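/- arXiv:2103.12108 — 5 statements merged into one kernel-verified Lean document; each statement's English description precedes it below -/
import Mathlib

section
/- Let f : ℂ → ℂ be holomorphic and injective on the open unit disc 𝔻 = {z ∈ ℂ : |z| < 1}, with f(0) = 0 and f'(0) = 1. Then for every z ∈ ℂ with |z| < 1, one has |z|/(1 + |z|)² ≤ |f(z)| ≤ |z|/(1 − |z|)². -/
open Metric Set MeasureTheory

/-- Integration over an annulus in polar coordinates. -/
theorem setIntegral_annulus_eq_integral_circleAverage {G : ℂ → ℝ} {r R : ℝ} (hr : 0 < r)
    (hG : ContinuousOn G {z | r ≤ ‖z‖ ∧ ‖z‖ ≤ R}) :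
    ∫ z in {z : ℂ | r < ‖z‖ ∧ ‖z‖ < R}, G z
      = ∫ t in Ioo r R, 2 * Real.pi * t * Real.circleAverage G 0 t := by
  have hA : MeasurableSet {z : ℂ | r < ‖z‖ ∧ ‖z‖ < R} :=
    ((isOpen_lt continuous_const continuous_norm).inter
      (isOpen_lt continuous_norm continuous_const)).measurableSet
  have hsymm : ∀ q : ℝ × ℝ, Complex.polarCoord.symm q = circleMap 0 q.1 q.2 := by
    intro q
    rw [Complex.polarCoord_symm_apply, circleMap, zero_add, Complex.exp_mul_I]
    push_cast
    rfl
  have hcont : ContinuousOn (fun q : ℝ × ℝ => q.1 * G (circleMap 0 q.1 q.2))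
      (Icc r R ×ˢ Icc (-Real.pi) Real.pi) := by
    refine continuousOn_fst.mul (hG.comp ?_ ?_)
    · simp only [circleMap]
      fun_prop
    · rintro ⟨t, θ⟩ ⟨ht, -⟩
      have : ‖circleMap 0 t θ‖ = t := by
        rw [norm_circleMap_zero, abs_of_pos (hr.trans_le ht.1)]
      simpa [this] using ht
  have hint : IntegrableOn (fun q : ℝ × ℝ => q.1 * G (circleMap 0 q.1 q.2))
      (Ioo r R ×ˢ Ioo (-Real.pi) Real.pi) (volume.prod volume) :=
    (hcont.integrableOn_compact (isCompact_Icc.prod isCompact_Icc)).mono_set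
      (prod_mono Ioo_subset_Icc_self Ioo_subset_Icc_self)
  have htarget : polarCoord.target ∩ (Ioo r R ×ˢ univ) = Ioo r R ×ˢ Ioo (-Real.pi) Real.pi := by
    ext ⟨t, θ⟩
    simp only [polarCoord_target, mem_inter_iff, mem_prod, mem_Ioi, mem_Ioo, mem_univ, and_true]
    constructor
    · rintro ⟨⟨-, h⟩, h'⟩
      exact ⟨h', h⟩
    · rintro ⟨h', h⟩
      exact ⟨⟨hr.trans h'.1, h⟩, h'⟩
  rw [← integral_indicator hA, ← Complex.integral_comp_polarCoord_symm]
  have hcongr : ∫ q in polarCoord.target, q.1 • ({z : ℂ | r < ‖z‖ ∧ ‖z‖ < R}.indicator G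
        (Complex.polarCoord.symm q))
      = ∫ q in polarCoord.target, (Ioo r R ×ˢ (univ : Set ℝ)).indicator
        (fun q : ℝ × ℝ => q.1 * G (circleMap 0 q.1 q.2)) q := by
    refine setIntegral_congr_fun polarCoord.open_target.measurableSet ?_
    rintro ⟨t, θ⟩ ht
    have ht0 : 0 < t := ht.1
    have hn : ‖circleMap 0 t θ‖ = t := by rw [norm_circleMap_zero, abs_of_pos ht0]
    simp only [hsymm]
    by_cases h : r < t ∧ t < R
    · rw [indicator_of_mem (by simpa [hn] using h), indicator_of_mem (by simpa using h),
        smul_eq_mul]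
    · rw [indicator_of_notMem (by simpa [hn] using h), indicator_of_notMem (by simpa using h),
        smul_zero]
  rw [hcongr, setIntegral_indicator (measurableSet_Ioo.prod MeasurableSet.univ), htarget,
    Measure.volume_eq_prod, setIntegral_prod _ hint]
  refine setIntegral_congr_fun measurableSet_Ioo fun t _ => ?_
  simp only
  rw [Real.circleAverage_eq_integral_add (-Real.pi),
    intervalIntegral.integral_comp_add_right (fun θ => G (circleMap 0 t θ)),
    integral_const_mul, ← integral_Ioc_eq_integral_Ioo,
    ← intervalIntegral.integral_of_le (by linarith [Real.pi_pos]), smul_eq_mul]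
  have hpi := Real.pi_ne_zero
  rw [zero_add, show 2 * Real.pi + -Real.pi = Real.pi by ring]
  field_simp

/-- The area of the image of an injective holomorphic map. -/
theorem volume_real_image_eq_integral_norm_deriv_sq {F F' : ℂ → ℂ} {A : Set ℂ}
    (hA : MeasurableSet A) (hF : ∀ z ∈ A, HasDerivAt F (F' z) z) (hinj : InjOn F A) :
    volume.real (F '' A) = ∫ z in A, ‖F' z‖ ^ 2 := by
  have h := integral_image_eq_integral_abs_det_fderiv_smul volume hA
    (fun z hz => ((hF z hz).hasFDerivAt.restrictScalars ℝ).hasFDerivWithinAt) hinj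
    (fun _ => (1 : ℝ))
  rw [setIntegral_const, smul_eq_mul, mul_one] at h
  rw [h]
  refine setIntegral_congr_fun hA fun z _ => ?_
  simp [ContinuousLinearMap.det, LinearMap.det_restrictScalars, Algebra.norm_complex_eq,
    Complex.normSq_eq_norm_sq]

theorem det_id_sub_smul_conj (β : ℂ) :
    LinearMap.det (LinearMap.id - β • Complex.conjAe.toLinearMap : ℂ →ₗ[ℝ] ℂ) = 1 - ‖β‖ ^ 2 := by
  rw [← LinearMap.det_toMatrix Complex.basisOneI, Matrix.det_fin_two,
    ← Complex.normSq_eq_norm_sq, Complex.normSq_apply]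
  simp [LinearMap.toMatrix_apply]
  ring

/-- Area bound for a subset of the ellipse `‖w - β * conj w‖ ≤ R`. -/
theorem mul_volume_real_le_of_norm_sub_conj_le {β : ℂ} (hβ : ‖β‖ ≤ 1) {s : Set ℂ} {R : ℝ}
    (hR : 0 ≤ R) (hs : ∀ w ∈ s, ‖w - β * (starRingEnd ℂ) w‖ ≤ R) :
    (1 - ‖β‖ ^ 2) * volume.real s ≤ Real.pi * R ^ 2 := by
  set M : ℂ →ₗ[ℝ] ℂ := LinearMap.id - β • Complex.conjAe.toLinearMap with hM
  have h1 : M '' s ⊆ closedBall 0 R := by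
    rintro _ ⟨w, hw, rfl⟩
    rw [mem_closedBall_zero_iff]
    simpa [hM] using hs w hw
  have h2 : volume (M '' s) ≤ volume (closedBall (0 : ℂ) R) := measure_mono h1
  rw [Measure.addHaar_image_linearMap, det_id_sub_smul_conj, Complex.volume_closedBall] at h2
  have hpos : 0 ≤ 1 - ‖β‖ ^ 2 := by nlinarith [norm_nonneg β]
  have h3 := ENNReal.toReal_mono (by finiteness) h2
  simp only [ENNReal.toReal_mul, abs_of_nonneg hpos, ENNReal.toReal_ofReal hpos,
    ENNReal.toReal_pow, ENNReal.toReal_ofReal hR, ENNReal.coe_toReal, NNReal.coe_real_pi] at h3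
  rw [Measure.real]
  linarith

theorem circleAverage_re_of_differentiableOn {Φ : ℂ → ℂ} {t : ℝ} (ht : 0 < t)
    (hΦ : DifferentiableOn ℂ Φ (ball 0 1)) (ht1 : t < 1) :
    Real.circleAverage (fun z => (Φ z).re) 0 t = (Φ 0).re := by
  have hd : DiffContOnCl ℂ Φ (ball 0 |t|) := by
    rw [abs_of_pos ht]
    exact (hΦ.mono (closedBall_subset_ball ht1)).diffContOnCl_ball subset_rfl
  have hc : CircleIntegrable Φ 0 t :=
    (hΦ.continuousOn.mono (sphere_subset_closedBall.trans
      (closedBall_subset_ball ht1))).circleIntegrable ht.le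
  have h := Complex.reCLM.circleAverage_comp_comm hc
  rw [hd.circleAverage] at h
  exact h

/-- Lower bound for the area of the image of an annulus under `z⁻¹ + p z`. -/
theorem le_integral_annulus_norm_deriv_sq {p : ℂ → ℂ} (hp : DifferentiableOn ℂ p (ball 0 1))
    {r R : ℝ} (hr : 0 < r) (hrR : r ≤ R) (hR : R < 1) :
    Real.pi * (1 / r ^ 2 - 1 / R ^ 2 + ‖deriv p 0‖ ^ 2 * (R ^ 2 - r ^ 2))
      ≤ ∫ z in {z : ℂ | r < ‖z‖ ∧ ‖z‖ < R}, ‖-(z ^ 2)⁻¹ + deriv p z‖ ^ 2 := by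
  set b := deriv p 0 with hb
  have hA : MeasurableSet {z : ℂ | r < ‖z‖ ∧ ‖z‖ < R} :=
    ((isOpen_lt continuous_const continuous_norm).inter
      (isOpen_lt continuous_norm continuous_const)).measurableSet
  have hK : IsCompact {z : ℂ | r ≤ ‖z‖ ∧ ‖z‖ ≤ R} := by
    refine (isCompact_closedBall (0 : ℂ) R).of_isClosed_subset
      ((isClosed_le continuous_const continuous_norm).inter
        (isClosed_le continuous_norm continuous_const)) fun z hz => ?_
    simpa using hz.2
  have hAK : {z : ℂ | r < ‖z‖ ∧ ‖z‖ < R} ⊆ {z : ℂ | r ≤ ‖z‖ ∧ ‖z‖ ≤ R} :=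
    fun z hz => ⟨hz.1.le, hz.2.le⟩
  have hKne : ∀ z ∈ {z : ℂ | r ≤ ‖z‖ ∧ ‖z‖ ≤ R}, z ≠ 0 := fun z hz =>
    norm_pos_iff.1 (hr.trans_le hz.1)
  have hp' : DifferentiableOn ℂ (deriv p) (ball 0 1) := hp.deriv isOpen_ball
  have hp'K : ContinuousOn (deriv p) {z : ℂ | r ≤ ‖z‖ ∧ ‖z‖ ≤ R} :=
    hp'.continuousOn.mono fun z hz => mem_ball_zero_iff.2 (hz.2.trans_lt hR)
  -- The tangent-line lower bound of `‖·‖ ^ 2` at `-z⁻² + b`, split by angular frequency.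
  set Φ : ℝ → ℂ → ℂ := fun t z => -(2 * b * z ^ 2) / (t : ℂ) ^ 4
    + 2 * (deriv p z - b) * (-z ^ 2 / (t : ℂ) ^ 4 + (starRingEnd ℂ) b) with hΦ
  set G : ℂ → ℝ := fun z => 1 / ‖z‖ ^ 4 + ‖b‖ ^ 2 + (Φ ‖z‖ z).re with hG
  have hGc : ContinuousOn G {z : ℂ | r ≤ ‖z‖ ∧ ‖z‖ ≤ R} := by
    have hne : ∀ z ∈ {z : ℂ | r ≤ ‖z‖ ∧ ‖z‖ ≤ R}, ‖z‖ ^ 4 ≠ 0 := fun z hz =>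
      pow_ne_zero 4 (norm_ne_zero_iff.2 (hKne z hz))
    have hne' : ∀ z ∈ {z : ℂ | r ≤ ‖z‖ ∧ ‖z‖ ≤ R}, (‖z‖ : ℂ) ^ 4 ≠ 0 := fun z hz => by
      exact_mod_cast hne z hz
    have h4 : ContinuousOn (fun z : ℂ => (‖z‖ : ℂ) ^ 4) {z : ℂ | r ≤ ‖z‖ ∧ ‖z‖ ≤ R} := by
      fun_prop
    refine ((continuousOn_const.div (by fun_prop) hne).add continuousOn_const).add
      (Complex.continuous_re.comp_continuousOn ?_)
    refine (ContinuousOn.div (by fun_prop) h4 hne').add ?_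
    exact (continuousOn_const.mul (hp'K.sub continuousOn_const)).mul
      ((ContinuousOn.div (by fun_prop) h4 hne').add continuousOn_const)
  have hFc : ContinuousOn (fun z : ℂ => ‖-(z ^ 2)⁻¹ + deriv p z‖ ^ 2)
      {z : ℂ | r ≤ ‖z‖ ∧ ‖z‖ ≤ R} := by
    refine ((ContinuousOn.add ?_ hp'K).norm).pow 2
    exact (ContinuousOn.inv₀ (by fun_prop) fun z hz => pow_ne_zero 2 (hKne z hz)).neg
  have hle : ∀ z ∈ {z : ℂ | r < ‖z‖ ∧ ‖z‖ < R}, G z ≤ ‖-(z ^ 2)⁻¹ + deriv p z‖ ^ 2 := by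
    intro z hz
    have hz0 := hKne z (hAK hz)
    have hzn : (‖z‖ : ℂ) ≠ 0 := by exact_mod_cast norm_ne_zero_iff.2 hz0
    set k := deriv p z - b with hk
    set v := (z ^ 2)⁻¹ with hv
    have hvc : z ^ 2 / (‖z‖ : ℂ) ^ 4 = (starRingEnd ℂ) v := by
      rw [hv, map_inv₀, map_pow, div_eq_iff (pow_ne_zero 4 hzn)]
      have h : (‖z‖ : ℂ) ^ 4 = (z * (starRingEnd ℂ) z) ^ 2 := by
        rw [Complex.mul_conj, Complex.normSq_eq_norm_sq]
        push_cast
        ring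
      have hc : (starRingEnd ℂ) z ≠ 0 := (map_ne_zero _).2 hz0
      rw [h]
      field_simp
    have hvn : 1 / ‖z‖ ^ 4 = Complex.normSq v := by
      rw [Complex.normSq_eq_norm_sq, hv, norm_inv, norm_pow]
      field_simp
    have hΦv : Φ ‖z‖ z = -(2 * b * (starRingEnd ℂ) v)
        + 2 * k * (-(starRingEnd ℂ) v + (starRingEnd ℂ) b) := by
      rw [← hvc]
      simp only [hΦ, ← hk]
      ring
    have hpk : -v + deriv p z = -v + b + k := by rw [hk]; ring
    simp only [hG]
    rw [hΦv, hvn, hpk, ← Complex.normSq_eq_norm_sq, ← Complex.normSq_eq_norm_sq]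
    simp only [Complex.normSq_apply, Complex.add_re, Complex.add_im, Complex.neg_re,
      Complex.neg_im, Complex.mul_re, Complex.mul_im, Complex.conj_re, Complex.conj_im,
      Complex.re_ofNat, Complex.im_ofNat]
    nlinarith [sq_nonneg k.re, sq_nonneg k.im]
  refine le_trans (le_of_eq ?_) (setIntegral_mono_on ((hGc.integrableOn_compact hK).mono_set hAK)
    ((hFc.integrableOn_compact hK).mono_set hAK) hA hle)
  rw [setIntegral_annulus_eq_integral_circleAverage hr hGc]
  have havg : ∀ t ∈ Ioo r R, 2 * Real.pi * t * Real.circleAverage G 0 t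
      = 2 * Real.pi * (t⁻¹ ^ 3 + ‖b‖ ^ 2 * t) := by
    intro t ht
    have ht0 : 0 < t := hr.trans ht.1
    have hΨ : DifferentiableOn ℂ (fun z => ((1 / t ^ 4 + ‖b‖ ^ 2 : ℝ) : ℂ) + Φ t z) (ball 0 1) := by
      refine (differentiableOn_const _).add (DifferentiableOn.add (by fun_prop) ?_)
      exact ((differentiableOn_const _).mul (hp'.sub (differentiableOn_const _))).mul
        (by fun_prop)
    have h1 : Real.circleAverage G 0 t = Real.circleAverage
        (fun z => (((1 / t ^ 4 + ‖b‖ ^ 2 : ℝ) : ℂ) + Φ t z).re) 0 t := by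
      refine Real.circleAverage_congr_sphere fun z hz => ?_
      rw [abs_of_pos ht0, mem_sphere_zero_iff_norm] at hz
      simp only [hG, hz, Complex.add_re, Complex.ofReal_re]
    rw [h1, circleAverage_re_of_differentiableOn ht0 hΨ (ht.2.trans hR)]
    have hΦ0 : Φ t 0 = 0 := by simp [hΦ, ← hb]
    rw [hΦ0, add_zero, Complex.ofReal_re]
    field_simp
  rw [setIntegral_congr_fun measurableSet_Ioo havg, ← integral_Ioc_eq_integral_Ioo,
    ← intervalIntegral.integral_of_le hrR]
  have hprim : ∀ t ∈ uIcc r R, HasDerivAt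
      (fun t : ℝ => Real.pi * (‖b‖ ^ 2 * t ^ 2 - (t ^ 2)⁻¹))
      (2 * Real.pi * (t⁻¹ ^ 3 + ‖b‖ ^ 2 * t)) t := by
    intro t ht
    rw [uIcc_of_le hrR] at ht
    have ht0 : t ≠ 0 := (hr.trans_le ht.1).ne'
    have hsq : HasDerivAt (fun t : ℝ => t ^ 2) (2 * t) t := by simpa using hasDerivAt_pow 2 t
    refine (((hsq.const_mul (‖b‖ ^ 2)).fun_sub
      (hsq.fun_inv (pow_ne_zero 2 ht0))).const_mul Real.pi).congr_deriv ?_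
    field_simp
    ring
  rw [intervalIntegral.integral_eq_sub_of_hasDerivAt hprim]
  · ring
  · refine ContinuousOn.intervalIntegrable fun t ht => ?_
    rw [uIcc_of_le hrR] at ht
    have ht0 : t ≠ 0 := (hr.trans_le ht.1).ne'
    exact (ContinuousAt.mul continuousAt_const
      (((continuousAt_inv₀ ht0).pow 3).add (by fun_prop))).continuousWithinAt

theorem exists_norm_sub_deriv_mul_le {p : ℂ → ℂ} (hp : DifferentiableOn ℂ p (ball 0 1))
    (hp0 : p 0 = 0) {R : ℝ} (hR : R < 1) :
    ∃ C, 0 ≤ C ∧ ∀ z : ℂ, ‖z‖ ≤ R → ‖p z - deriv p 0 * z‖ ≤ C * ‖z‖ ^ 2 := by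
  have hnhds := (isOpen_ball (x := (0 : ℂ)) (ε := 1)).mem_nhds (mem_ball_self one_pos)
  have hq : DifferentiableOn ℂ (dslope (dslope p 0) 0) (ball 0 1) :=
    (Complex.differentiableOn_dslope hnhds).2 ((Complex.differentiableOn_dslope hnhds).2 hp)
  obtain ⟨C, hC⟩ := (isCompact_closedBall (0 : ℂ) R).exists_bound_of_continuousOn
    (hq.continuousOn.mono (closedBall_subset_ball hR))
  refine ⟨max C 0, le_max_right _ _, fun z hz => ?_⟩
  have h1 := sub_smul_dslope p 0 z
  have h2 := sub_smul_dslope (dslope p 0) 0 z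
  simp only [sub_zero, hp0, smul_eq_mul, dslope_same] at h1 h2
  have h3 : p z - deriv p 0 * z = dslope (dslope p 0) 0 z * z ^ 2 := by
    linear_combination -h1 - z * h2
  rw [h3, norm_mul, norm_pow]
  gcongr
  exact (hC z (mem_closedBall_zero_iff.2 hz)).trans (le_max_left _ _)

/-- The map `z⁻¹ + b * z + O(z²)` sends `r < ‖z‖ < 1` into an ellipse whose area is `π / r ^ 2`
up to an error tending to zero with `r`. -/
theorem norm_inv_add_sub_conj_le {b z e : ℂ} {r C : ℝ} (hr : 0 < r) (hrz : r < ‖z‖)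
    (hz : ‖z‖ < 1) (hC : 0 ≤ C) (he : ‖e‖ ≤ C * ‖z‖ ^ 2)
    (hsmall : r * (2 * ‖b‖ + 2 * (C * (1 + ‖b‖))) ≤ 1) :
    ‖(z⁻¹ + (b * z + e)) - b * (r : ℂ) ^ 2 * (starRingEnd ℂ) (z⁻¹ + (b * z + e))‖
      ≤ 1 / r + (C * (1 + ‖b‖) + ‖b‖ ^ 2) * r ^ 2 := by
  set t := ‖z‖ with ht
  have ht0 : 0 < t := hr.trans hrz
  have hz0 : z ≠ 0 := norm_pos_iff.1 ht0
  have hzc : (starRingEnd ℂ) z ≠ 0 := (map_ne_zero _).2 hz0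
  have hexp : (z⁻¹ + (b * z + e)) - b * (r : ℂ) ^ 2 * (starRingEnd ℂ) (z⁻¹ + (b * z + e))
      = z⁻¹ + ((((t ^ 2 - r ^ 2) / t ^ 2 : ℝ) : ℂ) * (b * z) + (e +
        (-(b * (r : ℂ) ^ 2 * (starRingEnd ℂ) e)
          - b * (r : ℂ) ^ 2 * ((starRingEnd ℂ) b * (starRingEnd ℂ) z)))) := by
    have htt : (t : ℂ) ^ 2 = z * (starRingEnd ℂ) z := by
      rw [Complex.mul_conj, Complex.normSq_eq_norm_sq]
      push_cast
      rfl
    push_cast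
    rw [htt]
    simp only [map_add, map_inv₀, map_mul]
    field_simp
    ring
  have hrr : ‖(r : ℂ)‖ = r := by rw [Complex.norm_real, Real.norm_of_nonneg hr.le]
  have hsub : 0 ≤ t ^ 2 - r ^ 2 := by nlinarith
  have hnorm : ‖(z⁻¹ + (b * z + e)) - b * (r : ℂ) ^ 2 * (starRingEnd ℂ) (z⁻¹ + (b * z + e))‖
      ≤ 1 / t + ((t ^ 2 - r ^ 2) / t ^ 2 * (‖b‖ * t) + (‖e‖ +
        (‖b‖ * r ^ 2 * ‖e‖ + ‖b‖ * r ^ 2 * (‖b‖ * t)))) := by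
    rw [hexp]
    refine (norm_add_le _ _).trans (add_le_add (by rw [norm_inv, one_div])
      ((norm_add_le _ _).trans (add_le_add ?_ ((norm_add_le _ _).trans
        (add_le_add le_rfl ((norm_sub_le _ _).trans (add_le_add ?_ ?_)))))))
    · rw [norm_mul, norm_mul, Complex.norm_real, Real.norm_of_nonneg (by positivity)]
    · rw [norm_neg, norm_mul, norm_mul, norm_pow, hrr, RCLike.norm_conj]
    · rw [norm_mul, norm_mul, norm_mul, norm_pow, hrr, RCLike.norm_conj, RCLike.norm_conj]
  refine hnorm.trans ?_
  set B := ‖b‖ with hB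
  have hB0 : 0 ≤ B := norm_nonneg b
  have h1 : (t ^ 2 - r ^ 2) / t ^ 2 * (B * t) ≤ 2 * B * (t - r) := by
    have : (t ^ 2 - r ^ 2) / t ^ 2 * (B * t) = B * (t - r) * ((t + r) / t) := by
      field_simp
      ring
    rw [this]
    have h2 : (t + r) / t ≤ 2 := by rw [div_le_iff₀ ht0]; linarith
    nlinarith [mul_le_mul_of_nonneg_left h2 (mul_nonneg hB0 (sub_nonneg.2 hrz.le))]
  have hr2 : r ^ 2 ≤ 1 := by nlinarith
  have h2 : ‖e‖ + B * r ^ 2 * ‖e‖ ≤ C * (1 + B) * t ^ 2 := by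
    have : B * r ^ 2 * ‖e‖ ≤ B * (C * t ^ 2) := by
      have hbr : B * r ^ 2 ≤ B := by nlinarith
      exact mul_le_mul hbr he (norm_nonneg _) hB0
    linarith
  have hD : 0 ≤ C * (1 + B) := by positivity
  have h3 : C * (1 + B) * t ^ 2 ≤ C * (1 + B) * r ^ 2 + 2 * (C * (1 + B)) * (t - r) := by
    have : t ^ 2 ≤ r ^ 2 + 2 * (t - r) := by nlinarith
    nlinarith [mul_le_mul_of_nonneg_left this hD]
  have h4 : B * r ^ 2 * (B * t) ≤ B ^ 2 * r ^ 2 := by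
    have : 0 ≤ B ^ 2 * r ^ 2 := by positivity
    nlinarith
  have h5 : (2 * B + 2 * (C * (1 + B))) * (t - r) ≤ 1 / r - 1 / t := by
    have : 1 / r - 1 / t = (t - r) / (r * t) := by field_simp
    rw [this, le_div_iff₀ (by positivity)]
    have ht1 : r * (2 * B + 2 * (C * (1 + B))) * t ≤ 1 := by
      have : 0 ≤ r * (2 * B + 2 * (C * (1 + B))) := by positivity
      nlinarith
    nlinarith [mul_le_mul_of_nonneg_right ht1 (sub_nonneg.2 hrz.le)]
  linarith

/-- **Area theorem**, first coefficient: if `z⁻¹ + p z` is injective on the punctured disc and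
`p 0 = 0`, then `‖p' 0‖ ≤ 1`. -/
theorem norm_deriv_zero_le_one_of_injOn_inv_add {p : ℂ → ℂ}
    (hp : DifferentiableOn ℂ p (ball 0 1)) (hp0 : p 0 = 0)
    (hinj : InjOn (fun z => z⁻¹ + p z) (ball 0 1 \ {0})) : ‖deriv p 0‖ ≤ 1 := by
  set b := deriv p 0 with hb
  have key : ∀ R : ℝ, 0 < R → R < 1 → ‖b‖ ^ 2 * R ^ 2 - 1 / R ^ 2 ≤ 0 := by
    intro R hR0 hR
    obtain ⟨C, hC0, hC⟩ := exists_norm_sub_deriv_mul_le hp hp0 hR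
    set D := C * (1 + ‖b‖) + ‖b‖ ^ 2 with hD
    have hineq : ∀ r : ℝ, 0 < r → r < R → r * (2 * ‖b‖ + 2 * (C * (1 + ‖b‖))) ≤ 1 →
        (‖b‖ ^ 2 * (R ^ 2 - r ^ 2) - 1 / R ^ 2) * (1 - ‖b‖ ^ 2 * r ^ 4)
          ≤ 2 * D * r + D ^ 2 * r ^ 4 + ‖b‖ ^ 2 * r ^ 2 := by
      intro r hr hrR hsmall
      set A := {z : ℂ | r < ‖z‖ ∧ ‖z‖ < R} with hAdef
      have hA : MeasurableSet A :=
        ((isOpen_lt continuous_const continuous_norm).inter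
          (isOpen_lt continuous_norm continuous_const)).measurableSet
      have hAsub : A ⊆ ball 0 1 \ {0} := fun z hz =>
        ⟨mem_ball_zero_iff.2 (hz.2.trans hR), norm_pos_iff.1 (hr.trans hz.1)⟩
      have hF : ∀ z ∈ A, HasDerivAt (fun z => z⁻¹ + p z) (-(z ^ 2)⁻¹ + deriv p z) z :=
        fun z hz => (hasDerivAt_inv (hAsub hz).2).fun_add
          (hp.differentiableAt (isOpen_ball.mem_nhds (hAsub hz).1)).hasDerivAt
      have hlow := le_integral_annulus_norm_deriv_sq hp hr hrR.le hR
      rw [← volume_real_image_eq_integral_norm_deriv_sq hA hF (hinj.mono hAsub), ← hb] at hlow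
      have hβ : ‖b * (r : ℂ) ^ 2‖ = ‖b‖ * r ^ 2 := by
        rw [norm_mul, norm_pow, Complex.norm_real, Real.norm_of_nonneg hr.le]
      have hβ1 : ‖b‖ * r ^ 2 ≤ 1 := by
        have h1 : 0 ≤ C * (1 + ‖b‖) := by positivity
        nlinarith [norm_nonneg b, mul_nonneg hr.le h1, mul_nonneg (norm_nonneg b) hr.le]
      have hup := mul_volume_real_le_of_norm_sub_conj_le (β := b * (r : ℂ) ^ 2)
        (s := (fun z => z⁻¹ + p z) '' A) (R := 1 / r + D * r ^ 2) (by rw [hβ]; exact hβ1)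
        (by positivity) (by
          rintro _ ⟨z, hz, rfl⟩
          have h := norm_inv_add_sub_conj_le (b := b) hr hz.1 (hz.2.trans hR) hC0
            (hC z hz.2.le) hsmall
          rwa [← hb, add_sub_cancel] at h)
      rw [hβ] at hup
      have hpos : 0 ≤ 1 - (‖b‖ * r ^ 2) ^ 2 := by
        have : 0 ≤ ‖b‖ * r ^ 2 := by positivity
        nlinarith
      have h := (mul_le_mul_of_nonneg_left hlow hpos).trans hup
      have h' : (1 - (‖b‖ * r ^ 2) ^ 2) * (1 / r ^ 2 - 1 / R ^ 2 + ‖b‖ ^ 2 * (R ^ 2 - r ^ 2))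
          ≤ (1 / r + D * r ^ 2) ^ 2 := by
        refine le_of_mul_le_mul_left ?_ Real.pi_pos
        linarith
      have e1 : (1 - (‖b‖ * r ^ 2) ^ 2) * (1 / r ^ 2) = 1 / r ^ 2 - ‖b‖ ^ 2 * r ^ 2 := by
        field_simp
      have e2 : (1 / r + D * r ^ 2) ^ 2 = 1 / r ^ 2 + (2 * D * r + D ^ 2 * r ^ 4) := by
        field_simp
        ring
      linarith
    have hlim1 : Filter.Tendsto
        (fun r : ℝ => (‖b‖ ^ 2 * (R ^ 2 - r ^ 2) - 1 / R ^ 2) * (1 - ‖b‖ ^ 2 * r ^ 4))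
        (nhdsWithin 0 (Ioi 0)) (nhds (‖b‖ ^ 2 * R ^ 2 - 1 / R ^ 2)) := by
      have h : Continuous
          (fun r : ℝ => (‖b‖ ^ 2 * (R ^ 2 - r ^ 2) - 1 / R ^ 2) * (1 - ‖b‖ ^ 2 * r ^ 4)) := by
        fun_prop
      simpa using (h.tendsto 0).mono_left nhdsWithin_le_nhds
    have hlim2 : Filter.Tendsto
        (fun r : ℝ => 2 * D * r + D ^ 2 * r ^ 4 + ‖b‖ ^ 2 * r ^ 2)
        (nhdsWithin 0 (Ioi 0)) (nhds 0) := by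
      have h : Continuous (fun r : ℝ => 2 * D * r + D ^ 2 * r ^ 4 + ‖b‖ ^ 2 * r ^ 2) := by
        fun_prop
      simpa using (h.tendsto 0).mono_left nhdsWithin_le_nhds
    have hlim3 : Filter.Tendsto
        (fun r : ℝ => r * (2 * ‖b‖ + 2 * (C * (1 + ‖b‖)))) (nhdsWithin 0 (Ioi 0)) (nhds 0) := by
      have h : Continuous (fun r : ℝ => r * (2 * ‖b‖ + 2 * (C * (1 + ‖b‖)))) := by fun_prop
      simpa using (h.tendsto 0).mono_left nhdsWithin_le_nhds
    refine le_of_tendsto_of_tendsto hlim1 hlim2 ?_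
    filter_upwards [Ioo_mem_nhdsGT hR0, hlim3.eventually_le_const one_pos] with r hr hr'
    exact hineq r hr.1 hr.2 hr'
  have hlim : Filter.Tendsto (fun R : ℝ => ‖b‖ ^ 2 * R ^ 2 - 1 / R ^ 2)
      (nhdsWithin 1 (Iio 1)) (nhds (‖b‖ ^ 2 * 1 ^ 2 - 1 / 1 ^ 2)) := by
    refine Filter.Tendsto.mono_left ?_ nhdsWithin_le_nhds
    exact ContinuousAt.tendsto
      (ContinuousAt.sub (by fun_prop) (continuousAt_const.div (by fun_prop) (by norm_num)))
  have hfin := le_of_tendsto hlim (by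
    filter_upwards [Ioo_mem_nhdsLT one_pos] with R hR using key R hR.1 hR.2)
  nlinarith [norm_nonneg b]

/-- A zero-free holomorphic function on the unit disc has a holomorphic square root. -/
theorem exists_differentiableOn_sq_eq {ψ : ℂ → ℂ} (hψ : DifferentiableOn ℂ ψ (ball 0 1))
    (hne : ∀ z ∈ ball (0 : ℂ) 1, ψ z ≠ 0) (h0 : ψ 0 = 1) :
    ∃ s : ℂ → ℂ, DifferentiableOn ℂ s (ball 0 1) ∧ s 0 = 1 ∧
      ∀ z ∈ ball (0 : ℂ) 1, s z ^ 2 = ψ z := by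
  have hmem : (0 : ℂ) ∈ ball (0 : ℂ) 1 := by simp
  have hd : DifferentiableOn ℂ (fun z => deriv ψ z / ψ z) (ball 0 1) :=
    (hψ.deriv isOpen_ball).div hψ hne
  obtain ⟨L, hL0, hL⟩ := hd.isExactOn_ball.with_val_at 0 0
  have hψd : ∀ z ∈ ball (0 : ℂ) 1, HasDerivAt ψ (deriv ψ z) z := fun z hz =>
    (hψ.differentiableAt (isOpen_ball.mem_nhds hz)).hasDerivAt
  have hconst : ∀ z ∈ ball (0 : ℂ) 1, ψ z * Complex.exp (-L z) = 1 := by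
    have hder : ∀ z ∈ ball (0 : ℂ) 1,
        HasDerivAt (fun z => ψ z * Complex.exp (-L z)) 0 z := by
      intro z hz
      refine ((hψd z hz).fun_mul (hL z hz).fun_neg.cexp).congr_deriv ?_
      have := hne z hz
      field_simp
      ring
    intro z hz
    have h := (isOpen_ball (x := (0 : ℂ)) (ε := 1)).is_const_of_deriv_eq_zero
      (convex_ball (0 : ℂ) 1).isPreconnected
      (fun z hz => (hder z hz).differentiableAt.differentiableWithinAt)
      (fun z hz => (hder z hz).deriv) hz hmem
    simpa [h0, hL0] using h
  refine ⟨fun z => Complex.exp (L z / 2), fun z hz =>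
    ((hL z hz).div_const 2).cexp.differentiableAt.differentiableWithinAt, by simp [hL0], ?_⟩
  intro z hz
  have h := hconst z hz
  rw [Complex.exp_neg, mul_inv_eq_one₀ (Complex.exp_ne_zero _)] at h
  rw [h, ← Complex.exp_nat_mul]
  congr 1
  push_cast
  ring

/-- **Bieberbach's inequality** for the reciprocal `ψ z / z` of a schlicht function. -/
theorem norm_deriv_zero_le_two_of_injOn_div {ψ : ℂ → ℂ}
    (hψ : DifferentiableOn ℂ ψ (ball 0 1)) (hne : ∀ z ∈ ball (0 : ℂ) 1, ψ z ≠ 0)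
    (h0 : ψ 0 = 1) (hinj : InjOn (fun z => ψ z / z) (ball 0 1 \ {0})) : ‖deriv ψ 0‖ ≤ 2 := by
  obtain ⟨s, hs, hs0, hsq⟩ := exists_differentiableOn_sq_eq hψ hne h0
  have hmem : (0 : ℂ) ∈ ball (0 : ℂ) 1 := by simp
  have hnhds := (isOpen_ball (x := (0 : ℂ)) (ε := 1)).mem_nhds hmem
  have hsqmem : ∀ z ∈ ball (0 : ℂ) 1, z ^ 2 ∈ ball (0 : ℂ) 1 := by
    intro z hz
    simp only [mem_ball_zero_iff, norm_pow] at *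
    exact pow_lt_one₀ (norm_nonneg _) hz two_ne_zero
  have hσ : DifferentiableOn ℂ (dslope s 0) (ball 0 1) :=
    (Complex.differentiableOn_dslope hnhds).2 hs
  have hσsq : DifferentiableOn ℂ (fun z => dslope s 0 (z ^ 2)) (ball 0 1) :=
    hσ.comp (by fun_prop) hsqmem
  have hF : ∀ z : ℂ, z ≠ 0 → z⁻¹ + z * dslope s 0 (z ^ 2) = s (z ^ 2) / z := by
    intro z hz
    rw [dslope_of_ne _ (pow_ne_zero 2 hz), slope_def_field, hs0]
    field_simp
    ring
  have hp1 : ‖deriv (fun z => z * dslope s 0 (z ^ 2)) 0‖ ≤ 1 := by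
    refine norm_deriv_zero_le_one_of_injOn_inv_add (differentiableOn_id.mul hσsq) (by simp) ?_
    rintro z ⟨hz, hz0⟩ w ⟨hw, hw0⟩ h
    rw [mem_singleton_iff] at hz0 hw0
    simp only [hF z hz0, hF w hw0] at h
    have h2 : ψ (z ^ 2) / z ^ 2 = ψ (w ^ 2) / w ^ 2 := by
      rw [← hsq _ (hsqmem z hz), ← hsq _ (hsqmem w hw), ← div_pow, ← div_pow, h]
    have h3 : z ^ 2 = w ^ 2 := hinj ⟨hsqmem z hz, by simpa using hz0⟩
      ⟨hsqmem w hw, by simpa using hw0⟩ h2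
    rcases sq_eq_sq_iff_eq_or_eq_neg.1 h3 with h4 | h4
    · exact h4
    · have hsw : s (w ^ 2) ≠ 0 := fun hc =>
        hne _ (hsqmem w hw) (by rw [← hsq _ (hsqmem w hw), hc]; simp)
      rw [h3, h4] at h
      field_simp at h
      grind
  have hs' : HasDerivAt s (deriv s 0) 0 := (hs.differentiableAt hnhds).hasDerivAt
  have hpd : deriv (fun z => z * dslope s 0 (z ^ 2)) 0 = deriv s 0 := by
    have h := (hasDerivAt_id (0 : ℂ)).mul (hσsq.differentiableAt hnhds).hasDerivAt
    have h' := h.deriv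
    simp only [id, zero_mul, add_zero, one_mul, ne_eq, OfNat.ofNat_ne_zero, not_false_eq_true,
      zero_pow, dslope_same] at h'
    exact h'
  have hψ' : deriv ψ 0 = 2 * deriv s 0 := by
    have h : (fun z => s z ^ 2) =ᶠ[nhds 0] ψ := by
      filter_upwards [hnhds] with z hz using hsq z hz
    rw [← h.deriv_eq, (hs'.fun_pow 2).deriv, hs0]
    simp
  rw [hψ', norm_mul]
  rw [hpd] at hp1
  norm_num
  linarith

/-- **Koebe quarter theorem**: an omitted value `w` satisfies `‖f' 0‖ ≤ 4 * ‖w‖`. -/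
theorem norm_deriv_zero_le_four_mul_of_notMem_image {f : ℂ → ℂ}
    (hf : DifferentiableOn ℂ f (ball 0 1)) (hinj : InjOn f (ball 0 1)) (h0 : f 0 = 0) {w : ℂ}
    (hw : ∀ z ∈ ball (0 : ℂ) 1, f z ≠ w) : ‖deriv f 0‖ ≤ 4 * ‖w‖ := by
  have hmem : (0 : ℂ) ∈ ball (0 : ℂ) 1 := by simp
  have hnhds := (isOpen_ball (x := (0 : ℂ)) (ε := 1)).mem_nhds hmem
  rcases eq_or_ne (deriv f 0) 0 with hd | hd
  · rw [hd, norm_zero]; positivity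
  have hw0 : w ≠ 0 := fun h => hw 0 hmem (by rw [h0, h])
  set φ := dslope f 0 with hφdef
  have hφ : DifferentiableOn ℂ φ (ball 0 1) := (Complex.differentiableOn_dslope hnhds).2 hf
  have hfφ : ∀ z, f z = z * φ z := by
    intro z
    have := sub_smul_dslope f 0 z
    simpa [h0, eq_comm] using this
  have hφ0 : φ 0 = deriv f 0 := dslope_same f 0
  have hφne : ∀ z ∈ ball (0 : ℂ) 1, φ z ≠ 0 := by
    intro z hz h
    rcases eq_or_ne z 0 with rfl | hz0
    · exact hd (hφ0 ▸ h)
    · exact hz0 (hinj hz hmem (by rw [hfφ z, h, h0, mul_zero]))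
  set d := deriv f 0
  have key : ∀ v : ℂ, (∀ z ∈ ball (0 : ℂ) 1, v * f z ≠ 1) →
      ‖deriv (fun z => d / φ z) 0 - d * v‖ ≤ 2 := by
    intro v hv
    have hq : DifferentiableOn ℂ (fun z => d / φ z) (ball 0 1) :=
      (differentiableOn_const d).div hφ hφne
    have hψ : DifferentiableOn ℂ (fun z => d / φ z - d * v * z) (ball 0 1) :=
      hq.sub (by fun_prop)
    have hder : deriv (fun z => d / φ z - d * v * z) 0
        = deriv (fun z => d / φ z) 0 - d * v := by
      have h := (hq.differentiableAt hnhds).hasDerivAt.fun_sub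
        ((hasDerivAt_id (0 : ℂ)).const_mul (d * v))
      simpa using h.deriv
    rw [← hder]
    refine norm_deriv_zero_le_two_of_injOn_div hψ ?_ (by simp [hφ0, hd]) ?_
    · intro z hz h
      apply hv z hz
      have := hφne z hz
      rw [hfφ z]
      have hdz : d * (v * (z * φ z) - 1) = 0 := by
        field_simp at h
        linear_combination -h
      exact sub_eq_zero.1 ((mul_eq_zero.1 hdz).resolve_left hd)
    · rintro z ⟨hz, hz0⟩ y ⟨hy, hy0⟩ h
      rw [mem_singleton_iff] at hz0 hy0
      have h1 := hφne z hz
      have h2 := hφne y hy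
      refine hinj hz hy ?_
      rw [hfφ z, hfφ y]
      simp only [sub_div, mul_div_assoc, div_self hz0, div_self hy0, sub_left_inj] at h
      field_simp at h
      rw [mul_comm z, mul_comm y]
      exact h.symm
  have h1 := key 0 (by simp)
  have h2 := key w⁻¹ (fun z hz h => hw z hz (by field_simp at h; exact h))
  rw [mul_zero, sub_zero] at h1
  have h3 : ‖d * w⁻¹‖ ≤ 4 := by
    have : d * w⁻¹ = deriv (fun z => d / φ z) 0 - (deriv (fun z => d / φ z) 0 - d * w⁻¹) := by
      ring
    rw [this]
    exact (norm_sub_le _ _).trans (by linarith)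
  rwa [← div_eq_mul_inv, norm_div, div_le_iff₀ (norm_pos_iff.2 hw0)] at h3

theorem re_cayley_pos {z : ℂ} (hz : ‖z‖ < 1) : 0 < ((1 + z) / (1 - z)).re := by
  have hne : 1 - z ≠ 0 := fun h => by
    rw [← sub_eq_zero.1 h, norm_one] at hz
    exact lt_irrefl _ hz
  have hsq : z.re * z.re + z.im * z.im < 1 := by
    rw [← Complex.normSq_apply, Complex.normSq_eq_norm_sq]
    exact pow_lt_one₀ (norm_nonneg _) hz two_ne_zero
  rw [Complex.div_re, ← add_div]
  refine div_pos ?_ (Complex.normSq_pos.2 hne)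
  simp only [Complex.add_re, Complex.one_re, Complex.sub_re, Complex.add_im, Complex.one_im,
    Complex.sub_im]
  nlinarith

theorem norm_inverse_cayley_lt_one {S : ℂ} (hS : 0 < S.re) : ‖(S - 1) / (S + 1)‖ < 1 := by
  have hne : S + 1 ≠ 0 := fun h => by
    have := congrArg Complex.re h
    simp only [Complex.add_re, Complex.one_re, Complex.zero_re] at this
    linarith
  rw [norm_div, div_lt_one (norm_pos_iff.2 hne)]
  refine lt_of_pow_lt_pow_left₀ 2 (norm_nonneg _) ?_
  rw [← Complex.normSq_eq_norm_sq, ← Complex.normSq_eq_norm_sq, Complex.normSq_apply,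
    Complex.normSq_apply]
  simp only [Complex.add_re, Complex.one_re, Complex.sub_re, Complex.add_im, Complex.one_im,
    Complex.sub_im]
  nlinarith

theorem re_exp_half_log_pos {w : ℂ} (hw : w ∈ Complex.slitPlane) :
    0 < (Complex.exp (Complex.log w / 2)).re := by
  rw [Complex.exp_re]
  have him : (Complex.log w / 2).im = w.arg / 2 := by
    rw [← Complex.log_im]
    simp
  rw [him]
  have h1 := Complex.neg_pi_lt_arg w
  have h2 := Complex.arg_le_pi w
  have h3 : w.arg ≠ Real.pi := (Complex.mem_slitPlane_iff_arg.1 hw).1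
  have h4 := lt_of_le_of_ne h2 h3
  exact mul_pos (Real.exp_pos _) (Real.cos_pos_of_mem_Ioo ⟨by linarith, by linarith⟩)

/-- The conformal map of the unit disc onto the disc slit along `(-1, -r]`. -/
theorem exists_slit_disc_map {r : ℝ} (hr0 : 0 < r) (hr1 : r < 1) :
    ∃ p : ℂ → ℂ, DifferentiableOn ℂ p (ball 0 1) ∧ MapsTo p (ball 0 1) (ball 0 1) ∧
      InjOn p (ball 0 1) ∧ p 0 = 0 ∧ deriv p 0 = ((4 * r / (1 + r) ^ 2 : ℝ) : ℂ) ∧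
      ∀ z ∈ ball (0 : ℂ) 1, p z ≠ -r := by
  set c : ℝ := 4 * r / (1 + r) ^ 2 with hc
  have hc0 : 0 < c := by positivity
  have hcr : 1 - c = ((1 - r) / (1 + r)) ^ 2 := by
    rw [hc]
    field_simp
    ring
  have hc1 : 0 < 1 - c := by
    rw [hcr]
    exact pow_pos (div_pos (by linarith) (by linarith)) 2
  set C : ℂ → ℂ := fun z => (1 + z) / (1 - z) with hC
  set W : ℂ → ℂ := fun z => c * C z ^ 2 + ((1 - c : ℝ) : ℂ) with hW
  set S : ℂ → ℂ := fun z => Complex.exp (Complex.log (W z) / 2) with hSdef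
  have hne : ∀ z ∈ ball (0 : ℂ) 1, 1 - z ≠ 0 := by
    intro z hz h
    rw [← sub_eq_zero.1 h] at hz
    simp at hz
  have hCre : ∀ z ∈ ball (0 : ℂ) 1, 0 < (C z).re := fun z hz =>
    re_cayley_pos (mem_ball_zero_iff.1 hz)
  have hWslit : ∀ z ∈ ball (0 : ℂ) 1, W z ∈ Complex.slitPlane := by
    intro z hz
    have h := hCre z hz
    rw [Complex.mem_slitPlane_iff]
    rcases eq_or_ne (C z).im 0 with him | him
    · left
      simp only [hW, sq, Complex.add_re, Complex.mul_re, him, Complex.ofReal_re,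
        Complex.ofReal_im]
      nlinarith [mul_pos h h, mul_pos hc0 (mul_pos h h)]
    · right
      simp only [hW, sq, Complex.add_im, Complex.mul_im, Complex.ofReal_im, Complex.ofReal_re,
        add_zero, zero_mul]
      have : (C z).re * (C z).im ≠ 0 := mul_ne_zero h.ne' him
      intro hcon
      rcases mul_eq_zero.1 hcon with h' | h'
      · exact hc0.ne' h'
      · apply this; linarith
  have hSre : ∀ z ∈ ball (0 : ℂ) 1, 0 < (S z).re := fun z hz =>
    re_exp_half_log_pos (hWslit z hz)
  have hS1 : ∀ z ∈ ball (0 : ℂ) 1, S z + 1 ≠ 0 := by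
    intro z hz h
    have := congrArg Complex.re h
    simp only [Complex.add_re, Complex.one_re, Complex.zero_re] at this
    linarith [hSre z hz]
  have hSsq : ∀ z ∈ ball (0 : ℂ) 1, S z ^ 2 = W z := by
    intro z hz
    rw [hSdef]
    simp only
    rw [← Complex.exp_nat_mul, Nat.cast_ofNat, mul_div_cancel₀ _ (two_ne_zero' ℂ),
      Complex.exp_log (Complex.slitPlane_ne_zero (hWslit z hz))]
  have hCd : ∀ z ∈ ball (0 : ℂ) 1, HasDerivAt C (2 / (1 - z) ^ 2) z := by
    intro z hz
    have h := ((hasDerivAt_id z).const_add 1).fun_div ((hasDerivAt_id z).const_sub 1) (hne z hz)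
    refine h.congr_deriv ?_
    simp only [id]
    ring
  have hWd : ∀ z ∈ ball (0 : ℂ) 1, HasDerivAt W (c * (2 * C z * (2 / (1 - z) ^ 2))) z := by
    intro z hz
    have h := (((hCd z hz).fun_pow 2).const_mul (c : ℂ)).add_const ((1 - c : ℝ) : ℂ)
    refine h.congr_deriv ?_
    norm_num
  have hSd : ∀ z ∈ ball (0 : ℂ) 1,
      HasDerivAt S (S z * (c * (2 * C z * (2 / (1 - z) ^ 2)) / W z / 2)) z := fun z hz =>
    (((hWd z hz).clog (hWslit z hz)).div_const 2).cexp
  have hpd : ∀ z ∈ ball (0 : ℂ) 1, HasDerivAt (fun z => (S z - 1) / (S z + 1)) _ z := fun z hz =>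
    ((hSd z hz).sub_const 1).fun_div ((hSd z hz).add_const 1) (hS1 z hz)
  have hmem : (0 : ℂ) ∈ ball (0 : ℂ) 1 := by simp
  have hC0 : C 0 = 1 := by simp [hC]
  have hW0 : W 0 = 1 := by simp [hW, hC0]
  have hS0 : S 0 = 1 := by simp [hSdef, hW0]
  refine ⟨fun z => (S z - 1) / (S z + 1),
    fun z hz => (hpd z hz).differentiableAt.differentiableWithinAt, ?_, ?_, by simp [hS0], ?_, ?_⟩
  · intro z hz
    exact mem_ball_zero_iff.2 (norm_inverse_cayley_lt_one (hSre z hz))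
  · intro z hz w hw h
    have h1 := hS1 z hz
    have h2 := hS1 w hw
    have hSS : S z = S w := by
      simp only at h
      rw [div_eq_div_iff h1 h2] at h
      linear_combination h / 2
    have hWW : W z = W w := by rw [← hSsq z hz, ← hSsq w hw, hSS]
    have hCC : C z ^ 2 = C w ^ 2 := by
      have hcc : (c : ℂ) ≠ 0 := by exact_mod_cast hc0.ne'
      exact mul_left_cancel₀ hcc (add_right_cancel hWW)
    have hCC' : C z = C w := by
      rcases sq_eq_sq_iff_eq_or_eq_neg.1 hCC with h' | h'
      · exact h'
      · have := congrArg Complex.re h'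
        rw [Complex.neg_re] at this
        linarith [hCre z hz, hCre w hw]
    simp only [hC] at hCC'
    rw [div_eq_div_iff (hne z hz) (hne w hw)] at hCC'
    linear_combination hCC' / 2
  · rw [(hpd 0 hmem).deriv, hS0, hW0, hC0]
    norm_num
  · intro z hz h
    have h1 := hS1 z hz
    have hr' : (1 + r : ℂ) ≠ 0 := by exact_mod_cast (by linarith : (1 + r : ℝ) ≠ 0)
    simp only at h
    rw [div_eq_iff h1] at h
    have hS : S z = ((1 - r) / (1 + r) : ℂ) := by
      rw [eq_div_iff hr']
      linear_combination h
    have hWz : W z = ((1 - c : ℝ) : ℂ) := by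
      rw [← hSsq z hz, hS, hcr]
      push_cast
      ring
    have : (c : ℂ) * C z ^ 2 = 0 := by
      simp only [hW] at hWz
      linear_combination hWz
    rcases mul_eq_zero.1 this with h' | h'
    · exact hc0.ne' (by exact_mod_cast h')
    · have hz' := hCre z hz
      rw [pow_eq_zero_iff two_ne_zero] at h'
      rw [h'] at hz'
      simp at hz'

/-- Lower growth bound, obtained by composing with the map onto a slit disc which omits `z`. -/
theorem norm_deriv_zero_mul_norm_le {f : ℂ → ℂ}
    (hf : DifferentiableOn ℂ f (ball 0 1)) (hinj : InjOn f (ball 0 1)) (h0 : f 0 = 0)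
    {z : ℂ} (hz : ‖z‖ < 1) : ‖deriv f 0‖ * ‖z‖ ≤ (1 + ‖z‖) ^ 2 * ‖f z‖ := by
  rcases eq_or_ne z 0 with rfl | hz0
  · simp [h0]
  have hr : 0 < ‖z‖ := norm_pos_iff.2 hz0
  obtain ⟨p, hp, hpm, hpi, hp0, hpd, hpr⟩ := exists_slit_disc_map hr hz
  have hrc : (‖z‖ : ℂ) ≠ 0 := by exact_mod_cast hr.ne'
  set u : ℂ := -(z / ‖z‖) with hu
  have hu1 : ‖u‖ = 1 := by simp [hu, hr.ne']
  have hu0 : u ≠ 0 := by rw [← norm_pos_iff, hu1]; exact one_pos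
  have hm : MapsTo (fun ζ => u * p ζ) (ball 0 1) (ball 0 1) := by
    intro ζ hζ
    have := hpm hζ
    simp only [mem_ball_zero_iff, norm_mul, hu1, one_mul] at *
    exact this
  have hup : DifferentiableOn ℂ (fun ζ => u * p ζ) (ball 0 1) := hp.const_mul u
  have hmem : (0 : ℂ) ∈ ball (0 : ℂ) 1 := by simp
  have hnhds := (isOpen_ball (x := (0 : ℂ)) (ε := 1)).mem_nhds hmem
  have key := norm_deriv_zero_le_four_mul_of_notMem_image (f := fun ζ => f (u * p ζ)) (w := f z)
    (hf.comp hup hm)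
    (fun ζ hζ η hη h => hpi hζ hη (mul_left_cancel₀ hu0 (hinj (hm hζ) (hm hη) h)))
    (by simp [hp0, h0])
    (fun ζ hζ h => by
      have h1 : u * p ζ = z := hinj (hm hζ) (mem_ball_zero_iff.2 hz) h
      apply hpr ζ hζ
      apply mul_left_cancel₀ hu0
      rw [h1, hu]
      field_simp)
  have hd : deriv (fun ζ => f (u * p ζ)) 0
      = deriv f 0 * (u * ((4 * ‖z‖ / (1 + ‖z‖) ^ 2 : ℝ) : ℂ)) := by
    have h1 : HasDerivAt (fun ζ => u * p ζ) (u * deriv p 0) 0 :=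
      (hp.differentiableAt hnhds).hasDerivAt.const_mul u
    have h2 : HasDerivAt f (deriv f 0) (u * p 0) := by
      rw [hp0, mul_zero]
      exact (hf.differentiableAt hnhds).hasDerivAt
    rw [← hpd]
    exact (h2.comp 0 h1).deriv
  rw [hd, norm_mul, norm_mul, hu1, one_mul, Complex.norm_real, Real.norm_of_nonneg (by positivity),
    ← mul_div_assoc, div_le_iff₀ (by positivity)] at key
  linarith

theorem norm_disc_automorphism_lt_one {a ζ : ℂ} (ha : ‖a‖ < 1) (hζ : ‖ζ‖ < 1) :
    1 + (starRingEnd ℂ) a * ζ ≠ 0 ∧ ‖(ζ + a) / (1 + (starRingEnd ℂ) a * ζ)‖ < 1 := by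
  have hne : 1 + (starRingEnd ℂ) a * ζ ≠ 0 := by
    intro h
    have h1 : (starRingEnd ℂ) a * ζ = -1 := by linear_combination h
    have h2 := congrArg norm h1
    rw [norm_mul, RCLike.norm_conj, norm_neg, norm_one] at h2
    nlinarith [norm_nonneg a, norm_nonneg ζ]
  refine ⟨hne, ?_⟩
  have ha2 : a.re * a.re + a.im * a.im < 1 := by
    rw [← Complex.normSq_apply, Complex.normSq_eq_norm_sq]
    exact pow_lt_one₀ (norm_nonneg _) ha two_ne_zero
  have hζ2 : ζ.re * ζ.re + ζ.im * ζ.im < 1 := by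
    rw [← Complex.normSq_apply, Complex.normSq_eq_norm_sq]
    exact pow_lt_one₀ (norm_nonneg _) hζ two_ne_zero
  rw [norm_div, div_lt_one (norm_pos_iff.2 hne)]
  refine lt_of_pow_lt_pow_left₀ 2 (norm_nonneg _) ?_
  rw [← Complex.normSq_eq_norm_sq, ← Complex.normSq_eq_norm_sq, Complex.normSq_apply,
    Complex.normSq_apply]
  simp only [Complex.add_re, Complex.one_re, Complex.mul_re, Complex.mul_im, Complex.add_im,
    Complex.one_im, Complex.conj_re, Complex.conj_im]
  nlinarith [mul_pos (sub_pos.2 ha2) (sub_pos.2 hζ2)]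

/-- The bound on `f' / f` obtained from the lower growth bound for the Koebe transform of `f`. -/
theorem norm_deriv_mul_le {f : ℂ → ℂ}
    (hf : DifferentiableOn ℂ f (ball 0 1)) (hinj : InjOn f (ball 0 1)) (h0 : f 0 = 0)
    {a : ℂ} (ha : ‖a‖ < 1) : ‖deriv f a‖ * (‖a‖ * (1 - ‖a‖)) ≤ (1 + ‖a‖) * ‖f a‖ := by
  set m : ℂ → ℂ := fun ζ => (ζ + a) / (1 + (starRingEnd ℂ) a * ζ) with hmdef
  have hne : ∀ ζ ∈ ball (0 : ℂ) 1, 1 + (starRingEnd ℂ) a * ζ ≠ 0 := fun ζ hζ =>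
    (norm_disc_automorphism_lt_one ha (mem_ball_zero_iff.1 hζ)).1
  have hm : MapsTo m (ball 0 1) (ball 0 1) := fun ζ hζ =>
    mem_ball_zero_iff.2 (norm_disc_automorphism_lt_one ha (mem_ball_zero_iff.1 hζ)).2
  have hmd : DifferentiableOn ℂ m (ball 0 1) :=
    DifferentiableOn.div (by fun_prop) (by fun_prop) hne
  have hmem : (0 : ℂ) ∈ ball (0 : ℂ) 1 := by simp
  have hnn : (starRingEnd ℂ) a * a = ((‖a‖ ^ 2 : ℝ) : ℂ) := by
    rw [mul_comm, Complex.mul_conj, Complex.normSq_eq_norm_sq]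
  have hsq : 0 < 1 - ‖a‖ ^ 2 := by nlinarith [norm_nonneg a]
  have hmi : InjOn m (ball 0 1) := by
    intro ζ hζ η hη h
    simp only [hmdef] at h
    rw [div_eq_div_iff (hne ζ hζ) (hne η hη)] at h
    have h1 : ((1 - ‖a‖ ^ 2 : ℝ) : ℂ) * (ζ - η) = 0 := by
      push_cast at hnn ⊢
      linear_combination h + (ζ - η) * hnn
    rcases mul_eq_zero.1 h1 with h2 | h2
    · exact absurd (by exact_mod_cast h2) hsq.ne'
    · exact sub_eq_zero.1 h2
  have hm0 : m 0 = a := by simp [hmdef]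
  have hma : m (-a) = 0 := by simp [hmdef]
  have key := norm_deriv_zero_mul_norm_le (f := fun ζ => f (m ζ) - f a) (z := -a)
    ((hf.comp hmd hm).sub_const (f a))
    (fun ζ hζ η hη h => hmi hζ hη (hinj (hm hζ) (hm hη) (sub_left_injective h)))
    (by simp [hm0]) (by simpa using ha)
  have hd : deriv (fun ζ => f (m ζ) - f a) 0 = deriv f a * ((1 - ‖a‖ ^ 2 : ℝ) : ℂ) := by
    have h1 : HasDerivAt m ((1 - ‖a‖ ^ 2 : ℝ) : ℂ) 0 := by
      have h := ((hasDerivAt_id (0 : ℂ)).add_const a).fun_div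
        (((hasDerivAt_id (0 : ℂ)).const_mul ((starRingEnd ℂ) a)).const_add 1)
        (by simp)
      refine h.congr_deriv ?_
      push_cast at hnn ⊢
      simp only [id]
      linear_combination -hnn
    have h2 : HasDerivAt f (deriv f a) (m 0) := by
      rw [hm0]
      exact (hf.differentiableAt (isOpen_ball.mem_nhds (mem_ball_zero_iff.2 ha))).hasDerivAt
    exact ((h2.comp 0 h1).sub_const (f a)).deriv
  simp only [hd, hma, h0, zero_sub, norm_neg, norm_mul, Complex.norm_real,
    Real.norm_of_nonneg hsq.le] at key
  refine le_of_mul_le_mul_left ?_ (by positivity : 0 < 1 + ‖a‖)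
  linarith

/-- Upper growth bound, by integrating the bound on `f' / f` along a radius. -/
theorem norm_mul_one_sub_sq_le {f : ℂ → ℂ}
    (hf : DifferentiableOn ℂ f (ball 0 1)) (hinj : InjOn f (ball 0 1)) (h0 : f 0 = 0)
    {z : ℂ} (hz : ‖z‖ < 1) : ‖f z‖ * (1 - ‖z‖) ^ 2 ≤ ‖deriv f 0‖ * ‖z‖ := by
  rcases eq_or_ne z 0 with rfl | hz0
  · simp [h0]
  have hmem : (0 : ℂ) ∈ ball (0 : ℂ) 1 := by simp
  have hnhds := (isOpen_ball (x := (0 : ℂ)) (ε := 1)).mem_nhds hmem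
  set φ := dslope f 0 with hφdef
  have hφ : DifferentiableOn ℂ φ (ball 0 1) := (Complex.differentiableOn_dslope hnhds).2 hf
  have hfφ : ∀ z, f z = z * φ z := by
    intro z
    have := sub_smul_dslope f 0 z
    simpa [h0, eq_comm] using this
  have hφd : ∀ w ∈ ball (0 : ℂ) 1, HasDerivAt φ (deriv φ w) w := fun w hw =>
    (hφ.differentiableAt (isOpen_ball.mem_nhds hw)).hasDerivAt
  have hr : 0 < ‖z‖ := norm_pos_iff.2 hz0
  have hrc : (‖z‖ : ℂ) ≠ 0 := by exact_mod_cast hr.ne'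
  set u : ℂ := z / ‖z‖ with hu
  have hu1 : ‖u‖ = 1 := by simp [hu, hr.ne']
  have hzu : (‖z‖ : ℂ) * u = z := by rw [hu]; field_simp
  have hn : ∀ t : ℝ, 0 ≤ t → ‖(t : ℂ) * u‖ = t := fun t ht => by
    rw [norm_mul, hu1, mul_one, Complex.norm_real, Real.norm_of_nonneg ht]
  have htm : ∀ t ∈ Icc 0 ‖z‖, (t : ℂ) * u ∈ ball (0 : ℂ) 1 := fun t ht => by
    rw [mem_ball_zero_iff, hn t ht.1]
    exact ht.2.trans_lt hz
  have hgd : ∀ t ∈ Icc 0 ‖z‖, HasDerivAt (fun s : ℝ => ‖φ (s * u)‖ ^ 2 * (1 - s) ^ 4)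
      (2 * inner ℝ (φ (t * u)) (u * deriv φ (t * u)) * (1 - t) ^ 4
        + ‖φ (t * u)‖ ^ 2 * (4 * (1 - t) ^ 3 * (-1))) t := by
    intro t ht
    have h1 : HasDerivAt (fun s : ℝ => (s : ℂ) * u) u t := by
      simpa using (Complex.ofRealCLM.hasDerivAt (x := t)).mul_const u
    have h2 : HasDerivAt (fun s : ℝ => φ (s * u)) (u * deriv φ (t * u)) t := by
      exact (hφd _ (htm t ht)).scomp t h1
    have h3 := ((hasDerivAt_id t).const_sub 1).fun_pow 4
    have h4 := h2.norm_sq.fun_mul h3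
    simpa using h4
  have hanti : AntitoneOn (fun s : ℝ => ‖φ (s * u)‖ ^ 2 * (1 - s) ^ 4) (Icc 0 ‖z‖) := by
    refine antitoneOn_of_deriv_nonpos (convex_Icc _ _)
      (fun t ht => (hgd t ht).continuousAt.continuousWithinAt)
      (fun t ht => (hgd t (interior_subset ht)).differentiableAt.differentiableWithinAt) ?_
    intro t ht
    rw [(hgd t (interior_subset ht)).deriv]
    rw [interior_Icc] at ht
    have ht1 : 0 < 1 - t := by linarith [ht.2]
    set w : ℂ := t * u with hw
    have hwm : w ∈ ball (0 : ℂ) 1 := htm t ⟨ht.1.le, ht.2.le⟩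
    have hwn : ‖w‖ = t := hn t ht.1.le
    have hfd : deriv f w = φ w + w * deriv φ w := by
      have h : HasDerivAt f (1 * φ w + w * deriv φ w) w := by
        have := (hasDerivAt_id w).fun_mul (hφd w hwm)
        simp only [id] at this
        rwa [← funext hfφ] at this
      rw [h.deriv, one_mul]
    have hb := norm_deriv_mul_le hf hinj h0 (mem_ball_zero_iff.1 hwm)
    rw [hfφ w, norm_mul w, hwn] at hb
    have hb' : ‖deriv f w‖ * (1 - t) ≤ (1 + t) * ‖φ w‖ := by
      refine le_of_mul_le_mul_left ?_ ht.1
      linarith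
    have hin : t * inner ℝ (φ w) (u * deriv φ w) = inner ℝ (φ w) (deriv f w) - ‖φ w‖ ^ 2 := by
      have h1 : deriv f w = φ w + t • (u * deriv φ w) := by
        rw [hfd, hw, Complex.real_smul, mul_assoc]
      rw [h1, inner_add_right, real_inner_smul_right, real_inner_self_eq_norm_sq]
      ring
    have hcs := real_inner_le_norm (φ w) (deriv f w)
    have hbound : inner ℝ (φ w) (u * deriv φ w) * (1 - t) ≤ 2 * ‖φ w‖ ^ 2 := by
      refine le_of_mul_le_mul_left ?_ ht.1
      nlinarith [mul_le_mul_of_nonneg_left hb' (norm_nonneg (φ w)),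
        mul_le_mul_of_nonneg_right hcs ht1.le]
    nlinarith [mul_le_mul_of_nonneg_right hbound (pow_pos ht1 3).le]
  have hfin := hanti (left_mem_Icc.2 hr.le) (right_mem_Icc.2 hr.le) hr.le
  simp only [hzu, Complex.ofReal_zero, zero_mul, sub_zero, one_pow, mul_one] at hfin
  have hφ0 : φ 0 = deriv f 0 := dslope_same f 0
  rw [hφ0] at hfin
  have h5 : ‖φ z‖ * (1 - ‖z‖) ^ 2 ≤ ‖deriv f 0‖ := by
    refine le_of_sq_le_sq ?_ (norm_nonneg _)
    linarith
  rw [hfφ z, norm_mul]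
  nlinarith [mul_le_mul_of_nonneg_left h5 hr.le]

/-- The Koebe growth theorem: if `f` is holomorphic and injective on the
open unit disc with `f 0 = 0` and `f' 0 = 1`, then for every `z` with
`|z| < 1` one has `|z|/(1+|z|)² ≤ |f z| ≤ |z|/(1-|z|)²`. -/
theorem koebe_growth (f : ℂ → ℂ)
    (hdiff : DifferentiableOn ℂ f (Metric.ball 0 1))
    (hinj : Set.InjOn f (Metric.ball 0 1))
    (h0 : f 0 = 0) (h1 : deriv f 0 = 1) :
    ∀ z : ℂ, ‖z‖ < 1 →
      ‖z‖ / (1 + ‖z‖) ^ 2 ≤ ‖f z‖ ∧ ‖f z‖ ≤ ‖z‖ / (1 - ‖z‖) ^ 2 := by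
  intro z hz
  have hl := norm_deriv_zero_mul_norm_le hdiff hinj h0 hz
  have hu := norm_mul_one_sub_sq_le hdiff hinj h0 hz
  rw [h1, norm_one, one_mul] at hl hu
  have hpos : 0 < 1 - ‖z‖ := sub_pos.2 hz
  exact ⟨(div_le_iff₀' (by positivity)).2 hl, (le_div_iff₀ (by positivity)).2 hu⟩
end

section
/- Let g : ℂ → ℂ be holomorphic on the open unit disc 𝔻 = {z ∈ ℂ : |z| < 1} with g'(z) ≠ 0 for all z ∈ 𝔻. If the Schwarzian derivative {g; z} := (g''(z)/g'(z))' − (1/2)(g''(z)/g'(z))² satisfies |{g; z}| ≤ 2/(1 − |z|²)² for all z ∈ 𝔻, then g is injective on 𝔻. -/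
/-- The Schwarzian derivative `{g; z} = (g''/g')' - (1/2)(g''/g')²`. -/
noncomputable def schwarzianDeriv (g : ℂ → ℂ) (z : ℂ) : ℂ :=
  deriv (fun w => deriv (deriv g) w / deriv g w) z
    - (1 / 2) * (deriv (deriv g) z / deriv g z) ^ 2

open Complex in
/-- A form of Sturm comparison with `v'' + v / (1 - x²)² = 0`, whose solution `√(1 - x²)` is positive:
if a complex solution of `U'' + P U = 0` with `‖P‖ ≤ 1 / (1 - x²)²` vanishes at `0` and at some
`r ∈ (0, 1)`, then `U' 0 = 0`. -/
theorem deriv_eq_zero_of_two_zeros_real {U U₁ P : ℝ → ℂ} {r : ℝ} (hr0 : 0 < r) (hr1 : r < 1)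
    (hU : ∀ x ∈ Set.Icc 0 r, HasDerivAt U (U₁ x) x)
    (hU₁ : ∀ x ∈ Set.Icc 0 r, HasDerivAt U₁ (-P x * U x) x)
    (hP : ∀ x ∈ Set.Icc 0 r, ‖P x‖ ≤ 1 / (1 - x ^ 2) ^ 2)
    (h0 : U 0 = 0) (hr : U r = 0) : U₁ 0 = 0 := by
  have hre {f : ℝ → ℂ} {f' : ℂ} {x : ℝ} (h : HasDerivAt f f' x) :
      HasDerivAt (fun t => (f t).re) f'.re x :=
    reCLM.hasFDerivAt.comp_hasDerivAt x h
  have him {f : ℝ → ℂ} {f' : ℂ} {x : ℝ} (h : HasDerivAt f f' x) :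
      HasDerivAt (fun t => (f t).im) f'.im x :=
    imCLM.hasFDerivAt.comp_hasDerivAt x h
  -- `w = Re (conj U * (U' - U v' / v))` with `v = √(1 - x²)`
  set w : ℝ → ℝ := fun x => (U x).re * (U₁ x).re + (U x).im * (U₁ x).im
    + ((U x).re * (U x).re + (U x).im * (U x).im) * (x / (1 - x ^ 2)) with hw
  set w' : ℝ → ℝ := fun x => ((U₁ x).re + (U x).re * (x / (1 - x ^ 2))) ^ 2
    + ((U₁ x).im + (U x).im * (x / (1 - x ^ 2))) ^ 2
    + ((U x).re ^ 2 + (U x).im ^ 2) * (1 / (1 - x ^ 2) ^ 2 - (P x).re) with hw'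
  have hder : ∀ x ∈ Set.Icc 0 r, HasDerivAt w (w' x) x := by
    intro x hx
    have hne : 1 - x ^ 2 ≠ 0 := by nlinarith [hx.1, hx.2]
    have hq : HasDerivAt (fun x : ℝ => x / (1 - x ^ 2)) ((1 + x ^ 2) / (1 - x ^ 2) ^ 2) x := by
      convert! (hasDerivAt_id x).div (((hasDerivAt_id x).pow 2).const_sub 1) hne using 1
      simp
      ring
    have hA := hU x hx
    have hB := hU₁ x hx
    convert! (((hre hA).mul (hre hB)).add ((him hA).mul (him hB))).add
      ((((hre hA).mul (hre hA)).add ((him hA).mul (him hA))).mul hq) using 1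
    simp only [hw', neg_mul, neg_re, neg_im, mul_re, mul_im, Pi.mul_apply, Pi.add_apply]
    field_simp
    ring
  have hmono : MonotoneOn w (Set.Icc 0 r) := by
    refine monotoneOn_of_deriv_nonneg (convex_Icc 0 r)
      (fun x hx => (hder x hx).continuousAt.continuousWithinAt)
      (fun x hx => (hder x (interior_subset hx)).differentiableAt.differentiableWithinAt)
      fun x hx => ?_
    have hx := interior_subset hx
    rw [(hder x hx).deriv]
    have := (re_le_norm (P x)).trans (hP x hx)
    have : 0 ≤ 1 / (1 - x ^ 2) ^ 2 - (P x).re := by linarith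
    positivity
  have hmem0 : (0 : ℝ) ∈ Set.Icc 0 r := ⟨le_rfl, hr0.le⟩
  have hmemr : r ∈ Set.Icc 0 r := ⟨hr0.le, le_rfl⟩
  have hzero : ∀ x ∈ Set.Icc 0 r, w x = 0 := fun x hx => le_antisymm
    ((hmono hx hmemr hx.2).trans_eq (by simp [hw, hr]))
    (le_of_eq_of_le (by simp [hw, h0]) (hmono hmem0 hx hx.1))
  have hw0 : w' 0 = 0 := (uniqueDiffOn_Icc hr0 0 hmem0).eq_deriv _
    (hder 0 hmem0).hasDerivWithinAt
    ((hasDerivWithinAt_const 0 _ (0 : ℝ)).congr hzero (hzero 0 hmem0))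
  have hsum : (U₁ 0).re ^ 2 + (U₁ 0).im ^ 2 = 0 := by simpa [hw', h0] using hw0
  apply Complex.ext
  · simpa using (pow_eq_zero_iff two_ne_zero).1 (by nlinarith : (U₁ 0).re ^ 2 = 0)
  · simpa using (pow_eq_zero_iff two_ne_zero).1 (by nlinarith : (U₁ 0).im ^ 2 = 0)

open ComplexConjugate in
/-- The Schwarz–Pick identity for the factors of a disc automorphism. -/
theorem norm_sq_one_add_conj_mul_sub (a z : ℂ) :
    ‖1 + conj a * z‖ ^ 2 - ‖z + a‖ ^ 2 = (1 - ‖a‖ ^ 2) * (1 - ‖z‖ ^ 2) := by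
  simp only [← Complex.normSq_eq_norm_sq, Complex.normSq_apply]
  simp
  ring

theorem one_add_conj_mul_ne_zero {a z : ℂ} (ha : ‖a‖ < 1) (hz : ‖z‖ < 1) :
    1 + (starRingEnd ℂ) a * z ≠ 0 := by
  intro h
  have h1 := norm_sq_one_add_conj_mul_sub a z
  have h2 : 0 < (1 - ‖a‖ ^ 2) * (1 - ‖z‖ ^ 2) := by
    apply mul_pos <;> nlinarith [norm_nonneg a, norm_nonneg z]
  rw [h, norm_zero] at h1
  nlinarith [sq_nonneg ‖z + a‖]

open ComplexConjugate in
/-- If a solution of `u'' + P u = 0` on the unit disc with `‖P z‖ ≤ 1 / (1 - ‖z‖²)²` vanishes at two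
distinct points, then its derivative vanishes at the first of them. -/
theorem deriv_eq_zero_of_two_zeros_disc {u u₁ P : ℂ → ℂ} {a b : ℂ}
    (ha : ‖a‖ < 1) (hb : ‖b‖ < 1) (hab : a ≠ b)
    (hu : ∀ z, ‖z‖ < 1 → HasDerivAt u (u₁ z) z)
    (hu₁ : ∀ z, ‖z‖ < 1 → HasDerivAt u₁ (-P z * u z) z)
    (hP : ∀ z, ‖z‖ < 1 → ‖P z‖ ≤ 1 / (1 - ‖z‖ ^ 2) ^ 2)
    (hua : u a = 0) (hub : u b = 0) : u₁ a = 0 := by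
  have hD : 0 < 1 - ‖a‖ ^ 2 := by nlinarith [norm_nonneg a]
  have hDc : 1 - conj a * a = ((1 - ‖a‖ ^ 2 : ℝ) : ℂ) := by
    rw [Complex.conj_mul']; push_cast; rfl
  have hDc0 : 1 - conj a * a ≠ 0 := by rw [hDc]; exact_mod_cast hD.ne'
  have hden : 1 - conj a * b ≠ 0 := by
    have := one_add_conj_mul_ne_zero ha (z := -b) (by simpa using hb)
    simpa [sub_eq_add_neg] using this
  -- `c` is the image of `b` under the automorphism taking `a` to `0`
  set c : ℂ := (b - a) / (1 - conj a * b) with hc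
  have hc0 : c ≠ 0 := div_ne_zero (sub_ne_zero.2 hab.symm) hden
  have hc1 : ‖c‖ < 1 := by
    have h := norm_sq_one_add_conj_mul_sub (-a) b
    simp only [map_neg, neg_mul, ← sub_eq_add_neg, norm_neg] at h
    have : 0 < (1 - ‖a‖ ^ 2) * (1 - ‖b‖ ^ 2) := mul_pos hD (by nlinarith [norm_nonneg b])
    rw [hc, norm_div, div_lt_one (norm_pos_iff.2 hden)]
    exact lt_of_pow_lt_pow_left₀ 2 (norm_nonneg _) (by linarith)
  have hnc : (‖c‖ : ℂ) ≠ 0 := by simpa using hc0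
  set ω : ℂ := c / ‖c‖ with hω
  have hω1 : ‖ω‖ = 1 := by simp [hω, hc0]
  have hω0 : ω ≠ 0 := div_ne_zero hc0 hnc
  have hωc : ω * ‖c‖ = c := div_mul_cancel₀ _ hnc
  set q : ℂ → ℂ := fun x => 1 + conj a * (ω * x) with hq
  set T : ℂ → ℂ := fun x => (ω * x + a) / q x with hT
  set d : ℂ := ω * (1 - conj a * a) with hd
  have hq0 : ∀ x : ℂ, ‖x‖ < 1 → q x ≠ 0 := fun x hx =>
    one_add_conj_mul_ne_zero ha (by rwa [norm_mul, hω1, one_mul])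
  have hq' : ∀ x, HasDerivAt q (conj a * ω) x := by
    intro x
    convert! (((hasDerivAt_id x).const_mul ω).const_mul (conj a)).const_add 1 using 1
    ring
  have hT' : ∀ x : ℂ, ‖x‖ < 1 → HasDerivAt T (d / q x ^ 2) x := by
    intro x hx
    convert! (((hasDerivAt_id x).const_mul ω).add_const a).div (hq' x) (hq0 x hx) using 1
    simp [hd, hq]
    ring
  have hpick : ∀ x : ℂ, ‖x‖ < 1 →
      1 - ‖T x‖ ^ 2 = (1 - ‖a‖ ^ 2) * (1 - ‖x‖ ^ 2) / ‖q x‖ ^ 2 := by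
    intro x hx
    have hn : ‖q x‖ ≠ 0 := norm_ne_zero_iff.2 (hq0 x hx)
    have h := norm_sq_one_add_conj_mul_sub a (ω * x)
    rw [norm_mul, hω1, one_mul] at h
    rw [← h, hT, norm_div, div_pow, eq_div_iff (pow_ne_zero 2 hn), sub_mul, one_mul,
      div_mul_cancel₀ _ (pow_ne_zero 2 hn)]
  have hxpos : ∀ x : ℂ, ‖x‖ < 1 → 0 < 1 - ‖x‖ ^ 2 := fun x hx => by nlinarith [norm_nonneg x]
  have hT1 : ∀ x : ℂ, ‖x‖ < 1 → ‖T x‖ < 1 := by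
    intro x hx
    have hn : 0 < ‖q x‖ := norm_pos_iff.2 (hq0 x hx)
    have : 0 < 1 - ‖T x‖ ^ 2 := by
      rw [hpick x hx]
      have := hxpos x hx
      positivity
    nlinarith [norm_nonneg (T x)]
  have hT0 : T 0 = a := by simp [hT, hq]
  have hTc : T ‖c‖ = b := by
    have h := hq0 ‖c‖ (by simpa using hc1)
    simp only [hT, hq, hωc] at h ⊢
    have hcb : c * (1 - conj a * b) = b - a := div_mul_cancel₀ _ hden
    rw [div_eq_iff h]
    linear_combination hcb
  have hball : ∀ x ∈ Set.Icc 0 ‖c‖, ‖(x : ℂ)‖ < 1 := fun x hx => by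
    rw [Complex.norm_real, Real.norm_of_nonneg hx.1]
    exact hx.2.trans_lt hc1
  have hkey := deriv_eq_zero_of_two_zeros_real (r := ‖c‖)
    (U := fun x : ℝ => q x * u (T x))
    (U₁ := fun x : ℝ => conj a * ω * u (T x) + d * (u₁ (T x) / q x))
    (P := fun x : ℝ => P (T x) * (d / q x ^ 2) ^ 2) (norm_pos_iff.2 hc0) hc1
    (fun x hx => by
      have hx := hball x hx
      have hqx := hq0 x hx
      apply HasDerivAt.comp_ofReal
        (e := fun x : ℂ => q x * u (T x))
      convert! (hq' x).mul ((hu _ (hT1 x hx)).comp (x : ℂ) (hT' x hx)) using 1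
      simp only [Function.comp]
      field_simp)
    (fun x hx => by
      have hx := hball x hx
      have hqx := hq0 x hx
      apply HasDerivAt.comp_ofReal
        (e := fun x : ℂ => conj a * ω * u (T x) + d * (u₁ (T x) / q x))
      convert! (((hu _ (hT1 x hx)).comp (x : ℂ) (hT' x hx)).const_mul (conj a * ω)).add
        ((((hu₁ _ (hT1 x hx)).comp (x : ℂ) (hT' x hx)).div (hq' x) hqx).const_mul d) using 1
      simp only [Function.comp]
      field_simp
      ring)
    (fun x hx => by
      have hx' := hball x hx
      have hn : ‖q x‖ ≠ 0 := norm_ne_zero_iff.2 (hq0 x hx')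
      have hx1 := hxpos x hx'
      have hdn : ‖d‖ = 1 - ‖a‖ ^ 2 := by
        rw [hd, norm_mul, hω1, one_mul, hDc, Complex.norm_real, Real.norm_of_nonneg hD.le]
      have h := hP _ (hT1 x hx')
      rw [hpick x hx'] at h
      rw [norm_mul, norm_pow, norm_div, norm_pow, hdn]
      refine (mul_le_mul_of_nonneg_right h (by positivity)).trans_eq ?_
      rw [Complex.norm_real, Real.norm_eq_abs, sq_abs] at hx1 ⊢
      field_simp)
    (by simp [hT0, hua]) (by simp [hTc, hub])
  simpa [hT0, hua, hq, hd, hω0, hDc0] using hkey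

/-- Nehari's sufficient condition for univalence: if `g` is holomorphic on the
open unit disc with nonvanishing derivative and its Schwarzian derivative
satisfies `|{g; z}| ≤ 2/(1-|z|²)²` there, then `g` is injective on the disc. -/
theorem nehari_sufficient (g : ℂ → ℂ)
    (hdiff : DifferentiableOn ℂ g (Metric.ball 0 1))
    (hder : ∀ z ∈ Metric.ball (0 : ℂ) 1, deriv g z ≠ 0)
    (hS : ∀ z ∈ Metric.ball (0 : ℂ) 1,
      ‖schwarzianDeriv g z‖ ≤ 2 / (1 - ‖z‖ ^ 2) ^ 2) :
    Set.InjOn g (Metric.ball 0 1) := by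
  have hopen : IsOpen (Metric.ball (0 : ℂ) 1) := Metric.isOpen_ball
  have hg₁ : DifferentiableOn ℂ (deriv g) (Metric.ball 0 1) := hdiff.deriv hopen
  have hN : DifferentiableOn ℂ (fun w => deriv (deriv g) w / deriv g w) (Metric.ball 0 1) :=
    (hg₁.deriv hopen).div hg₁ hder
  obtain ⟨L, hL⟩ := hN.isExactOn_ball
  set N : ℂ → ℂ := fun w => deriv (deriv g) w / deriv g w with hNdef
  intro a ha b hb hgab
  by_contra hab
  have hball {z : ℂ} (hz : ‖z‖ < 1) : z ∈ Metric.ball (0 : ℂ) 1 := mem_ball_zero_iff.2 hz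
  have hE (z : ℂ) (hz : ‖z‖ < 1) : HasDerivAt (fun z => Complex.exp (-(L z / 2)))
      (Complex.exp (-(L z / 2)) * -(N z / 2)) z := ((hL z (hball hz)).div_const 2).neg.cexp
  have hg (z : ℂ) (hz : ‖z‖ < 1) : HasDerivAt (fun z => g z - g a) (deriv g z) z :=
    ((hdiff.differentiableAt (hopen.mem_nhds (hball hz))).hasDerivAt).sub_const _
  -- `exp (-L / 2)` is a constant multiple of `(g')^(-1/2)`
  have hkey := deriv_eq_zero_of_two_zeros_disc
    (u := fun z => (g z - g a) * Complex.exp (-(L z / 2)))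
    (u₁ := fun z => (deriv g z - (g z - g a) * (N z / 2)) * Complex.exp (-(L z / 2)))
    (P := fun z => schwarzianDeriv g z / 2)
    (mem_ball_zero_iff.1 ha) (mem_ball_zero_iff.1 hb) hab
    (fun z hz => by
      convert! (hg z hz).mul (hE z hz) using 1
      ring)
    (fun z hz => by
      have hz' := hball hz
      have hg₂ : HasDerivAt (deriv g) (deriv g z * N z) z := by
        rw [hNdef, mul_div_cancel₀ _ (hder z hz')]
        exact (hg₁.differentiableAt (hopen.mem_nhds hz')).hasDerivAt
      have hN' := (hN.differentiableAt (hopen.mem_nhds hz')).hasDerivAt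
      have hS' : schwarzianDeriv g z = deriv N z - 1 / 2 * N z ^ 2 := rfl
      convert! (hg₂.sub ((hg z hz).mul (hN'.div_const 2))).mul (hE z hz) using 1
      simp only [hS', Pi.sub_apply, Pi.mul_apply]
      ring)
    (fun z hz => by
      rw [norm_div, Complex.norm_ofNat, div_le_iff₀ two_pos]
      exact (hS z (hball hz)).trans_eq (by ring))
    (by simp) (by simp [hgab])
  simp [hder a ha] at hkey
end

section
/- Let g : ℂ → ℂ be holomorphic and injective on the open unit disc 𝔻 = {z ∈ ℂ : |z| < 1}. Then g'(z) ≠ 0 for all z ∈ 𝔻, and the Schwarzian derivative {g; z} := (g''(z)/g'(z))' − (1/2)(g''(z)/g'(z))² satisfies |{g; z}| ≤ 6/(1 − |z|²)² for all z ∈ 𝔻. -/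
open Filter Topology Set Complex MeasureTheory Metric ComplexConjugate

/-- A holomorphic function that is injective near a point has nonzero derivative there. -/
theorem AnalyticAt.deriv_ne_zero_of_injOn {f : ℂ → ℂ} {z₀ : ℂ} {U : Set ℂ}
    (hf : AnalyticAt ℂ f z₀) (hU : U ∈ 𝓝 z₀) (hinj : InjOn f U) : deriv f z₀ ≠ 0 := by
  intro hderiv
  have hg : AnalyticAt ℂ (fun z => f z - f z₀) z₀ := by fun_prop
  have hfin : analyticOrderAt (fun z => f z - f z₀) z₀ ≠ ⊤ := by
    intro htop
    rw [analyticOrderAt_eq_top] at htop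
    have h2 : ∀ᶠ z in 𝓝[≠] z₀, False := by
      filter_upwards [htop.filter_mono nhdsWithin_le_nhds, mem_nhdsWithin_of_mem_nhds hU,
        self_mem_nhdsWithin] with z hz hzU hne
      exact hne (hinj hzU (mem_of_mem_nhds hU) (sub_eq_zero.1 hz))
    exact h2.exists.elim fun _ h => h
  obtain ⟨F, hFa, hF0, hfF⟩ := (hg.analyticOrderAt_ne_top).1 hfin
  set n := analyticOrderNatAt (fun z => f z - f z₀) z₀ with hn
  have hn0 : n ≠ 0 := by
    intro h0
    have := hfF.self_of_nhds
    simp [h0] at this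
    exact hF0 this.symm
  have hn1 : n ≠ 1 := by
    intro h1
    simp only [h1, pow_one, smul_eq_mul] at hfF
    have hd : HasDerivAt (fun z => (z - z₀) * F z) (F z₀) z₀ := by
      simpa using ((hasDerivAt_id z₀).sub_const z₀).fun_mul hFa.differentiableAt.hasDerivAt
    have hd' := (hd.congr_of_eventuallyEq hfF).deriv
    rw [deriv_sub_const, hderiv] at hd'
    exact hF0 hd'.symm
  obtain ⟨c, hc⟩ := IsAlgClosed.exists_pow_nat_eq (F z₀) (Nat.pos_of_ne_zero hn0)
  have hc0 : c ≠ 0 := by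
    rintro rfl
    exact hF0 (by rw [← hc, zero_pow hn0])
  set u : ℂ → ℂ := fun z => c * (F z / F z₀) ^ (1 / n : ℂ) with hu
  have hua : AnalyticAt ℂ u z₀ :=
    analyticAt_const.mul ((hFa.div analyticAt_const hF0).cpow analyticAt_const (by simp [hF0]))
  have hun : ∀ z, u z ^ n = F z := fun z => by
    simp only [hu, mul_pow, ← cpow_mul_nat]
    rw [one_div, inv_mul_cancel₀ (mod_cast hn0), cpow_one, hc, mul_div_cancel₀ _ hF0]
  have hu0 : u z₀ ≠ 0 := by simp [hu, hF0, hc0]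
  set p : ℂ → ℂ := fun z => (z - z₀) * u z with hp
  have hpa : AnalyticAt ℂ p z₀ := by fun_prop
  have hpd : deriv p z₀ = u z₀ := by
    have : HasDerivAt p (u z₀) z₀ := by
      simpa using ((hasDerivAt_id z₀).sub_const z₀).fun_mul hua.differentiableAt.hasDerivAt
    exact this.deriv
  have hpm : map p (𝓝 z₀) = 𝓝 0 := by
    have := hpa.hasStrictDerivAt.map_nhds_eq (by rwa [hpd])
    simpa [hp] using this
  have hV : U ∩ {z | f z - f z₀ = p z ^ n} ∈ 𝓝 z₀ := by
    refine inter_mem hU ?_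
    filter_upwards [hfF] with z hz
    simp [hp, mul_pow, hun, hz]
  have hW := image_mem_map (m := p) hV
  rw [hpm] at hW
  set ω : ℂ := exp (2 * Real.pi * I / n)
  have hω : IsPrimitiveRoot ω n := isPrimitiveRoot_exp n hn0
  have hW' : ∀ᶠ w in 𝓝 (0 : ℂ), ω * w ∈ p '' (U ∩ {z | f z - f z₀ = p z ^ n}) := by
    have : Tendsto (fun w : ℂ => ω * w) (𝓝 0) (𝓝 0) := by
      simpa using (continuous_const_mul ω).tendsto 0
    exact this hW
  have hex : ∀ᶠ w in 𝓝[≠] (0 : ℂ), False := by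
    filter_upwards [nhdsWithin_le_nhds hW, hW'.filter_mono nhdsWithin_le_nhds,
      self_mem_nhdsWithin] with w ⟨a, ⟨haU, ha⟩, haw⟩ ⟨b, ⟨hbU, hb⟩, hbw⟩ hw
    simp only [mem_ofPred_eq] at ha hb
    have hab : f a = f b := by
      rw [haw] at ha
      rw [hbw, mul_pow, hω.pow_eq_one, one_mul, ← ha] at hb
      exact (sub_left_inj.1 hb).symm
    have := hinj haU hbU hab
    subst this
    rw [haw] at hbw
    have : ω = 1 := mul_right_cancel₀ hw (by rw [one_mul, ← hbw])
    exact hn1 (by simpa [this] using hω.eq_orderOf)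
  exact hex.exists.elim fun _ h => h

theorem lintegral_annulus_eq_lintegral_circleAverage {f : ℂ → ℝ} {s t : ℝ} (hs : 0 ≤ s)
    (hf : ContinuousOn f (norm ⁻¹' Ioo s t)) (hf0 : ∀ z, 0 ≤ f z) :
    ∫⁻ z in norm ⁻¹' Ioo s t, ENNReal.ofReal (f z) =
      ∫⁻ r in Ioo s t, ENNReal.ofReal (2 * Real.pi * (r * Real.circleAverage f 0 r)) := by
  have hA : MeasurableSet (norm ⁻¹' Ioo s t : Set ℂ) := measurable_norm measurableSet_Ioo
  have hcont : ContinuousOn (fun p : ℝ × ℝ => f (circleMap 0 p.1 p.2))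
      (Ioo s t ×ˢ Ioo (-Real.pi) Real.pi) := by
    refine hf.comp (by fun_prop) fun p hp => ?_
    simpa [abs_of_pos (hs.trans_lt hp.1.1)] using hp.1
  rw [← lintegral_indicator hA, ← Complex.lintegral_comp_polarCoord_symm]
  have hpol : ∀ p ∈ polarCoord.target, ENNReal.ofReal p.1 • (norm ⁻¹' Ioo s t).indicator
      (fun z => ENNReal.ofReal (f z)) (Complex.polarCoord.symm p) =
      (Ioo s t ×ˢ Ioo (-Real.pi) Real.pi).indicator
        (fun p : ℝ × ℝ => ENNReal.ofReal p.1 * ENNReal.ofReal (f (circleMap 0 p.1 p.2))) p := by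
    rintro ⟨r, θ⟩ ⟨hr, hθ⟩
    have hz : Complex.polarCoord.symm (r, θ) = circleMap 0 r θ := by
      simp [circleMap, exp_mul_I]
    rw [hz]
    have hmem : circleMap 0 r θ ∈ (norm ⁻¹' Ioo s t) ↔
        (r, θ) ∈ Ioo s t ×ˢ Ioo (-Real.pi) Real.pi := by
      have hr' : 0 < r := hr
      have hθ' : θ ∈ Ioo (-Real.pi) Real.pi := hθ
      simp [abs_of_pos hr', hθ'.1, hθ'.2]
    by_cases h : circleMap 0 r θ ∈ (norm ⁻¹' Ioo s t)
    · rw [indicator_of_mem h, indicator_of_mem (hmem.1 h), smul_eq_mul]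
    · rw [indicator_of_notMem h, indicator_of_notMem (mt hmem.2 h), smul_zero]
  have hsub : Ioo s t ×ˢ Ioo (-Real.pi) Real.pi ⊆ polarCoord.target :=
    prod_mono (fun r hr => hs.trans_lt hr.1) subset_rfl
  rw [setLIntegral_congr_fun polarCoord.open_target.measurableSet hpol,
    setLIntegral_indicator (measurableSet_Ioo.prod measurableSet_Ioo), inter_eq_left.2 hsub,
    Measure.volume_eq_prod, setLIntegral_prod]
  · refine setLIntegral_congr_fun measurableSet_Ioo fun r hr => ?_
    have hr0 : 0 < r := hs.trans_lt hr.1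
    have hci : Continuous fun θ : ℝ => f (circleMap 0 r θ) :=
      hf.comp_continuous (continuous_circleMap 0 r) fun θ => by
        simpa [abs_of_pos hr0] using hr
    have hper : (fun θ : ℝ => f (circleMap 0 r θ)).Periodic (2 * Real.pi) :=
      fun θ => by simp [periodic_circleMap 0 r θ]
    have hint := hper.intervalIntegral_add_eq (-Real.pi) 0
    have hpi : -Real.pi ≤ Real.pi := by linarith [Real.pi_pos]
    rw [zero_add, show -Real.pi + 2 * Real.pi = Real.pi by ring] at hint
    dsimp only
    rw [lintegral_const_mul' _ _ ENNReal.ofReal_ne_top, ← ofReal_integral_eq_lintegral_ofReal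
      (hci.integrableOn_Icc.mono_set Ioo_subset_Icc_self)
      (Eventually.of_forall fun θ => hf0 _), ← ENNReal.ofReal_mul hr0.le,
      ← integral_Ioc_eq_integral_Ioo, ← intervalIntegral.integral_of_le hpi, hint,
      Real.circleAverage_def, smul_eq_mul]
    congr 1
    field_simp
  · refine AEMeasurable.mul (by fun_prop) (ENNReal.measurable_ofReal.comp_aemeasurable ?_)
    exact hcont.aemeasurable (measurableSet_Ioo.prod measurableSet_Ioo)

theorem one_add_le_circleAverage_norm_sq {k : ℂ → ℂ} {b : ℂ} {r : ℝ} (hr : 0 < r)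
    (hk : DifferentiableOn ℂ k (closedBall 0 r)) :
    1 + ‖b‖ ^ 2 * r ^ 4 ≤
      Real.circleAverage (fun z => ‖-1 + b * z ^ 2 + z ^ 3 * k z‖ ^ 2) 0 r := by
  set H : ℂ → ℂ := fun z => -b * z ^ 2 - z ^ 3 * k z + conj b * r ^ 4 * (z * k z) with hH
  have hHd : DifferentiableOn ℂ H (closedBall 0 r) := by fun_prop
  have hHi : CircleIntegrable H 0 r :=
    (hHd.continuousOn.mono sphere_subset_closedBall).circleIntegrable hr.le
  have hHavg : Real.circleAverage H 0 r = 0 := by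
    have hd : DiffContOnCl ℂ H (ball 0 |r|) := by
      rw [abs_of_pos hr]
      exact (hHd.mono closure_ball_subset_closedBall).diffContOnCl
    simpa [hH] using hd.circleAverage
  have hre : Real.circleAverage (fun z => (H z).re) 0 r = 0 := by
    have := reCLM.circleAverage_comp_comm hHi
    rw [hHavg] at this
    simpa [Function.comp_def] using this
  have hHre : CircleIntegrable (fun z => (H z).re) 0 r :=
    ((continuous_re.comp_continuousOn hHd.continuousOn).mono
      sphere_subset_closedBall).circleIntegrable hr.le
  have hlow : Real.circleAverage (fun z => (1 + ‖b‖ ^ 2 * r ^ 4) + (2 : ℝ) • (H z).re) 0 r =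
      1 + ‖b‖ ^ 2 * r ^ 4 := by
    rw [Real.circleAverage_fun_add (by simp) hHre.const_fun_smul, Real.circleAverage_const,
      Real.circleAverage_fun_smul, hre]
    simp
  rw [← hlow]
  refine Real.circleAverage_mono ?_ ?_ ?_
  · exact CircleIntegrable.add (by simp) hHre.const_fun_smul
  · have := hk.continuousOn.mono sphere_subset_closedBall
    exact ContinuousOn.circleIntegrable hr.le (by fun_prop)
  · intro z hz
    have hzr : ‖z‖ = r := by simpa [abs_of_pos hr] using hz
    set Q : ℂ := -1 + b * z ^ 2
    set K : ℂ := z ^ 3 * k z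
    have h1 : ‖Q + K‖ ^ 2 = ‖Q‖ ^ 2 + ‖K‖ ^ 2 + 2 * (K * conj Q).re := by
      rw [← normSq_eq_norm_sq, ← normSq_eq_norm_sq, ← normSq_eq_norm_sq, add_comm Q K, normSq_add]
      ring
    have hzz : conj z * z = (r : ℂ) ^ 2 := by rw [conj_mul', hzr]
    have h2 : ‖Q‖ ^ 2 = 1 + ‖b‖ ^ 2 * r ^ 4 - 2 * (b * z ^ 2).re := by
      have hn : ‖b‖ ^ 2 * r ^ 4 = normSq (b * z ^ 2) := by
        rw [normSq_eq_norm_sq, norm_mul, norm_pow, hzr]; ring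
      rw [← normSq_eq_norm_sq, hn, normSq_add, neg_one_mul, neg_re, conj_re, normSq_neg, map_one]
      ring
    have h3 : K * conj Q = -K + conj b * r ^ 4 * (z * k z) := by
      have : (r : ℂ) ^ 4 = (conj z * z) ^ 2 := by rw [hzz]; ring
      simp only [K, Q, this, map_add, map_neg, map_one, map_mul, map_pow]
      ring
    have h4 : H z = -(b * z ^ 2) + K * conj Q := by
      rw [h3]; simp only [hH, K]; ring
    rw [h1, h2, h4, add_re, neg_re, smul_eq_mul]
    nlinarith [sq_nonneg ‖K‖]

/-- The map `w ↦ w - c * conj w` is real-linear, with determinant `1 - ‖c‖²`. -/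
theorem Complex.exists_linearMap_sub_mul_conj (c : ℂ) :
    ∃ L : ℂ →ₗ[ℝ] ℂ, (∀ w, L w = w - c * conj w) ∧ LinearMap.det L = 1 - ‖c‖ ^ 2 := by
  refine ⟨LinearMap.id - (LinearMap.mulLeft ℝ c).comp conjAe.toLinearMap, fun w => by simp, ?_⟩
  rw [← LinearMap.det_toMatrix basisOneI, Matrix.det_fin_two]
  simp [LinearMap.toMatrix_apply, ← normSq_eq_norm_sq, normSq_apply]
  ring

theorem ContinuousLinearMap.det_restrictScalars_toSpanSingleton (a : ℂ) :
    ((ContinuousLinearMap.toSpanSingleton ℂ a).restrictScalars ℝ).det = ‖a‖ ^ 2 := by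
  simp [ContinuousLinearMap.det, LinearMap.det_restrictScalars,
      Algebra.norm_complex_eq, Complex.normSq_eq_norm_sq]

theorem volume_image_eq_lintegral_norm_deriv_sq {G : ℂ → ℂ} {G' : ℂ → ℂ} {A : Set ℂ}
    (hA : MeasurableSet A) (hG : ∀ z ∈ A, HasDerivAt G (G' z) z) (hinj : InjOn G A) :
    volume (G '' A) = ∫⁻ z in A, ENNReal.ofReal (‖G' z‖ ^ 2) := by
  rw [← lintegral_abs_det_fderiv_eq_addHaar_image volume hA
    (fun z hz => ((hG z hz).hasFDerivAt.restrictScalars ℝ).hasFDerivWithinAt) hinj]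
  refine lintegral_congr fun z => ?_
  rw [ContinuousLinearMap.det_restrictScalars_toSpanSingleton, abs_of_nonneg (by positivity)]

theorem HasDerivAt.inv_add_mul_add_sq_mul {h : ℂ → ℂ} {h' b z : ℂ} (hz : z ≠ 0)
    (hh : HasDerivAt h h' z) :
    HasDerivAt (fun z => z⁻¹ + b * z + z ^ 2 * h z)
      ((-1 + b * z ^ 2 + z ^ 3 * (2 * h z + z * h')) / z ^ 2) z := by
  have h2 := (((hasDerivAt_inv hz).fun_add ((hasDerivAt_id z).const_mul b)).fun_add
    ((hasDerivAt_pow 2 z).fun_mul hh))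
  refine h2.congr_deriv ?_
  simp only [Nat.cast_ofNat]
  field_simp
  ring

theorem le_volume_image_annulus {h : ℂ → ℂ} {b : ℂ} {s t : ℝ}
    (hh : DifferentiableOn ℂ h (ball 0 1))
    (hinj : InjOn (fun z => z⁻¹ + b * z + z ^ 2 * h z) (ball 0 1 \ {0}))
    (hs : 0 < s) (hst : s ≤ t) (ht : t ≤ 1) :
    ENNReal.ofReal (Real.pi * ((s ^ 2)⁻¹ - (t ^ 2)⁻¹ + ‖b‖ ^ 2 * (t ^ 2 - s ^ 2))) ≤
      volume ((fun z => z⁻¹ + b * z + z ^ 2 * h z) '' (norm ⁻¹' Ioo s t)) := by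
  have hA : MeasurableSet (norm ⁻¹' Ioo s t : Set ℂ) := measurable_norm measurableSet_Ioo
  have hA0 : ∀ z ∈ (norm ⁻¹' Ioo s t : Set ℂ), z ≠ 0 := fun z hz =>
    norm_pos_iff.1 (hs.trans hz.1)
  have hA1 : (norm ⁻¹' Ioo s t : Set ℂ) ⊆ ball 0 1 := fun z hz => by
    simpa using hz.2.trans_le ht
  have hsub : (norm ⁻¹' Ioo s t : Set ℂ) ⊆ ball 0 1 \ {0} := fun z hz => ⟨hA1 hz, hA0 z hz⟩
  have hdh : DifferentiableOn ℂ (deriv h) (ball 0 1) := hh.deriv isOpen_ball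
  set k : ℂ → ℂ := fun z => 2 * h z + z * deriv h z with hk
  have hkd : DifferentiableOn ℂ k (ball 0 1) := by fun_prop
  have hG : ∀ z ∈ (norm ⁻¹' Ioo s t : Set ℂ), HasDerivAt (fun z => z⁻¹ + b * z + z ^ 2 * h z)
      ((-1 + b * z ^ 2 + z ^ 3 * k z) / z ^ 2) z := fun z hz =>
    (hh.differentiableAt (isOpen_ball.mem_nhds (hA1 hz))).hasDerivAt.inv_add_mul_add_sq_mul
      (hA0 z hz)
  rw [volume_image_eq_lintegral_norm_deriv_sq hA hG (hinj.mono hsub),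
    lintegral_annulus_eq_lintegral_circleAverage hs.le _ fun z => by positivity]
  swap
  · have := hkd.continuousOn.mono hA1
    refine ((ContinuousOn.div (by fun_prop) (by fun_prop) fun z hz => ?_).norm).pow 2
    exact pow_ne_zero _ (hA0 z hz)
  have hmono : ∫⁻ r in Ioo s t, ENNReal.ofReal (2 * Real.pi * ((r ^ 3)⁻¹ + ‖b‖ ^ 2 * r)) ≤
      ∫⁻ r in Ioo s t, ENNReal.ofReal (2 * Real.pi * (r * Real.circleAverage
        (fun z => ‖(-1 + b * z ^ 2 + z ^ 3 * k z) / z ^ 2‖ ^ 2) 0 r)) := by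
    refine setLIntegral_mono' measurableSet_Ioo fun r hr => ENNReal.ofReal_le_ofReal ?_
    have hr0 : 0 < r := hs.trans hr.1
    have havg := one_add_le_circleAverage_norm_sq (b := b) hr0
      (hkd.mono (closedBall_subset_ball (hr.2.trans_le ht)))
    have heq : Real.circleAverage (fun z => ‖(-1 + b * z ^ 2 + z ^ 3 * k z) / z ^ 2‖ ^ 2) 0 r =
        (r ^ 4)⁻¹ * Real.circleAverage (fun z => ‖-1 + b * z ^ 2 + z ^ 3 * k z‖ ^ 2) 0 r := by
      rw [← smul_eq_mul, ← Real.circleAverage_fun_smul]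
      refine Real.circleAverage_congr_sphere fun z hz => ?_
      have hzr : ‖z‖ = r := by simpa [abs_of_pos hr0] using hz
      simp only [norm_div, norm_pow, hzr, smul_eq_mul]
      field_simp
    rw [heq]
    have : (r ^ 3)⁻¹ + ‖b‖ ^ 2 * r = r * ((r ^ 4)⁻¹ * (1 + ‖b‖ ^ 2 * r ^ 4)) := by field_simp
    rw [this]
    gcongr
  refine le_trans (le_of_eq ?_) hmono
  have hne : ∀ x ∈ Icc s t, x ≠ 0 := fun x hx => (hs.trans_le hx.1).ne'
  have hcont : ContinuousOn (fun r : ℝ => 2 * Real.pi * ((r ^ 3)⁻¹ + ‖b‖ ^ 2 * r)) (Icc s t) := by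
    have : ContinuousOn (fun r : ℝ => (r ^ 3)⁻¹) (Icc s t) :=
      ContinuousOn.inv₀ (by fun_prop) fun x hx => pow_ne_zero _ (hne x hx)
    fun_prop
  rw [← ofReal_integral_eq_lintegral_ofReal
    (hcont.integrableOn_Icc.mono_set Ioo_subset_Icc_self)
    ((ae_restrict_iff' measurableSet_Ioo).2 (Eventually.of_forall fun r hr => ?_)),
    ← integral_Ioc_eq_integral_Ioo, ← intervalIntegral.integral_of_le hst]
  · congr 1
    have hderiv : ∀ x ∈ uIcc s t, HasDerivAt
        (fun r : ℝ => Real.pi * (-(r ^ 2)⁻¹ + ‖b‖ ^ 2 * r ^ 2))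
        (2 * Real.pi * ((x ^ 3)⁻¹ + ‖b‖ ^ 2 * x)) x := fun x hx => by
      rw [uIcc_of_le hst] at hx
      have hx0 := hne x hx
      have := ((((hasDerivAt_pow 2 x).fun_inv (pow_ne_zero 2 hx0)).fun_neg).fun_add
        ((hasDerivAt_pow 2 x).const_mul (‖b‖ ^ 2))).const_mul Real.pi
      refine this.congr_deriv ?_
      simp only [Nat.cast_ofNat]
      field_simp
      norm_num
    rw [intervalIntegral.integral_eq_sub_of_hasDerivAt hderiv]
    · ring
    · exact (by rwa [uIcc_of_le hst] : ContinuousOn _ (uIcc s t)).intervalIntegrable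
  · have : 0 < r := hs.trans hr.1
    positivity

theorem norm_inv_add_sub_mul_conj_le {b z h : ℂ} {s C : ℝ} (hs : 0 < s) (hsz : s ≤ ‖z‖)
    (hz : ‖z‖ ≤ 1) (hC : ‖h‖ ≤ C) (hsmall : 2 * s * (‖b‖ + C) ≤ 1) :
    ‖(z⁻¹ + b * z + z ^ 2 * h) - b * s ^ 2 * conj (z⁻¹ + b * z + z ^ 2 * h)‖ ≤
      s⁻¹ + (‖b‖ * (‖b‖ + C) + C) * s ^ 2 := by
  set x := ‖z‖ with hx
  have hx0 : 0 < x := hs.trans_le hsz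
  have hC0 : 0 ≤ C := (norm_nonneg h).trans hC
  have hz0 : z ≠ 0 := norm_pos_iff.1 hx0
  have hconj : conj z⁻¹ = z / (x : ℂ) ^ 2 := by
    rw [map_inv₀, eq_div_iff (pow_ne_zero 2 (by exact_mod_cast hx0.ne')), hx, ← mul_conj']
    have : conj z ≠ 0 := by simpa using hz0
    field_simp
  have hsplit : (z⁻¹ + b * z + z ^ 2 * h) - b * s ^ 2 * conj (z⁻¹ + b * z + z ^ 2 * h) =
      z⁻¹ + b * z * ((1 - s ^ 2 / x ^ 2 : ℝ) : ℂ) + z ^ 2 * h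
        - b * s ^ 2 * conj (b * z + z ^ 2 * h) := by
    rw [add_assoc z⁻¹, map_add, hconj]
    push_cast
    ring
  have hfac : 0 ≤ 1 - s ^ 2 / x ^ 2 := by
    rw [sub_nonneg, div_le_one (by positivity)]
    gcongr
  have hn1 : ‖b * z * ((1 - s ^ 2 / x ^ 2 : ℝ) : ℂ)‖ = ‖b‖ * x * (1 - s ^ 2 / x ^ 2) := by
    rw [norm_mul, norm_mul, norm_real, Real.norm_of_nonneg hfac]
  have hn2 : ‖z ^ 2 * h‖ ≤ C * x ^ 2 := by
    rw [norm_mul, norm_pow, mul_comm]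
    gcongr
  have hn3 : ‖b * s ^ 2 * conj (b * z + z ^ 2 * h)‖ ≤ ‖b‖ * s ^ 2 * (‖b‖ + C) := by
    rw [norm_mul, norm_mul, norm_pow, norm_real, Real.norm_of_nonneg hs.le, norm_conj]
    gcongr
    refine (norm_add_le _ _).trans (add_le_add ?_ (hn2.trans ?_))
    · rw [norm_mul]
      exact mul_le_of_le_one_right (norm_nonneg _) hz
    · exact mul_le_of_le_one_right hC0 (pow_le_one₀ hx0.le hz)
  have hkey : x⁻¹ + ‖b‖ * x * (1 - s ^ 2 / x ^ 2) + C * (x ^ 2 - s ^ 2) ≤ s⁻¹ := by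
    have hbound : s * (x + s) * (‖b‖ + C * x) ≤ 1 := by
      refine le_trans ?_ hsmall
      have h1 : x + s ≤ 2 := by linarith
      have h2 : C * x ≤ C := mul_le_of_le_one_right hC0 hz
      calc s * (x + s) * (‖b‖ + C * x) ≤ s * 2 * (‖b‖ + C) := by gcongr
        _ = 2 * s * (‖b‖ + C) := by ring
    have hid : s⁻¹ - (x⁻¹ + ‖b‖ * x * (1 - s ^ 2 / x ^ 2) + C * (x ^ 2 - s ^ 2)) =
        (x - s) * (1 - s * (x + s) * (‖b‖ + C * x)) / (x * s) := by
      field_simp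
      ring
    have : 0 ≤ (x - s) * (1 - s * (x + s) * (‖b‖ + C * x)) / (x * s) :=
      div_nonneg (mul_nonneg (by linarith) (by linarith)) (by positivity)
    linarith
  rw [hsplit]
  have htri := (norm_sub_le (z⁻¹ + b * z * ((1 - s ^ 2 / x ^ 2 : ℝ) : ℂ) + z ^ 2 * h)
    (b * s ^ 2 * conj (b * z + z ^ 2 * h)))
  have htri' := norm_add₃_le (a := z⁻¹) (b := b * z * ((1 - s ^ 2 / x ^ 2 : ℝ) : ℂ))
    (c := z ^ 2 * h)
  rw [hn1, norm_inv] at htri'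
  nlinarith

/-- **Area theorem**, first coefficient: if `1/z + b z + z² h(z)` is injective on the punctured
unit disc, with `h` holomorphic on the disc, then `|b| ≤ 1`. -/
theorem norm_le_one_of_injOn_inv_add {h : ℂ → ℂ} {b : ℂ}
    (hh : DifferentiableOn ℂ h (ball 0 1))
    (hinj : InjOn (fun z => z⁻¹ + b * z + z ^ 2 * h z) (ball 0 1 \ {0})) : ‖b‖ ≤ 1 := by
  have hmain : ∀ t ∈ Ioo (0 : ℝ) 1, ‖b‖ * t ^ 2 ≤ 1 := by
    intro t ht
    obtain ⟨C, hC⟩ := (isCompact_closedBall (0 : ℂ) t).exists_bound_of_continuousOn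
      (hh.continuousOn.mono (closedBall_subset_ball ht.2))
    set K := ‖b‖ * (‖b‖ + C) + C
    set D := ‖b‖ ^ 2 * t ^ 2 - (t ^ 2)⁻¹ with hD
    have hev : ∀ᶠ s in 𝓝[>] (0 : ℝ), D ≤ 2 * K * s + K ^ 2 * s ^ 4 + 2 * ‖b‖ ^ 2 * s ^ 2 +
        ‖b‖ ^ 2 * s ^ 4 * D - ‖b‖ ^ 4 * s ^ 6 := by
      have hlt : ∀ᶠ s in 𝓝 (0 : ℝ), s < t := eventually_lt_nhds ht.1
      have hsm : ∀ᶠ s in 𝓝 (0 : ℝ), 2 * s * (‖b‖ + C) < 1 :=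
        (Continuous.tendsto' (by fun_prop) _ _ (by simp)).eventually_lt_const zero_lt_one
      have hdet : ∀ᶠ s in 𝓝 (0 : ℝ), ‖b‖ ^ 2 * s ^ 4 < 1 :=
        (Continuous.tendsto' (by fun_prop) _ _ (by simp)).eventually_lt_const zero_lt_one
      filter_upwards [nhdsWithin_le_nhds hlt, nhdsWithin_le_nhds hsm, nhdsWithin_le_nhds hdet,
        self_mem_nhdsWithin] with s hst hss hsd hs
      have hs : 0 < s := hs
      obtain ⟨L, hL, hLdet⟩ := exists_linearMap_sub_mul_conj (b * s ^ 2)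
      have hLdet' : LinearMap.det L = 1 - ‖b‖ ^ 2 * s ^ 4 := by
        rw [hLdet, norm_mul, norm_pow, norm_real, Real.norm_of_nonneg hs.le]; ring
      have hlow := le_volume_image_annulus hh hinj hs hst.le ht.2.le
      set G : ℂ → ℂ := fun z => z⁻¹ + b * z + z ^ 2 * h z
      have hsub : L '' (G '' (norm ⁻¹' Ioo s t)) ⊆ closedBall 0 (s⁻¹ + K * s ^ 2) := by
        rintro _ ⟨_, ⟨z, hz, rfl⟩, rfl⟩
        rw [mem_closedBall_zero_iff, hL]
        exact norm_inv_add_sub_mul_conj_le hs hz.1.le (hz.2.le.trans ht.2.le)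
          (hC z (by simpa using hz.2.le)) hss.le
      have hvol := measure_mono (μ := volume) hsub
      rw [Measure.addHaar_image_linearMap, hLdet', abs_of_pos (by linarith),
        Complex.volume_closedBall] at hvol
      have hle := (mul_le_mul_right hlow (ENNReal.ofReal (1 - ‖b‖ ^ 2 * s ^ 4))).trans hvol
      have hC0 : 0 ≤ C := (norm_nonneg _).trans (hC 0 (by simp [ht.1.le]))
      have hM : 0 ≤ s⁻¹ + K * s ^ 2 := by positivity
      rw [← ENNReal.ofReal_mul (by linarith), ← ENNReal.ofReal_pow hM,
        show ((NNReal.pi : NNReal) : ENNReal) = ENNReal.ofReal Real.pi from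
          (ENNReal.ofReal_coe_nnreal (p := NNReal.pi)).symm,
        ← ENNReal.ofReal_mul (by positivity), ENNReal.ofReal_le_ofReal_iff (by positivity)] at hle
      have hle' : (1 - ‖b‖ ^ 2 * s ^ 4) * ((s ^ 2)⁻¹ - (t ^ 2)⁻¹ + ‖b‖ ^ 2 * (t ^ 2 - s ^ 2)) ≤
          (s⁻¹ + K * s ^ 2) ^ 2 := by
        refine le_of_mul_le_mul_right ?_ Real.pi_pos
        linarith
      have hl : (1 - ‖b‖ ^ 2 * s ^ 4) * ((s ^ 2)⁻¹ - (t ^ 2)⁻¹ + ‖b‖ ^ 2 * (t ^ 2 - s ^ 2)) =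
          (s ^ 2)⁻¹ + D - 2 * ‖b‖ ^ 2 * s ^ 2 - ‖b‖ ^ 2 * s ^ 4 * D + ‖b‖ ^ 4 * s ^ 6 := by
        have ht0 : t ≠ 0 := ht.1.ne'
        rw [hD]
        field_simp
        ring
      have hr : (s⁻¹ + K * s ^ 2) ^ 2 = (s ^ 2)⁻¹ + 2 * K * s + K ^ 2 * s ^ 4 := by
        field_simp
        ring
      rw [hl, hr] at hle'
      linarith
    have hlim : Tendsto (fun s : ℝ => 2 * K * s + K ^ 2 * s ^ 4 + 2 * ‖b‖ ^ 2 * s ^ 2 +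
        ‖b‖ ^ 2 * s ^ 4 * D - ‖b‖ ^ 4 * s ^ 6) (𝓝[>] 0) (𝓝 0) :=
      (Continuous.tendsto' (by fun_prop) _ _ (by simp)).mono_left nhdsWithin_le_nhds
    have hD0 : D ≤ 0 := ge_of_tendsto hlim hev
    have ht2 : 0 < t ^ 2 := pow_pos ht.1 2
    have hsq : (‖b‖ * t ^ 2) ^ 2 ≤ 1 := by
      have h1 : ‖b‖ ^ 2 * t ^ 2 ≤ (t ^ 2)⁻¹ := by linarith
      calc (‖b‖ * t ^ 2) ^ 2 = ‖b‖ ^ 2 * t ^ 2 * t ^ 2 := by ring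
        _ ≤ (t ^ 2)⁻¹ * t ^ 2 := by gcongr
        _ = 1 := inv_mul_cancel₀ ht2.ne'
    exact (sq_le_one_iff₀ (by positivity)).1 hsq
  have hlim : Tendsto (fun t : ℝ => ‖b‖ * t ^ 2) (𝓝[<] 1) (𝓝 ‖b‖) :=
    (Continuous.tendsto' (by fun_prop) _ _ (by simp)).mono_left nhdsWithin_le_nhds
  refine le_of_tendsto hlim ?_
  filter_upwards [Ioo_mem_nhdsLT zero_lt_one] with t ht using hmain t ht

/-- The Schwarzian derivative at the origin of `c + a z / ψ(z)`, where `ψ(0) = 1`. -/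
theorem schwarzianDeriv_zero_of_eq_add_mul_div {f ψ : ℂ → ℂ} {a c : ℂ} (ha : a ≠ 0)
    (hψ : AnalyticAt ℂ ψ 0) (hψ0 : ψ 0 = 1) (hf : ∀ᶠ z in 𝓝 0, f z = c + a * (z / ψ z)) :
    schwarzianDeriv f 0 = -3 * deriv (deriv ψ) 0 := by
  have hψ' : AnalyticAt ℂ (deriv ψ) 0 := hψ.deriv
  have hψ'' : AnalyticAt ℂ (deriv (deriv ψ)) 0 := hψ'.deriv
  have hne : ∀ᶠ z in 𝓝 (0 : ℂ), ψ z ≠ 0 := hψ.continuousAt.eventually_ne (by simp [hψ0])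
  have hne' : ∀ᶠ z in 𝓝 (0 : ℂ), ψ z - z * deriv ψ z ≠ 0 := by
    have : ContinuousAt (fun z => ψ z - z * deriv ψ z) 0 :=
      hψ.continuousAt.sub (continuousAt_id.mul hψ'.continuousAt)
    exact this.eventually_ne (by simp [hψ0])
  have hd1 : ∀ᶠ z in 𝓝 0, deriv f z = a * ((ψ z - z * deriv ψ z) / ψ z ^ 2) := by
    filter_upwards [hf.eventually_nhds, hne, hψ.eventually_analyticAt] with z hz hzne hza
    have h1 := (((hasDerivAt_id z).fun_div hza.differentiableAt.hasDerivAt hzne).const_mul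
      a).const_add c
    rw [(h1.congr_of_eventuallyEq hz).deriv]
    simp
  have hd2 : ∀ᶠ z in 𝓝 0, deriv (deriv f) z / deriv f z =
      -(z * deriv (deriv ψ) z) / (ψ z - z * deriv ψ z) - 2 * (deriv ψ z / ψ z) := by
    filter_upwards [hd1, hd1.eventually_nhds, hne, hne', hψ.eventually_analyticAt,
      hψ'.eventually_analyticAt] with z hz1 hz hzne hzne' hza hza'
    have hψz := hza.differentiableAt.hasDerivAt
    have h1 := ((hψz.fun_sub ((hasDerivAt_id z).fun_mul
      hza'.differentiableAt.hasDerivAt)).fun_div (hψz.fun_pow 2) (pow_ne_zero 2 hzne)).const_mul a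
    rw [(h1.congr_of_eventuallyEq hz).deriv, hz1]
    simp only [id, Nat.cast_ofNat]
    norm_num
    field_simp
  have hd3 : HasDerivAt (fun z => -(z * deriv (deriv ψ) z) / (ψ z - z * deriv ψ z) -
      2 * (deriv ψ z / ψ z)) (-3 * deriv (deriv ψ) 0 + 2 * deriv ψ 0 ^ 2) 0 := by
    have e0 := hψ.differentiableAt.hasDerivAt
    have e1 := hψ'.differentiableAt.hasDerivAt
    have e2 := hψ''.differentiableAt.hasDerivAt
    have h1 := ((((hasDerivAt_id (0 : ℂ)).fun_mul e2).fun_neg).fun_div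
      (e0.fun_sub ((hasDerivAt_id (0 : ℂ)).fun_mul e1)) (by simp [hψ0])).fun_sub
      ((e1.fun_div e0 (by simp [hψ0])).const_mul 2)
    refine h1.congr_deriv ?_
    simp [hψ0]
    ring
  rw [schwarzianDeriv, (hd3.congr_of_eventuallyEq hd2).deriv, hd2.self_of_nhds]
  simp [hψ0]
  ring

theorem eq_add_mul_dslope_zero (F : ℂ → ℂ) (z : ℂ) : F z = F 0 + z * dslope F 0 z := by
  have := sub_smul_dslope F 0 z
  simp only [sub_zero, smul_eq_mul] at this
  rw [this]
  ring

theorem deriv_deriv_eq_two_mul_deriv_dslope {ψ : ℂ → ℂ} (hψ : AnalyticAt ℂ (dslope ψ 0) 0) :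
    deriv (deriv ψ) 0 = 2 * deriv (dslope ψ 0) 0 := by
  have hd : ∀ᶠ z in 𝓝 0, deriv ψ z = dslope ψ 0 z + z * deriv (dslope ψ 0) z := by
    filter_upwards [hψ.eventually_analyticAt] with z hz
    have h1 := ((hasDerivAt_id z).fun_mul hz.differentiableAt.hasDerivAt).const_add (ψ 0)
    rw [(h1.congr_of_eventuallyEq (Eventually.of_forall (eq_add_mul_dslope_zero ψ))).deriv, one_mul,
      id]
  have h3 := hψ.differentiableAt.hasDerivAt.fun_add
    ((hasDerivAt_id (0 : ℂ)).fun_mul hψ.deriv.differentiableAt.hasDerivAt)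
  rw [(h3.congr_of_eventuallyEq hd).deriv]
  simp
  ring

theorem norm_schwarzianDeriv_zero_le {f : ℂ → ℂ} (hf : DifferentiableOn ℂ f (ball 0 1))
    (hinj : InjOn f (ball 0 1)) : ‖schwarzianDeriv f 0‖ ≤ 6 := by
  have hnhds : ball (0 : ℂ) 1 ∈ 𝓝 0 := ball_mem_nhds 0 one_pos
  have h0 : (0 : ℂ) ∈ ball (0 : ℂ) 1 := mem_ball_self one_pos
  have hds : ∀ {F : ℂ → ℂ}, DifferentiableOn ℂ F (ball 0 1) →
      DifferentiableOn ℂ (dslope F 0) (ball 0 1) := fun hF =>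
    (differentiableOn_dslope hnhds).2 hF
  set a := deriv f 0 with ha_def
  have ha : a ≠ 0 := (hf.analyticAt hnhds).deriv_ne_zero_of_injOn hnhds hinj
  set φ := dslope f 0 with hφ_def
  have hφ0 : φ 0 = a := dslope_same f 0
  have hφne : ∀ z ∈ ball (0 : ℂ) 1, φ z ≠ 0 := by
    intro z hz hφz
    by_cases hz0 : z = 0
    · rw [hz0, hφ0] at hφz
      exact ha hφz
    · have := eq_add_mul_dslope_zero f z
      rw [← hφ_def, hφz, mul_zero, add_zero] at this
      exact hz0 (hinj hz h0 this)
  set ψ : ℂ → ℂ := fun z => a / φ z with hψ_def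
  have hψd : DifferentiableOn ℂ ψ (ball 0 1) := (differentiableOn_const a).div (hds hf) hφne
  have hψ0 : ψ 0 = 1 := by simp [hψ_def, hφ0, ha]
  have hfψ : ∀ z ∈ ball (0 : ℂ) 1, f z = f 0 + a * (z / ψ z) := fun z hz => by
    have hφz := hφne z hz
    rw [eq_add_mul_dslope_zero f z, ← hφ_def, hψ_def]
    field_simp
  have hS : schwarzianDeriv f 0 = -3 * deriv (deriv ψ) 0 :=
    schwarzianDeriv_zero_of_eq_add_mul_div ha (hψd.analyticAt hnhds) hψ0
      (eventually_of_mem hnhds hfψ)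
  set ψ₁ := dslope ψ 0 with hψ₁
  set ψ₂ := dslope ψ₁ 0 with hψ₂
  rw [deriv_deriv_eq_two_mul_deriv_dslope ((hds hψd).analyticAt hnhds), ← hψ₁,
    ← dslope_same ψ₁ 0, ← hψ₂] at hS
  have hb : ‖ψ₂ 0‖ ≤ 1 := by
    refine norm_le_one_of_injOn_inv_add (hds (hds (hds hψd))) ?_
    rintro z ⟨hz, hz0⟩ w ⟨hw, hw0⟩ hzw
    have hG : ∀ x ∈ ball (0 : ℂ) 1, x ≠ 0 →
        x⁻¹ + ψ₂ 0 * x + x ^ 2 * dslope ψ₂ 0 x = a / (f x - f 0) - ψ₁ 0 := by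
      intro x hx hx0
      have hψx : ψ x = 1 + x * (ψ₁ 0 + x * (ψ₂ 0 + x * dslope ψ₂ 0 x)) := by
        rw [← eq_add_mul_dslope_zero ψ₂ x, ← eq_add_mul_dslope_zero ψ₁ x, ← hψ0,
          ← eq_add_mul_dslope_zero ψ x]
      have hψne : ψ x ≠ 0 := div_ne_zero ha (hφne x hx)
      have hq : a / (f x - f 0) = ψ x / x := by
        rw [hfψ x hx, add_sub_cancel_left]
        field_simp
      rw [hq, hψx]
      field_simp
      ring
    dsimp only at hzw
    rw [hG z hz hz0, hG w hw hw0, sub_left_inj, div_eq_mul_inv, div_eq_mul_inv, mul_right_inj' ha,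
      inv_inj, sub_left_inj] at hzw
    exact hinj hz hw hzw
  rw [hS, norm_mul, norm_mul]
  norm_num
  linarith

theorem one_add_conj_mul_ne_zero_s5 {z w : ℂ} (hz : ‖z‖ < 1) (hw : ‖w‖ < 1) :
    1 + conj z * w ≠ 0 := by
  intro h
  have h1 : conj z * w = -1 := by linear_combination h
  have h2 : ‖z‖ * ‖w‖ = 1 := by simpa using congrArg norm h1
  nlinarith [norm_nonneg z, norm_nonneg w]

theorem norm_add_div_one_add_conj_mul_lt_one {z w : ℂ} (hz : ‖z‖ < 1) (hw : ‖w‖ < 1) :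
    ‖(w + z) / (1 + conj z * w)‖ < 1 := by
  have hne := one_add_conj_mul_ne_zero_s5 hz hw
  rw [norm_div, div_lt_one (norm_pos_iff.2 hne)]
  refine lt_of_pow_lt_pow_left₀ 2 (norm_nonneg _) ?_
  have hid : normSq (1 + conj z * w) - normSq (w + z) = (1 - normSq z) * (1 - normSq w) := by
    simp only [normSq_apply, add_re, add_im, mul_re, mul_im, conj_re, conj_im, one_re, one_im]
    ring
  simp only [normSq_eq_norm_sq] at hid
  have h1 : 0 < 1 - ‖z‖ ^ 2 := by nlinarith [norm_nonneg z]
  have h2 : 0 < 1 - ‖w‖ ^ 2 := by nlinarith [norm_nonneg w]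
  nlinarith [mul_pos h1 h2]

theorem hasDerivAt_add_div_one_add_conj_mul {z w : ℂ} (hne : 1 + conj z * w ≠ 0) :
    HasDerivAt (fun w => (w + z) / (1 + conj z * w))
      ((1 - conj z * z) / (1 + conj z * w) ^ 2) w := by
  have h1 := ((hasDerivAt_id w).add_const z).fun_div
    (((hasDerivAt_id w).const_mul (conj z)).const_add 1) hne
  refine h1.congr_deriv ?_
  simp only [id]
  congr 1
  ring

/-- The Schwarzian derivative of the Koebe transform at the origin. -/
theorem schwarzianDeriv_comp_add_div_one_add_conj_mul {g : ℂ → ℂ} {z : ℂ} (hz : ‖z‖ < 1)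
    (hg : AnalyticAt ℂ g z) (hg0 : deriv g z ≠ 0) :
    schwarzianDeriv (fun w => g ((w + z) / (1 + conj z * w))) 0 =
      schwarzianDeriv g z * (1 - conj z * z) ^ 2 := by
  set T : ℂ → ℂ := fun w => (w + z) / (1 + conj z * w) with hT
  have hT0 : T 0 = z := by simp [hT]
  have hk : 1 - conj z * z ≠ 0 := by
    simpa [sub_eq_add_neg] using one_add_conj_mul_ne_zero_s5 (z := z) (w := -z) hz (by simpa using hz)
  have hTd : ∀ w, 1 + conj z * w ≠ 0 →
      HasDerivAt T ((1 - conj z * z) / (1 + conj z * w) ^ 2) w := fun w hw =>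
    hasDerivAt_add_div_one_add_conj_mul hw
  have hden : ∀ᶠ w in 𝓝 (0 : ℂ), 1 + conj z * w ≠ 0 :=
    (Continuous.continuousAt (by fun_prop)).eventually_ne (by simp)
  have hTc : Tendsto T (𝓝 0) (𝓝 z) := by
    have := (hTd 0 (by simp)).continuousAt.tendsto
    rwa [hT0] at this
  have hg' := hg.deriv
  have hg'' := hg'.deriv
  have hd1 : ∀ᶠ w in 𝓝 0, deriv (fun w => g (T w)) w =
      deriv g (T w) * ((1 - conj z * z) / (1 + conj z * w) ^ 2) := by
    filter_upwards [hden, hTc.eventually hg.eventually_analyticAt] with w hw hgw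
    exact (hgw.differentiableAt.hasDerivAt.comp w (hTd w hw)).deriv
  have hd2 : ∀ᶠ w in 𝓝 0, deriv (deriv (fun w => g (T w))) w / deriv (fun w => g (T w)) w =
      deriv (deriv g) (T w) / deriv g (T w) * ((1 - conj z * z) / (1 + conj z * w) ^ 2) -
        2 * conj z / (1 + conj z * w) := by
    filter_upwards [hd1, hd1.eventually_nhds, hden, hTc.eventually hg'.eventually_analyticAt,
      hTc.eventually (hg'.continuousAt.eventually_ne hg0)] with w hw1 hw hwd hgw hgne
    have h1 := (hgw.differentiableAt.hasDerivAt.comp w (hTd w hwd)).fun_mul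
      ((hasDerivAt_const w (1 - conj z * z)).fun_div
        ((((hasDerivAt_id w).const_mul (conj z)).const_add 1).fun_pow 2) (pow_ne_zero 2 hwd))
    rw [(h1.congr_of_eventuallyEq hw).deriv, hw1]
    simp only [id, Function.comp_apply, Nat.cast_ofNat]
    norm_num
    field_simp
    ring
  have hN : HasDerivAt (fun w => deriv (deriv g) w / deriv g w)
      (deriv (fun w => deriv (deriv g) w / deriv g w) z) (T 0) := by
    rw [hT0]
    exact (hg''.div hg' hg0).differentiableAt.hasDerivAt
  have hd3 : HasDerivAt (fun w => deriv (deriv g) (T w) / deriv g (T w) *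
      ((1 - conj z * z) / (1 + conj z * w) ^ 2) - 2 * conj z / (1 + conj z * w))
      (deriv (fun w => deriv (deriv g) w / deriv g w) z * (1 - conj z * z) ^ 2 -
        2 * conj z * (1 - conj z * z) * (deriv (deriv g) z / deriv g z) + 2 * conj z ^ 2) 0 := by
    have hlin := ((hasDerivAt_id (0 : ℂ)).const_mul (conj z)).const_add 1
    have h1 := ((hN.comp 0 (hTd 0 (by simp))).fun_mul
      ((hasDerivAt_const 0 (1 - conj z * z)).fun_div (hlin.fun_pow 2) (by simp))).fun_sub
      ((hasDerivAt_const 0 (2 * conj z)).fun_div hlin (by simp))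
    refine h1.congr_deriv ?_
    simp [hT0]
    ring
  rw [schwarzianDeriv, (hd3.congr_of_eventuallyEq hd2).deriv, hd2.self_of_nhds, schwarzianDeriv,
    hT0]
  simp
  ring

/-- Nehari's necessary condition: if `g` is holomorphic and injective on the
open unit disc, then `g'` never vanishes there and the Schwarzian derivative
satisfies `|{g; z}| ≤ 6/(1-|z|²)²` on the disc. -/
theorem nehari_necessary (g : ℂ → ℂ)
    (hdiff : DifferentiableOn ℂ g (Metric.ball 0 1))
    (hinj : Set.InjOn g (Metric.ball 0 1)) :
    (∀ z ∈ Metric.ball (0 : ℂ) 1, deriv g z ≠ 0) ∧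
    (∀ z ∈ Metric.ball (0 : ℂ) 1,
      ‖schwarzianDeriv g z‖ ≤ 6 / (1 - ‖z‖ ^ 2) ^ 2) := by
  have hne : ∀ z ∈ ball (0 : ℂ) 1, deriv g z ≠ 0 := fun z hz =>
    (hdiff.analyticAt (isOpen_ball.mem_nhds hz)).deriv_ne_zero_of_injOn
      (isOpen_ball.mem_nhds hz) hinj
  refine ⟨hne, fun z hz => ?_⟩
  have hz1 : ‖z‖ < 1 := by simpa using hz
  have hpos : 0 < 1 - ‖z‖ ^ 2 := by nlinarith [norm_nonneg z]
  have hmaps : MapsTo (fun w => (w + z) / (1 + conj z * w)) (ball 0 1) (ball 0 1) :=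
    fun w hw => by
      simpa using norm_add_div_one_add_conj_mul_lt_one hz1 (by simpa using hw)
  have hk : (1 : ℂ) - conj z * z = ((1 - ‖z‖ ^ 2 : ℝ) : ℂ) := by
    rw [conj_mul']
    push_cast
    rfl
  have hTinj : InjOn (fun w => (w + z) / (1 + conj z * w)) (ball 0 1) := by
    intro v hv w hw hvw
    have hv0 := one_add_conj_mul_ne_zero_s5 hz1 (by simpa using hv : ‖v‖ < 1)
    have hw0 := one_add_conj_mul_ne_zero_s5 hz1 (by simpa using hw : ‖w‖ < 1)
    dsimp only at hvw
    rw [div_eq_div_iff hv0 hw0] at hvw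
    have hprod : (v - w) * (1 - conj z * z) = 0 := by linear_combination hvw
    rw [hk] at hprod
    exact sub_eq_zero.1 ((mul_eq_zero.1 hprod).resolve_right (ofReal_ne_zero.2 hpos.ne'))
  have hTd : DifferentiableOn ℂ (fun w => (w + z) / (1 + conj z * w)) (ball 0 1) := fun w hw =>
    (hasDerivAt_add_div_one_add_conj_mul (one_add_conj_mul_ne_zero_s5 hz1
      (by simpa using hw))).differentiableAt.differentiableWithinAt
  have hbound := norm_schwarzianDeriv_zero_le (hdiff.comp hTd hmaps) (hinj.comp hTinj hmaps)
  rw [Function.comp_def, schwarzianDeriv_comp_add_div_one_add_conj_mul hz1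
    (hdiff.analyticAt (isOpen_ball.mem_nhds hz)) (hne z hz), hk, norm_mul, norm_pow, norm_real,
    Real.norm_of_nonneg hpos.le] at hbound
  exact (le_div_iff₀ (by positivity)).2 hbound
end

section
/- Let f : ℂ → ℂ be holomorphic and injective on the open unit disc 𝔻 = {z ∈ ℂ : |z| < 1}, with f(0) = 0 and f'(0) = 1, and let bₖ = f⁽ᵏ⁾(0)/k! be its Taylor coefficients at 0 (so b₁ = 1). Then for every integer n ≥ 1, the partial sum fₙ(z) := Σ_{k=1}^{n} bₖ z^k is injective on the open disc {z ∈ ℂ : |z| < 1/4}. -/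
section

open Metric Set Filter Topology

/-- The `k`-th Taylor coefficient of `f` at `0`. -/
noncomputable def taylorCoeff (f : ℂ → ℂ) (k : ℕ) : ℂ :=
  iteratedDeriv k f 0 / (k.factorial : ℂ)

lemma taylorCoeff_zero (f : ℂ → ℂ) : taylorCoeff f 0 = f 0 := by
  simp [taylorCoeff]

lemma taylorCoeff_one (f : ℂ → ℂ) : taylorCoeff f 1 = deriv f 0 := by
  simp [taylorCoeff]

lemma hasSum_taylorCoeff {f : ℂ → ℂ} (hf : DifferentiableOn ℂ f (ball 0 1)) {z : ℂ}
    (hz : z ∈ ball (0 : ℂ) 1) : HasSum (fun k => taylorCoeff f k * z ^ k) (f z) := by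
  have := Complex.hasSum_taylorSeries_on_ball hf hz
  simp only [sub_zero, smul_eq_mul] at this
  refine this.congr_fun fun k => ?_
  simp only [taylorCoeff]
  ring

lemma summable_norm_taylorCoeff {f : ℂ → ℂ} (hf : DifferentiableOn ℂ f (ball 0 1)) {r : ℝ}
    (hr0 : 0 ≤ r) (hr1 : r < 1) : Summable (fun k => ‖taylorCoeff f k‖ * r ^ k) := by
  have h := (hasSum_taylorCoeff hf (z := (r : ℂ)) (by simp [abs_of_nonneg hr0, hr1])).summable.norm
  refine h.congr fun k => ?_
  simp [abs_of_nonneg hr0]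

lemma analyticAt_of_differentiableOn_ball {f : ℂ → ℂ}
    (hf : DifferentiableOn ℂ f (ball 0 1)) : AnalyticAt ℂ f 0 :=
  hf.analyticAt (ball_mem_nhds _ one_pos)

lemma taylorCoeff_mul {f g : ℂ → ℂ} (hf : DifferentiableOn ℂ f (ball 0 1))
    (hg : DifferentiableOn ℂ g (ball 0 1)) (n : ℕ) :
    taylorCoeff (fun z => f z * g z) n =
      ∑ i ∈ Finset.range (n + 1), taylorCoeff f i * taylorCoeff g (n - i) := by
  have h := iteratedDeriv_mul (n := n)
    (analyticAt_of_differentiableOn_ball hf).contDiffAt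
    (analyticAt_of_differentiableOn_ball hg).contDiffAt
  simp only [taylorCoeff]
  change iteratedDeriv n (f * g) 0 / _ = _
  rw [h, Finset.sum_div]
  refine Finset.sum_congr rfl fun i hi => ?_
  have hi : i ≤ n := Nat.lt_succ_iff.mp (Finset.mem_range.mp hi)
  rw [Nat.cast_choose ℂ hi]
  have := Nat.cast_ne_zero (R := ℂ).mpr n.factorial_ne_zero
  have := Nat.cast_ne_zero (R := ℂ).mpr i.factorial_ne_zero
  have := Nat.cast_ne_zero (R := ℂ).mpr (n - i).factorial_ne_zero
  field_simp

lemma taylorCoeff_congr {f g : ℂ → ℂ} (h : EqOn f g (ball 0 1)) (k : ℕ) :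
    taylorCoeff f k = taylorCoeff g k := by
  have : f =ᶠ[𝓝 0] g := h.eventuallyEq_of_mem (ball_mem_nhds _ one_pos)
  simp [taylorCoeff, this.iteratedDeriv_eq]

/-- Uniqueness of power series expansions on the unit disc. -/
lemma taylorCoeff_eq_of_hasSum {f : ℂ → ℂ} {c : ℕ → ℂ}
    (h : ∀ z ∈ ball (0 : ℂ) 1, HasSum (fun k => c k * z ^ k) (f z)) (k : ℕ) :
    taylorCoeff f k = c k := by
  have hp : HasFPowerSeriesOnBall f (FormalMultilinearSeries.ofScalars ℂ c) 0 1 := by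
    refine ⟨?_, one_pos, ?_⟩
    · refine le_of_forall_lt_imp_le_of_dense fun r hr => ?_
      lift r to NNReal using hr.ne_top
      refine FormalMultilinearSeries.le_radius_of_summable _ ?_
      have := (h (r : ℝ) (by simpa using hr)).summable.norm
      refine this.congr fun n => ?_
      simp
    · intro y hy
      have hy' : ‖y‖₊ < 1 := by simpa [enorm] using hy
      have := h y (by simpa using NNReal.coe_lt_coe.mpr hy')
      simpa [FormalMultilinearSeries.ofScalars_apply_eq, mul_comm] using this
  have h1 := hp.hasFPowerSeriesAt.eq_formalMultilinearSeries
    hp.analyticAt.hasFPowerSeriesAt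
  have h2 := congrArg (fun p : FormalMultilinearSeries ℂ ℂ ℂ => p.coeff k) h1
  simp only [FormalMultilinearSeries.coeff_ofScalars] at h2
  rw [h2]
  rfl

lemma taylorCoeff_deriv (f : ℂ → ℂ) (k : ℕ) :
    taylorCoeff (deriv f) k = (k + 1) * taylorCoeff f (k + 1) := by
  simp only [taylorCoeff, iteratedDeriv_succ', Nat.factorial_succ]
  have := Nat.cast_ne_zero (R := ℂ).mpr k.factorial_ne_zero
  have : (k + 1 : ℂ) ≠ 0 := Nat.cast_add_one_ne_zero k
  push_cast
  field_simp

/-- The Taylor coefficients of `z f'(z) - f(z)`. -/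
lemma taylorCoeff_mul_deriv_sub {f : ℂ → ℂ} (hf : DifferentiableOn ℂ f (ball 0 1)) (k : ℕ) :
    taylorCoeff (fun z => z * deriv f z - f z) k = (k - 1) * taylorCoeff f k := by
  refine taylorCoeff_eq_of_hasSum (c := fun k => (k - 1) * taylorCoeff f k) (fun z hz => ?_) k
  have h1 := hasSum_taylorCoeff hf hz
  have h2 := (hasSum_taylorCoeff (hf.deriv isOpen_ball) hz).mul_left z
  have h3 : HasSum (fun k : ℕ => k * taylorCoeff f k * z ^ k) (z * deriv f z) := by
    rw [← hasSum_nat_add_iff' 1]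
    simp only [Finset.sum_range_one, Nat.cast_zero, zero_mul, sub_zero]
    convert! h2 using 2 with k
    rw [taylorCoeff_deriv]
    push_cast
    ring
  convert! h3.sub h1 using 2 with k
  ring

open intervalIntegral in
/-- Cauchy's formula for Taylor coefficients as a Fourier integral over a circle. -/
lemma integral_mul_conj_pow {q : ℂ → ℂ} (hq : DifferentiableOn ℂ q (ball 0 1)) {r : ℝ}
    (hr0 : 0 < r) (hr1 : r < 1) (n : ℕ) :
    ∫ θ in (0 : ℝ)..2 * Real.pi, q (circleMap 0 r θ) *
      (starRingEnd ℂ) (circleMap 0 r θ) ^ n = 2 * Real.pi * taylorCoeff q n * r ^ (2 * n) := by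
  have h := DifferentiableOn.circleIntegral_one_div_sub_center_pow_smul hr0 n
    (hq.mono (closedBall_subset_ball hr1))
  have hr : (r : ℂ) ≠ 0 := by exact_mod_cast hr0.ne'
  have key : ∀ θ : ℝ, q (circleMap 0 r θ) * (starRingEnd ℂ) (circleMap 0 r θ) ^ n =
      (r ^ (2 * n) / Complex.I) * (deriv (circleMap 0 r) θ •
        ((1 / (circleMap 0 r θ - 0) ^ (n + 1)) • q (circleMap 0 r θ))) := by
    intro θ
    have hz : circleMap 0 r θ ≠ 0 := circleMap_ne_center hr0.ne'
    have hc : (starRingEnd ℂ) (circleMap 0 r θ) = r ^ 2 / circleMap 0 r θ := by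
      rw [eq_div_iff hz, Complex.conj_mul', norm_circleMap_zero, abs_of_pos hr0]
    rw [hc, deriv_circleMap, smul_eq_mul, smul_eq_mul, sub_zero, div_pow, ← pow_mul,
      pow_succ (circleMap 0 r θ)]
    field_simp
  simp_rw [key]
  rw [integral_const_mul]
  change _ * (∮ z in C(0, r), (1 / (z - 0) ^ (n + 1)) • q z) = _
  rw [h, smul_eq_mul, taylorCoeff]
  field_simp

open intervalIntegral in
/-- Bessel's inequality for the Taylor coefficients on a circle. -/
lemma sum_norm_taylorCoeff_sq_le {p : ℂ → ℂ} (hp : DifferentiableOn ℂ p (ball 0 1)) {r : ℝ}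
    (hr0 : 0 < r) (hr1 : r < 1) (N : ℕ) :
    2 * Real.pi * ∑ k ∈ Finset.range N, ‖taylorCoeff p k‖ ^ 2 * r ^ (2 * k) ≤
      ∫ θ in (0 : ℝ)..2 * Real.pi, ‖p (circleMap 0 r θ)‖ ^ 2 := by
  set P : ℂ → ℂ := fun z => ∑ k ∈ Finset.range N, taylorCoeff p k * z ^ k with hP
  have hPd : Differentiable ℂ P := by fun_prop
  have hPc : ∀ k ∈ Finset.range N, taylorCoeff P k = taylorCoeff p k := by
    intro k hk
    rw [taylorCoeff_eq_of_hasSum (f := P)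
      (c := fun k => if k ∈ Finset.range N then taylorCoeff p k else 0) ?_ k, if_pos hk]
    intro z _
    have := hasSum_sum_of_ne_finset_zero (L := .unconditional ℕ) (s := Finset.range N)
      (f := fun k => (if k ∈ Finset.range N then taylorCoeff p k else 0) * z ^ k)
      (fun b hb => by simp only [if_neg hb, zero_mul])
    convert! this using 1
    exact Finset.sum_congr rfl fun k hk => by simp only [if_pos hk]
  have hcm : Continuous (circleMap 0 r) := continuous_circleMap 0 r
  have hcont : ∀ {q : ℂ → ℂ}, DifferentiableOn ℂ q (ball 0 1) →
      Continuous (fun θ => q (circleMap 0 r θ)) := fun hq =>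
    hq.continuousOn.comp_continuous hcm (fun θ => by simpa [abs_of_pos hr0] using hr1)
  have hPcont := hcont hPd.differentiableOn
  have hpcont := hcont hp
  have inner : ∀ {q : ℂ → ℂ}, DifferentiableOn ℂ q (ball 0 1) →
      ∫ θ in (0 : ℝ)..2 * Real.pi, q (circleMap 0 r θ) * (starRingEnd ℂ) (P (circleMap 0 r θ)) =
        ∑ k ∈ Finset.range N, (starRingEnd ℂ) (taylorCoeff p k) *
          (2 * Real.pi * taylorCoeff q k * r ^ (2 * k)) := by
    intro q hq
    have hqc := hcont hq
    simp only [hP, map_sum, map_mul, map_pow, Finset.mul_sum]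
    rw [integral_finsetSum]
    · refine Finset.sum_congr rfl fun k _ => ?_
      rw [← integral_mul_conj_pow hq hr0 hr1, ← integral_const_mul]
      congr 1
      ext θ
      ring
    · intro k _
      exact (hqc.mul (continuous_const.mul
        ((Complex.continuous_conj.comp hcm).pow k))).intervalIntegrable _ _
  have hval : ∀ {q : ℂ → ℂ}, DifferentiableOn ℂ q (ball 0 1) →
      (∀ k ∈ Finset.range N, taylorCoeff q k = taylorCoeff p k) →
      ∫ θ in (0 : ℝ)..2 * Real.pi,
        (q (circleMap 0 r θ) * (starRingEnd ℂ) (P (circleMap 0 r θ))).re =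
        2 * Real.pi * ∑ k ∈ Finset.range N, ‖taylorCoeff p k‖ ^ 2 * r ^ (2 * k) := by
    intro q hq hqk
    have hqc := hcont hq
    have h1 : ∫ θ in (0 : ℝ)..2 * Real.pi,
        (q (circleMap 0 r θ) * (starRingEnd ℂ) (P (circleMap 0 r θ))).re =
        (∫ θ in (0 : ℝ)..2 * Real.pi,
          q (circleMap 0 r θ) * (starRingEnd ℂ) (P (circleMap 0 r θ))).re :=
      Complex.reCLM.intervalIntegral_comp_comm
        (f := fun θ => q (circleMap 0 r θ) * (starRingEnd ℂ) (P (circleMap 0 r θ)))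
        ((hqc.mul (Complex.continuous_conj.comp hPcont)).intervalIntegrable _ _)
    rw [h1, inner hq, Complex.re_sum, Finset.mul_sum]
    refine Finset.sum_congr rfl fun k hk => ?_
    rw [hqk k hk]
    have : (starRingEnd ℂ) (taylorCoeff p k) * (2 * Real.pi * taylorCoeff p k * r ^ (2 * k)) =
        ((2 * Real.pi * (‖taylorCoeff p k‖ ^ 2 * r ^ (2 * k)) : ℝ) : ℂ) := by
      push_cast
      rw [← Complex.conj_mul']
      ring
    rw [this, Complex.ofReal_re]
  have hnonneg : 0 ≤ ∫ θ in (0 : ℝ)..2 * Real.pi, (‖p (circleMap 0 r θ)‖ ^ 2 -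
      2 * (p (circleMap 0 r θ) * (starRingEnd ℂ) (P (circleMap 0 r θ))).re +
      (P (circleMap 0 r θ) * (starRingEnd ℂ) (P (circleMap 0 r θ))).re) := by
    refine integral_nonneg Real.two_pi_pos.le fun θ _ => ?_
    have h1 : (P (circleMap 0 r θ) * (starRingEnd ℂ) (P (circleMap 0 r θ))).re =
        ‖P (circleMap 0 r θ)‖ ^ 2 := by
      rw [Complex.mul_conj']
      norm_cast
    rw [h1]
    have h2 := Complex.re_le_norm (p (circleMap 0 r θ) * (starRingEnd ℂ) (P (circleMap 0 r θ)))
    rw [norm_mul, RCLike.norm_conj] at h2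
    nlinarith [sq_nonneg (‖p (circleMap 0 r θ)‖ - ‖P (circleMap 0 r θ)‖)]
  have hA : Continuous fun θ => ‖p (circleMap 0 r θ)‖ ^ 2 := hpcont.norm.pow 2
  have hB : ∀ {q : ℂ → ℂ}, Continuous (fun θ => q (circleMap 0 r θ)) → Continuous fun θ =>
      (q (circleMap 0 r θ) * (starRingEnd ℂ) (P (circleMap 0 r θ))).re := fun hq =>
    Complex.continuous_re.comp (hq.mul (Complex.continuous_conj.comp hPcont))
  rw [integral_add, integral_sub, integral_const_mul, hval hp fun _ _ => rfl,
    hval hPd.differentiableOn hPc] at hnonneg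
  · linarith
  · exact hA.intervalIntegrable _ _
  · exact (hB hpcont).const_mul 2 |>.intervalIntegrable _ _
  · exact (hA.sub ((hB hpcont).const_mul 2)).intervalIntegrable _ _
  · exact (hB hPcont).intervalIntegrable _ _

lemma isPreconnected_compl_closedBall (q : ℂ) {M : ℝ} (hM : 0 ≤ M) :
    IsPreconnected {w : ℂ | M < ‖w - q‖} := by
  have h : {w : ℂ | M < ‖w - q‖} = (fun x : ℝ × ℝ => circleMap q x.1 x.2) '' (Ioi M ×ˢ univ) := by
    ext w
    constructor
    · intro hw
      refine ⟨(‖w - q‖, (w - q).arg), ⟨hw, trivial⟩, ?_⟩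
      simp [circleMap, Complex.norm_mul_exp_arg_mul_I]
    · rintro ⟨⟨r, θ⟩, ⟨hr, -⟩, rfl⟩
      have hr : M < r := hr
      simpa [circleMap, abs_of_pos (hM.trans_lt hr)] using hr
  rw [h]
  refine IsPreconnected.image ((convex_Ioi M).prod convex_univ).isPreconnected _ ?_
  unfold circleMap
  fun_prop

lemma analyticAt_div_self {φ : ℂ → ℂ} (hφ : DifferentiableOn ℂ φ (ball 0 1)) {z : ℂ}
    (hz : z ∈ ball (0 : ℂ) 1 \ {0}) : AnalyticAt ℂ (fun z => φ z / z) z :=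
  (hφ.analyticAt (isOpen_ball.mem_nhds hz.1)).div analyticAt_id hz.2

/-- If `φ(z) / z` is injective on the punctured unit disc and maps the circle of radius `ε` into
the ellipse `{w | ‖T w - q‖ ≤ M}`, then it maps the outside of that circle into this ellipse. -/
lemma norm_map_sub_le_of_sphere {φ : ℂ → ℂ} (hφ : DifferentiableOn ℂ φ (ball 0 1))
    (h0 : φ 0 = 1) (hinj : InjOn (fun z => φ z / z) (ball 0 1 \ {0})) (T : ℂ ≃L[ℝ] ℂ) (q : ℂ)
    {M ε : ℝ} (hε0 : 0 < ε) (hε1 : ε < 1) (hM : ∀ z : ℂ, ‖z‖ = ε → ‖T (φ z / z) - q‖ ≤ M)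
    {z : ℂ} (hz : ε < ‖z‖) (hz1 : ‖z‖ < 1) : ‖T (φ z / z) - q‖ ≤ M := by
  set h : ℂ → ℂ := fun z => φ z / z with hh
  have hM0 : 0 ≤ M := (norm_nonneg _).trans (hM ε (by simp [hε0.le]))
  set E : Set ℂ := {w | M < ‖T w - q‖} with hE
  have hEpre : IsPreconnected E := by
    have : E = T.symm '' {w : ℂ | M < ‖w - q‖} := by
      ext w
      constructor
      · intro hw
        exact ⟨T w, hw, by simp⟩
      · rintro ⟨u, hu, rfl⟩
        simpa [hE] using hu
    rw [this]
    exact (isPreconnected_compl_closedBall q hM0).image _ T.symm.continuous.continuousOn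
  set U : Set ℂ := h '' (ball 0 ε \ {0}) with hU
  have hsub : ball (0 : ℂ) ε \ {0} ⊆ ball 0 1 \ {0} :=
    sdiff_subset_sdiff_left (ball_subset_ball hε1.le)
  have hUopen : IsOpen U := by
    rw [isOpen_iff_mem_nhds]
    rintro _ ⟨x, hx, rfl⟩
    have hxo : ball (0 : ℂ) ε \ {0} ∈ 𝓝 x :=
      (isOpen_ball.sdiff isClosed_singleton).mem_nhds hx
    rcases (analyticAt_div_self hφ (hsub hx)).eventually_constant_or_nhds_le_map_nhds with hc | hc
    · exfalso
      have h1 : ∀ᶠ y in 𝓝 x, y = x := by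
        filter_upwards [hc, hxo] with y hy hyo
        exact hinj (hsub hyo) (hsub hx) hy
      have h2 : ∀ᶠ y in 𝓝[≠] x, False := by
        filter_upwards [h1.filter_mono nhdsWithin_le_nhds, self_mem_nhdsWithin] with y hy hyx
        exact hyx hy
      exact h2.exists.choose_spec
    · exact hc (image_mem_map hxo)
  set V : Set ℂ := {w | ∃ x ∈ closedBall (0 : ℂ) ε, x * w = φ x} with hV
  have hVclosed : IsClosed V := by
    have hcl : IsClosed {y : closedBall (0 : ℂ) ε × ℂ | (y.1 : ℂ) * y.2 = φ y.1} := by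
      refine isClosed_eq (by fun_prop) ?_
      have h1 : Continuous fun x : closedBall (0 : ℂ) ε => φ x :=
        hφ.continuousOn.comp_continuous continuous_subtype_val
          fun x => closedBall_subset_ball hε1 x.2
      exact h1.comp continuous_fst
    have := isClosedMap_snd_of_compactSpace (X := closedBall (0 : ℂ) ε) (Y := ℂ) _ hcl
    convert this using 1
    ext w
    simp [hV]
  have hcover : E ⊆ U ∪ Vᶜ := by
    intro w hw
    by_cases hwV : w ∈ V
    · left
      obtain ⟨x, hx, hxw⟩ := hwV
      have hx0 : x ≠ 0 := by
        rintro rfl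
        simp [h0] at hxw
      have hwx : h x = w := by simp only [hh, ← hxw]; field_simp
      refine ⟨x, ⟨?_, hx0⟩, hwx⟩
      have hxe : ‖x‖ ≤ ε := by simpa using hx
      rcases hxe.lt_or_eq with hlt | heq
      · simpa using hlt
      · exact absurd (hM x heq) (not_le.mpr (by rw [← hwx] at hw; exact hw))
    · exact Or.inr hwV
  have hdisj : Disjoint U Vᶜ := by
    rw [disjoint_left]
    rintro _ ⟨x, hx, rfl⟩ hw
    refine hw ⟨x, ball_subset_closedBall hx.1, ?_⟩
    have : x ≠ 0 := hx.2
    simp only [hh]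
    field_simp
  have hmeet : (E ∩ U).Nonempty := by
    have t1 : Tendsto h (𝓝[≠] 0) (Bornology.cobounded ℂ) := by
      rw [← tendsto_norm_atTop_iff_cobounded]
      have hc : Tendsto (fun z => ‖φ z‖) (𝓝[≠] 0) (𝓝 1) := by
        have := (hφ.continuousOn.continuousAt (ball_mem_nhds _ one_pos)).norm.tendsto
        rw [h0, norm_one] at this
        exact this.mono_left nhdsWithin_le_nhds
      have := hc.pos_mul_atTop one_pos (tendsto_norm_inv_nhdsNE_zero_atTop (α := ℂ))
      refine this.congr fun z => ?_
      simp [hh, div_eq_mul_inv]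
    have t2 : Tendsto (fun z => ‖T (h z) - q‖) (𝓝[≠] 0) atTop := by
      rw [tendsto_norm_atTop_iff_cobounded]
      have h3 : Tendsto T (Bornology.cobounded ℂ) (Bornology.cobounded ℂ) :=
        T.antilipschitz.tendsto_cobounded
      exact (tendsto_sub_const_cobounded q).comp (h3.comp t1)
    have e1 := t2.eventually_gt_atTop M
    have e2 : ∀ᶠ z : ℂ in 𝓝[≠] 0, z ∈ ball (0 : ℂ) ε \ {0} :=
      (eventually_nhdsWithin_of_eventually_nhds (ball_mem_nhds _ hε0)).and self_mem_nhdsWithin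
    obtain ⟨x, hx1, hx2⟩ := (e1.and e2).exists
    exact ⟨h x, hx1, x, hx2, rfl⟩
  have hEU : E ⊆ U :=
    hEpre.subset_left_of_subset_union hUopen hVclosed.isOpen_compl hdisj hcover hmeet
  by_contra hcon
  obtain ⟨x, hx, hxz⟩ := hEU (show h z ∈ E from not_le.mp hcon)
  have hz0 : z ≠ 0 := norm_pos_iff.mp (hε0.trans hz)
  have := hinj (hsub hx) ⟨by simpa using hz1, hz0⟩ hxz
  subst this
  have : ‖x‖ < ε := by simpa using hx.1
  linarith

lemma hasDerivAt_div_self {φ : ℂ → ℂ} (hφ : DifferentiableOn ℂ φ (ball 0 1)) {z : ℂ}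
    (hz : z ∈ ball (0 : ℂ) 1 \ {0}) :
    HasDerivAt (fun z => φ z / z) ((z * deriv φ z - φ z) / z ^ 2) z := by
  have h := (hφ.differentiableAt (isOpen_ball.mem_nhds hz.1)).hasDerivAt.div (hasDerivAt_id z) hz.2
  convert! h using 1
  simp [mul_comm]

lemma abs_det_restrictScalars_toSpanSingleton (a : ℂ) :
    |((ContinuousLinearMap.toSpanSingleton ℂ a).restrictScalars ℝ).det| = ‖a‖ ^ 2 := by
  simp [ContinuousLinearMap.det, LinearMap.det_restrictScalars, Algebra.norm_complex_apply,
    Complex.normSq_eq_norm_sq]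

open MeasureTheory in
/-- The area of an annulus under an injective holomorphic map, in polar coordinates. -/
lemma volume_image_annulus {h h' : ℂ → ℂ} {ε ρ : ℝ} (hε : 0 < ε)
    (hh : ∀ z : ℂ, ε < ‖z‖ → ‖z‖ < ρ → HasDerivAt h (h' z) z)
    (hc : ContinuousOn h' {z : ℂ | ε < ‖z‖ ∧ ‖z‖ < ρ})
    (hinj : InjOn h {z : ℂ | ε < ‖z‖ ∧ ‖z‖ < ρ}) :
    volume (h '' {z : ℂ | ε < ‖z‖ ∧ ‖z‖ < ρ}) =
      ∫⁻ r in Ioo ε ρ, ∫⁻ θ in Ioo (-Real.pi) Real.pi,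
        ENNReal.ofReal (r * ‖h' (circleMap 0 r θ)‖ ^ 2) := by
  set A : Set ℂ := {z : ℂ | ε < ‖z‖ ∧ ‖z‖ < ρ} with hA
  have hAo : IsOpen A := (isOpen_lt continuous_const continuous_norm).inter
    (isOpen_lt continuous_norm continuous_const)
  have h1 := lintegral_abs_det_fderiv_eq_addHaar_image volume hAo.measurableSet
    (fun z hz => ((hh z hz.1 hz.2).hasFDerivAt.restrictScalars ℝ).hasFDerivWithinAt) hinj
  rw [← h1]
  simp_rw [abs_det_restrictScalars_toSpanSingleton]
  rw [← lintegral_indicator hAo.measurableSet, ← Complex.lintegral_comp_polarCoord_symm]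
  have hmap : ∀ x : ℝ × ℝ, Complex.polarCoord.symm x = circleMap 0 x.1 x.2 := by
    intro x
    simp [circleMap, Complex.exp_mul_I]
  have hcm : Continuous fun x : ℝ × ℝ => circleMap 0 x.1 x.2 := by
    unfold circleMap
    fun_prop
  have hset : Ioo ε ρ ×ˢ Ioo (-Real.pi) Real.pi ⊆ polarCoord.target := by
    rw [polarCoord_target]
    exact prod_mono (fun r hr => hε.trans hr.1) subset_rfl
  have hms : MeasurableSet (Ioo ε ρ ×ˢ Ioo (-Real.pi) Real.pi) :=
    measurableSet_Ioo.prod measurableSet_Ioo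
  have h2 : ∀ x ∈ polarCoord.target, ENNReal.ofReal x.1 • A.indicator
      (fun z => ENNReal.ofReal (‖h' z‖ ^ 2)) (Complex.polarCoord.symm x) =
      (Ioo ε ρ ×ˢ Ioo (-Real.pi) Real.pi).indicator
        (fun x => ENNReal.ofReal (x.1 * ‖h' (circleMap 0 x.1 x.2)‖ ^ 2)) x := by
    intro x hx
    rw [polarCoord_target] at hx
    have hx1 : 0 < x.1 := hx.1
    rw [hmap]
    by_cases hxA : circleMap 0 x.1 x.2 ∈ A
    · have hxs : x ∈ Ioo ε ρ ×ˢ Ioo (-Real.pi) Real.pi :=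
        ⟨by simpa [hA, abs_of_pos hx1] using hxA, hx.2⟩
      rw [indicator_of_mem hxA, indicator_of_mem hxs, smul_eq_mul, ENNReal.ofReal_mul hx1.le]
    · have hxs : x ∉ Ioo ε ρ ×ˢ Ioo (-Real.pi) Real.pi := fun hxs =>
        hxA (by simpa [hA, abs_of_pos hx1] using hxs.1)
      rw [indicator_of_notMem hxA, indicator_of_notMem hxs, smul_zero]
  rw [setLIntegral_congr_fun polarCoord.open_target.measurableSet h2,
    setLIntegral_indicator hms, inter_eq_self_of_subset_left hset, Measure.volume_eq_prod,
    setLIntegral_prod]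
  have hco : ContinuousOn (fun x : ℝ × ℝ => x.1 * ‖h' (circleMap 0 x.1 x.2)‖ ^ 2)
      (Ioo ε ρ ×ˢ Ioo (-Real.pi) Real.pi) := by
    refine continuousOn_fst.mul ((ContinuousOn.norm ?_).pow 2)
    refine hc.comp hcm.continuousOn fun x hx => ?_
    have hx1 : 0 < x.1 := hε.trans hx.1.1
    simpa [hA, abs_of_pos hx1] using hx.1
  exact (hco.aemeasurable hms).ennreal_ofReal

open MeasureTheory in
lemma le_volume_image_annulus_s6 {φ : ℂ → ℂ} (hφ : DifferentiableOn ℂ φ (ball 0 1))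
    (h0 : φ 0 = 1) (hinj : InjOn (fun z => φ z / z) (ball 0 1 \ {0})) {ε ρ : ℝ} (hε : 0 < ε)
    (hερ : ε ≤ ρ) (hρ : ρ < 1) (N : ℕ) :
    ENNReal.ofReal (Real.pi * ((ε ^ 2)⁻¹ - (ρ ^ 2)⁻¹ +
      ∑ k ∈ Finset.range N, k * ‖taylorCoeff φ (k + 1)‖ ^ 2 * (ρ ^ (2 * k) - ε ^ (2 * k)))) ≤
    volume ((fun z => φ z / z) '' {z : ℂ | ε < ‖z‖ ∧ ‖z‖ < ρ}) := by
  set p : ℂ → ℂ := fun z => z * deriv φ z - φ z with hp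
  have hpd : DifferentiableOn ℂ p (ball 0 1) :=
    (differentiableOn_id.mul (hφ.deriv isOpen_ball)).sub hφ
  have hsub : {z : ℂ | ε < ‖z‖ ∧ ‖z‖ < ρ} ⊆ ball 0 1 \ {0} := fun z hz =>
    ⟨by simpa using hz.2.trans hρ, norm_pos_iff.mp (hε.trans hz.1)⟩
  rw [volume_image_annulus (h' := fun z => p z / z ^ 2) hε
    (fun z h1 h2 => hasDerivAt_div_self hφ (hsub ⟨h1, h2⟩))
    ((hpd.continuousOn.mono fun z hz => (hsub hz).1).div (continuousOn_id.pow 2)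
      fun z hz => pow_ne_zero 2 (hsub hz).2) (hinj.mono hsub)]
  set c : ℕ → ℝ := fun k => ‖taylorCoeff φ (k + 1)‖ ^ 2 with hcdef
  set S : ℝ → ℝ := fun r => 2 * Real.pi * ((r ^ 3)⁻¹ +
    ∑ k ∈ Finset.range N, k ^ 2 * c k * r ^ (2 * k - 1)) with hS
  have hSpos : ∀ r ∈ Ioo ε ρ, 0 ≤ S r := fun r hr => by
    have : 0 < r := hε.trans hr.1
    positivity
  have hin : ∀ r ∈ Ioo ε ρ, ENNReal.ofReal (S r) ≤ ∫⁻ θ in Ioo (-Real.pi) Real.pi,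
      ENNReal.ofReal (r * ‖p (circleMap 0 r θ) / (circleMap 0 r θ) ^ 2‖ ^ 2) := by
    intro r hr
    have hr0 : 0 < r := hε.trans hr.1
    have hr1 : r < 1 := hr.2.trans hρ
    have hcont : Continuous fun θ : ℝ => ‖p (circleMap 0 r θ)‖ ^ 2 :=
      (hpd.continuousOn.comp_continuous (continuous_circleMap 0 r)
        fun θ => by simpa [abs_of_pos hr0] using hr1).norm.pow 2
    have hB := sum_norm_taylorCoeff_sq_le hpd hr0 hr1 (N + 1)
    have hper : Function.Periodic (fun θ : ℝ => ‖p (circleMap 0 r θ)‖ ^ 2) (2 * Real.pi) :=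
      fun θ => by simp only [periodic_circleMap 0 r θ]
    have hshift := hper.intervalIntegral_add_eq 0 (-Real.pi)
    rw [zero_add, show -Real.pi + 2 * Real.pi = Real.pi by ring] at hshift
    rw [hshift, intervalIntegral.integral_of_le (by linarith [Real.pi_pos]),
      integral_Ioc_eq_integral_Ioo] at hB
    have hint : IntegrableOn (fun θ : ℝ => ‖p (circleMap 0 r θ)‖ ^ 2)
        (Ioo (-Real.pi) Real.pi) :=
      (hcont.integrableOn_Icc (a := -Real.pi) (b := Real.pi)).mono_set Ioo_subset_Icc_self
    have heq : ∀ θ : ℝ, r * ‖p (circleMap 0 r θ) / (circleMap 0 r θ) ^ 2‖ ^ 2 =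
        (r ^ 3)⁻¹ * ‖p (circleMap 0 r θ)‖ ^ 2 := by
      intro θ
      rw [norm_div, norm_pow, norm_circleMap_zero, abs_of_pos hr0]
      field_simp
    simp_rw [heq]
    rw [← ofReal_integral_eq_lintegral_ofReal (hint.const_mul _)
      (ae_of_all _ fun θ => by positivity), integral_const_mul]
    refine ENNReal.ofReal_le_ofReal (le_trans (le_of_eq ?_)
      (mul_le_mul_of_nonneg_left hB (by positivity)))
    rw [Finset.sum_range_succ']
    simp only [hp, taylorCoeff_mul_deriv_sub hφ, taylorCoeff_zero, h0, hS, hcdef]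
    have : ∑ k ∈ Finset.range N, ‖(((k + 1 : ℕ) : ℂ) - 1) * taylorCoeff φ (k + 1)‖ ^ 2 *
        r ^ (2 * (k + 1)) =
        r ^ 3 * ∑ k ∈ Finset.range N, k ^ 2 * ‖taylorCoeff φ (k + 1)‖ ^ 2 * r ^ (2 * k - 1) := by
      rw [Finset.mul_sum]
      refine Finset.sum_congr rfl fun k _ => ?_
      rcases Nat.eq_zero_or_pos k with rfl | hk
      · simp
      · have : 2 * (k + 1) = 3 + (2 * k - 1) := by omega
        rw [this, pow_add]
        push_cast
        rw [add_sub_cancel_right, norm_mul, Complex.norm_natCast]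
        ring
    rw [this]
    simp
    field_simp
    ring
  refine le_trans ?_ (setLIntegral_mono' measurableSet_Ioo hin)
  have hScont : ContinuousOn S (Icc ε ρ) := by
    refine ContinuousOn.mul continuousOn_const (ContinuousOn.add ?_ (by fun_prop))
    exact (continuousOn_pow 3).inv₀ fun r hr => pow_ne_zero 3 (hε.trans_le hr.1).ne'
  have hSint : IntegrableOn S (Ioo ε ρ) :=
    hScont.integrableOn_Icc.mono_set Ioo_subset_Icc_self
  rw [← ofReal_integral_eq_lintegral_ofReal hSint
    ((ae_restrict_iff' measurableSet_Ioo).mpr (ae_of_all _ hSpos)),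
    ← integral_Ioc_eq_integral_Ioo, ← intervalIntegral.integral_of_le hερ]
  refine ENNReal.ofReal_le_ofReal (le_of_eq ?_)
  rw [intervalIntegral.integral_eq_sub_of_hasDerivAt
    (f := fun r => Real.pi * (-(r ^ 2)⁻¹ + ∑ k ∈ Finset.range N, k * c k * r ^ (2 * k)))]
  · simp only [mul_sub, Finset.sum_sub_distrib, hcdef]
    ring
  · intro r hr
    rw [uIcc_of_le hερ] at hr
    have hr0 : r ≠ 0 := (hε.trans_le hr.1).ne'
    have h1 : HasDerivAt (fun r : ℝ => -(r ^ 2)⁻¹) (2 * (r ^ 3)⁻¹) r := by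
      have := ((hasDerivAt_pow 2 r).inv (pow_ne_zero 2 hr0)).neg
      convert! this using 1
      field_simp
      simp
    have h2 : HasDerivAt (fun r : ℝ => ∑ k ∈ Finset.range N, k * c k * r ^ (2 * k))
        (∑ k ∈ Finset.range N, k * c k * ((2 * k : ℕ) * r ^ (2 * k - 1))) r :=
      HasDerivAt.fun_sum fun k _ => (hasDerivAt_pow (2 * k) r).const_mul _
    convert! (h1.add h2).const_mul Real.pi using 1
    simp only [hS, mul_add, Finset.mul_sum]
    congr 1
    · ring
    · refine Finset.sum_congr rfl fun k _ => ?_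
      push_cast
      ring
  · exact ContinuousOn.intervalIntegrable (by rwa [uIcc_of_le hερ])

/-- The real-linear map `w ↦ w - β * conj w` is invertible for `‖β‖ < 1`. -/
lemma exists_equiv_sub_mul_conj {β : ℂ} (hβ : ‖β‖ < 1) :
    ∃ T : ℂ ≃L[ℝ] ℂ, (∀ w, T w = w - β * (starRingEnd ℂ) w) ∧
      LinearMap.det (T : ℂ →ₗ[ℝ] ℂ) = 1 - ‖β‖ ^ 2 := by
  let L : ℂ →ₗ[ℝ] ℂ := LinearMap.id -
    (LinearMap.mulLeft ℝ β).comp Complex.conjLIE.toLinearEquiv.toLinearMap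
  have hL : ∀ w, L w = w - β * (starRingEnd ℂ) w := fun w => by simp [L]
  have hdet : LinearMap.det L = 1 - ‖β‖ ^ 2 := by
    rw [← LinearMap.det_toMatrix Complex.basisOneI, Matrix.det_fin_two,
      ← Complex.normSq_eq_norm_sq, Complex.normSq_apply]
    simp [LinearMap.toMatrix_apply, hL]
    ring
  have hpos : 0 < 1 - ‖β‖ ^ 2 := by nlinarith [norm_nonneg β]
  have hunit : IsUnit (LinearMap.det L) := by
    rw [hdet]
    exact hpos.ne'.isUnit
  let T := (LinearMap.equivOfIsUnitDet hunit).toContinuousLinearEquiv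
  have hT : (T : ℂ →ₗ[ℝ] ℂ) = L := by
    ext w
    simp [T]
  exact ⟨T, fun w => by rw [← hL, ← hT]; rfl, by rw [hT, hdet]⟩

/-- The Taylor remainder of order three is cubic near the origin. -/
lemma exists_taylor_remainder_le {φ : ℂ → ℂ} (hφ : DifferentiableOn ℂ φ (ball 0 1)) :
    ∃ K : ℝ, 0 ≤ K ∧ ∀ z : ℂ, ‖z‖ ≤ 1 / 2 →
      ‖φ z - (φ 0 + taylorCoeff φ 1 * z + taylorCoeff φ 2 * z ^ 2)‖ ≤ K * ‖z‖ ^ 3 := by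
  have hs := summable_norm_taylorCoeff hφ (r := 1 / 2) (by norm_num) (by norm_num)
  have hs3 := (summable_nat_add_iff 3).mpr hs
  refine ⟨8 * ∑' k, ‖taylorCoeff φ (k + 3)‖ * (1 / 2) ^ (k + 3), by positivity, fun z hz => ?_⟩
  have h := hasSum_taylorCoeff hφ (z := z) (by simp; linarith)
  rw [← hasSum_nat_add_iff' 3] at h
  simp only [Finset.sum_range_succ, Finset.sum_range_zero, taylorCoeff_zero, pow_zero, mul_one,
    zero_add, pow_one] at h
  rw [mul_right_comm, ← h.tsum_eq]
  refine tsum_of_norm_bounded (hs3.hasSum.mul_left (8 * ‖z‖ ^ 3)) fun k => ?_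
  rw [norm_mul, norm_pow, pow_add, pow_add]
  have : ‖z‖ ^ k ≤ (1 / 2) ^ k := by gcongr
  calc _ = ‖taylorCoeff φ (k + 3)‖ * ‖z‖ ^ 3 * ‖z‖ ^ k := by ring
    _ ≤ ‖taylorCoeff φ (k + 3)‖ * ‖z‖ ^ 3 * (1 / 2) ^ k := by gcongr
    _ = _ := by ring

/-- Comparison of the image of an annulus with the ellipse approximately bounding it. -/
lemma sum_area_le_of_small {φ : ℂ → ℂ} (hφ : DifferentiableOn ℂ φ (ball 0 1)) (h0 : φ 0 = 1)
    (hinj : InjOn (fun z => φ z / z) (ball 0 1 \ {0})) {K ε ρ : ℝ}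
    (hK : ∀ z : ℂ, ‖z‖ ≤ 1 / 2 →
      ‖φ z - (φ 0 + taylorCoeff φ 1 * z + taylorCoeff φ 2 * z ^ 2)‖ ≤ K * ‖z‖ ^ 3)
    (hK0 : 0 ≤ K) (hε : 0 < ε) (hε2 : ε ≤ 1 / 2) (hερ : ε ≤ ρ) (hρ : ρ < 1)
    (hβ : ‖taylorCoeff φ 2‖ * ε ^ 2 < 1) (N : ℕ) :
    (1 - ‖taylorCoeff φ 2‖ ^ 2 * ε ^ 4) * (∑ k ∈ Finset.range N,
        k * ‖taylorCoeff φ (k + 1)‖ ^ 2 * (ρ ^ (2 * k) - ε ^ (2 * k)) - (ρ ^ 2)⁻¹) ≤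
      2 * (K + ‖taylorCoeff φ 2‖ ^ 2 + ‖taylorCoeff φ 2‖ * K) * ε +
        (K + ‖taylorCoeff φ 2‖ ^ 2 + ‖taylorCoeff φ 2‖ * K) ^ 2 * ε ^ 4 +
        ‖taylorCoeff φ 2‖ ^ 2 * ε ^ 2 := by
  set a := ‖taylorCoeff φ 2‖ with ha
  have ha0 : 0 ≤ a := norm_nonneg _
  set C := K + a ^ 2 + a * K with hC
  have hC0 : 0 ≤ C := by positivity
  have hnβ : ‖taylorCoeff φ 2 * (ε : ℂ) ^ 2‖ = a * ε ^ 2 := by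
    simp [ha]
  obtain ⟨T, hT, hdet⟩ := exists_equiv_sub_mul_conj (β := taylorCoeff φ 2 * ε ^ 2)
    (by rw [hnβ]; exact hβ)
  rw [hnβ] at hdet
  set q := T (taylorCoeff φ 1) with hq
  have hM : ∀ z : ℂ, ‖z‖ = ε → ‖T (φ z / z) - q‖ ≤ 1 / ε + C * ε ^ 2 := by
    intro z hz
    have hz0 : z ≠ 0 := by
      rintro rfl
      simp at hz
      linarith
    set E := φ z - (φ 0 + taylorCoeff φ 1 * z + taylorCoeff φ 2 * z ^ 2) with hE
    have hEn : ‖E‖ ≤ K * ε ^ 3 := by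
      rw [← hz]
      exact hK z (hz ▸ hε2)
    set R := E / z with hR
    have hRn : ‖R‖ ≤ K * ε ^ 2 := by
      rw [hR, norm_div, hz, div_le_iff₀ hε]
      linarith
    have h1 : φ z / z - taylorCoeff φ 1 = 1 / z + taylorCoeff φ 2 * z + R := by
      rw [hR, hE, h0]
      field_simp
      ring
    have hconj : (ε : ℂ) ^ 2 * (starRingEnd ℂ) (1 / z) = z := by
      have : (starRingEnd ℂ) z ≠ 0 := by simpa using hz0
      rw [← hz, ← Complex.mul_conj', map_div₀, map_one]
      field_simp
    have h2 : T (φ z / z) - q = 1 / z + R -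
        taylorCoeff φ 2 * ε ^ 2 * (starRingEnd ℂ) (taylorCoeff φ 2 * z + R) := by
      rw [hq, ← map_sub, h1, hT, map_add, map_add, map_add]
      linear_combination -taylorCoeff φ 2 * hconj
    rw [h2]
    have h3 : ‖taylorCoeff φ 2 * z + R‖ ≤ a * ε + K * ε ^ 2 := by
      refine (norm_add_le _ _).trans ?_
      rw [norm_mul, hz]
      gcongr
    calc _ ≤ ‖1 / z‖ + ‖R‖ + ‖taylorCoeff φ 2 * (ε : ℂ) ^ 2‖ * ‖taylorCoeff φ 2 * z + R‖ := by
          refine (norm_sub_le _ _).trans ?_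
          rw [norm_mul, RCLike.norm_conj]
          gcongr
          exact norm_add_le _ _
      _ ≤ 1 / ε + K * ε ^ 2 + a * ε ^ 2 * (a * ε + K * ε ^ 2) := by
          rw [hnβ, norm_div, hz, norm_one]
          gcongr
      _ ≤ 1 / ε + K * ε ^ 2 + a * ε ^ 2 * (a * 1 + K * 1 ^ 2) := by
          gcongr <;> linarith
      _ = _ := by rw [hC]; ring
  have hsub : (fun z => φ z / z) '' {z | ε < ‖z‖ ∧ ‖z‖ < ρ} ⊆
      (T : ℂ →ₗ[ℝ] ℂ) ⁻¹' closedBall q (1 / ε + C * ε ^ 2) := by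
    rintro _ ⟨z, hz, rfl⟩
    rw [mem_preimage, mem_closedBall, dist_eq_norm]
    exact norm_map_sub_le_of_sphere hφ h0 hinj T q hε (by linarith) hM hz.1 (hz.2.trans hρ)
  have hβ4 : 0 < 1 - (a * ε ^ 2) ^ 2 := by nlinarith [mul_nonneg ha0 (sq_nonneg ε)]
  have hvol := (le_volume_image_annulus_s6 hφ h0 hinj hε hερ hρ N).trans
    (MeasureTheory.measure_mono hsub)
  rw [MeasureTheory.Measure.addHaar_preimage_linearMap _ (by rw [hdet]; exact hβ4.ne'), hdet,
    Complex.volume_closedBall, abs_of_pos (inv_pos.mpr hβ4), ← ENNReal.ofReal_pow (by positivity),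
    ← ENNReal.ofReal_coe_nnreal, NNReal.coe_real_pi, ← ENNReal.ofReal_mul (by positivity),
    ← ENNReal.ofReal_mul (by positivity),
    ENNReal.ofReal_le_ofReal_iff (by positivity)] at hvol
  set S := ∑ k ∈ Finset.range N,
    (k : ℝ) * ‖taylorCoeff φ (k + 1)‖ ^ 2 * (ρ ^ (2 * k) - ε ^ (2 * k)) with hS
  have h4 : (1 - (a * ε ^ 2) ^ 2) * ((ε ^ 2)⁻¹ - (ρ ^ 2)⁻¹ + S) ≤ (1 / ε + C * ε ^ 2) ^ 2 := by
    rw [← le_inv_mul_iff₀ hβ4]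
    refine le_of_mul_le_mul_left (hvol.trans_eq ?_) Real.pi_pos
    ring
  have h5 : (1 - (a * ε ^ 2) ^ 2) * (ε ^ 2)⁻¹ = 1 / ε ^ 2 - a ^ 2 * ε ^ 2 := by
    field_simp
  have h6 : (1 / ε + C * ε ^ 2) ^ 2 = 1 / ε ^ 2 + 2 * C * ε + C ^ 2 * ε ^ 4 := by
    field_simp
    ring
  linear_combination h4 - h5 + h6

/-- **Gronwall's area theorem**. -/
theorem sum_mul_norm_taylorCoeff_sq_le_one {φ : ℂ → ℂ} (hφ : DifferentiableOn ℂ φ (ball 0 1))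
    (h0 : φ 0 = 1) (hinj : InjOn (fun z => φ z / z) (ball 0 1 \ {0})) (N : ℕ) :
    ∑ k ∈ Finset.range N, k * ‖taylorCoeff φ (k + 1)‖ ^ 2 ≤ 1 := by
  obtain ⟨K, hK0, hK⟩ := exists_taylor_remainder_le hφ
  set a := ‖taylorCoeff φ 2‖ with ha
  have hρ : ∀ ρ ∈ Ioo (0 : ℝ) 1, ∑ k ∈ Finset.range N,
      k * ‖taylorCoeff φ (k + 1)‖ ^ 2 * ρ ^ (2 * k) ≤ (ρ ^ 2)⁻¹ := by
    rintro ρ ⟨hρ0, hρ1⟩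
    have hl : Tendsto (fun ε : ℝ => (1 - a ^ 2 * ε ^ 4) * (∑ k ∈ Finset.range N,
        k * ‖taylorCoeff φ (k + 1)‖ ^ 2 * (ρ ^ (2 * k) - ε ^ (2 * k)) - (ρ ^ 2)⁻¹)) (𝓝[>] 0)
        (𝓝 (∑ k ∈ Finset.range N,
          k * ‖taylorCoeff φ (k + 1)‖ ^ 2 * ρ ^ (2 * k) - (ρ ^ 2)⁻¹)) := by
      refine (Continuous.tendsto' (by fun_prop) 0 _ ?_).mono_left nhdsWithin_le_nhds
      simp only [ne_eq, OfNat.ofNat_ne_zero, not_false_eq_true, zero_pow, mul_zero, sub_zero,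
        one_mul]
      congr 1
      refine Finset.sum_congr rfl fun k _ => ?_
      rcases Nat.eq_zero_or_pos k with rfl | hk
      · simp
      · rw [zero_pow (by omega), sub_zero]
    have hr : Tendsto (fun ε : ℝ => 2 * (K + a ^ 2 + a * K) * ε +
        (K + a ^ 2 + a * K) ^ 2 * ε ^ 4 + a ^ 2 * ε ^ 2) (𝓝[>] 0) (𝓝 0) :=
      (Continuous.tendsto' (by fun_prop) 0 _ (by simp)).mono_left nhdsWithin_le_nhds
    have hsmall : ∀ᶠ ε : ℝ in 𝓝[>] 0, a * ε ^ 2 < 1 := by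
      have : Tendsto (fun ε : ℝ => a * ε ^ 2) (𝓝[>] 0) (𝓝 0) :=
        (Continuous.tendsto' (by fun_prop) 0 _ (by simp)).mono_left nhdsWithin_le_nhds
      exact this.eventually_lt_const one_pos
    have hle := le_of_tendsto_of_tendsto hl hr ?_
    · linarith
    filter_upwards [hsmall, Ioc_mem_nhdsGT (show (0 : ℝ) < 1 / 2 by norm_num),
      Ioc_mem_nhdsGT hρ0] with ε h1 h2 h3
    exact sum_area_le_of_small hφ h0 hinj hK hK0 h2.1 h2.2 h3.2 hρ1 h1 N
  have hl : Tendsto (fun ρ : ℝ => ∑ k ∈ Finset.range N,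
      k * ‖taylorCoeff φ (k + 1)‖ ^ 2 * ρ ^ (2 * k)) (𝓝[<] 1)
      (𝓝 (∑ k ∈ Finset.range N, k * ‖taylorCoeff φ (k + 1)‖ ^ 2)) :=
    (Continuous.tendsto' (by fun_prop) 1 _ (by simp)).mono_left nhdsWithin_le_nhds
  have hr : Tendsto (fun ρ : ℝ => (ρ ^ 2)⁻¹) (𝓝[<] 1) (𝓝 1) := by
    have : ContinuousAt (fun ρ : ℝ => (ρ ^ 2)⁻¹) 1 := by fun_prop (disch := norm_num)
    have := this.tendsto
    simp only [one_pow, inv_one] at this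
    exact this.mono_left nhdsWithin_le_nhds
  refine le_of_tendsto_of_tendsto hl hr ?_
  filter_upwards [Ioo_mem_nhdsLT (show (0 : ℝ) < 1 by norm_num)] with ρ h
  exact hρ ρ h

/-- A normalized univalent function on the unit disc. -/
structure IsSchlicht (f : ℂ → ℂ) : Prop where
  differentiableOn : DifferentiableOn ℂ f (ball 0 1)
  injOn : InjOn f (ball 0 1)
  map_zero : f 0 = 0
  deriv_zero : deriv f 0 = 1

/-- A nonvanishing holomorphic function on the disc with value `1` at `0` has a logarithm. -/
lemma exists_exp_eq_of_ne_zero {F : ℂ → ℂ} (hF : DifferentiableOn ℂ F (ball 0 1))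
    (hne : ∀ z ∈ ball (0 : ℂ) 1, F z ≠ 0) (h0 : F 0 = 1) :
    ∃ L : ℂ → ℂ, DifferentiableOn ℂ L (ball 0 1) ∧ L 0 = 0 ∧
      ∀ z ∈ ball (0 : ℂ) 1, F z = Complex.exp (L z) := by
  obtain ⟨L, hL0, hL⟩ := ((hF.deriv isOpen_ball).div hF hne).isExactOn_ball.with_val_at 0 0
  refine ⟨L, fun z hz => (hL z hz).differentiableAt.differentiableWithinAt, hL0, fun z hz => ?_⟩
  have hd : ∀ z ∈ ball (0 : ℂ) 1, HasDerivAt (fun z => F z * Complex.exp (-L z)) 0 z := by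
    intro z hz
    have h1 := (hF.differentiableAt (isOpen_ball.mem_nhds hz)).hasDerivAt.mul (hL z hz).neg.cexp
    convert! h1 using 1
    have := hne z hz
    simp only [Pi.div_apply]
    field_simp
    ring
  have hc := isOpen_ball.is_const_of_deriv_eq_zero (convex_ball (0 : ℂ) 1).isPreconnected
    (fun z hz => (hd z hz).differentiableAt.differentiableWithinAt)
    (fun z hz => (hd z hz).deriv) hz (mem_ball_self one_pos)
  simp only [hL0, h0, neg_zero, Complex.exp_zero, mul_one, Complex.exp_neg] at hc
  have := Complex.exp_ne_zero (L z)
  field_simp at hc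
  exact hc

/-- Every schlicht function is `z * D z ^ 2` with `D` holomorphic and invertible on the disc. -/
lemma IsSchlicht.exists_sqrt {f : ℂ → ℂ} (hf : IsSchlicht f) :
    ∃ D ψ : ℂ → ℂ, DifferentiableOn ℂ D (ball 0 1) ∧ DifferentiableOn ℂ ψ (ball 0 1) ∧
      D 0 = 1 ∧ ψ 0 = 1 ∧ (∀ z ∈ ball (0 : ℂ) 1, ψ z * D z = 1) ∧
      ∀ z ∈ ball (0 : ℂ) 1, f z = z * D z ^ 2 := by
  have hb : ball (0 : ℂ) 1 ∈ 𝓝 0 := ball_mem_nhds _ one_pos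
  have hF : DifferentiableOn ℂ (dslope f 0) (ball 0 1) :=
    (Complex.differentiableOn_dslope hb).mpr hf.differentiableOn
  have hF0 : dslope f 0 0 = 1 := by rw [dslope_same, hf.deriv_zero]
  have hfF : ∀ z, f z = z * dslope f 0 z := fun z => by
    have := sub_smul_dslope f 0 z
    simpa [hf.map_zero] using this.symm
  have hne : ∀ z ∈ ball (0 : ℂ) 1, dslope f 0 z ≠ 0 := by
    intro z hz h
    have hz0 : z = 0 := hf.injOn hz (mem_ball_self one_pos)
      (by rw [hfF z, h, hf.map_zero, mul_zero])
    rw [hz0, hF0] at h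
    exact one_ne_zero h
  obtain ⟨L, hL, hL0, hLF⟩ := exists_exp_eq_of_ne_zero hF hne hF0
  refine ⟨fun z => Complex.exp (L z / 2), fun z => Complex.exp (-(L z / 2)),
    (hL.div_const 2).cexp, (hL.div_const 2).neg.cexp, by simp [hL0], by simp [hL0],
    fun z _ => by rw [← Complex.exp_add]; simp, fun z hz => ?_⟩
  rw [hfF, hLF z hz, ← Complex.exp_nat_mul]
  congr 2
  push_cast
  ring

section

variable {f D ψ : ℂ → ℂ}

/-- The area theorem for the reciprocal `1 / f = ψ ^ 2 / z`. -/
lemma IsSchlicht.sum_area_inv_le (hf : IsSchlicht f) (hψ : DifferentiableOn ℂ ψ (ball 0 1))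
    (hψ0 : ψ 0 = 1) (hψD : ∀ z ∈ ball (0 : ℂ) 1, ψ z * D z = 1)
    (hfD : ∀ z ∈ ball (0 : ℂ) 1, f z = z * D z ^ 2) (N : ℕ) :
    ∑ k ∈ Finset.range N, k * ‖taylorCoeff (fun z => ψ z * ψ z) (k + 1)‖ ^ 2 ≤ 1 := by
  have hinv : ∀ z ∈ ball (0 : ℂ) 1 \ {0}, ψ z * ψ z / z = (f z)⁻¹ := by
    rintro z ⟨hz, -⟩
    have hD : D z ≠ 0 := right_ne_zero_of_mul_eq_one (hψD z hz)
    rw [hfD z hz, eq_inv_of_mul_eq_one_left (hψD z hz)]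
    field_simp
  refine sum_mul_norm_taylorCoeff_sq_le_one (φ := fun z => ψ z * ψ z) (hψ.mul hψ)
    (by simp [hψ0]) (fun z hz w hw hzw => ?_) N
  simp only [hinv z hz, hinv w hw] at hzw
  exact hf.injOn hz.1 hw.1 (inv_injective hzw)

/-- The Taylor coefficients of `ψ (z ^ 2)`. -/
lemma taylorCoeff_comp_sq (hψ : DifferentiableOn ℂ ψ (ball 0 1)) (k : ℕ) :
    taylorCoeff (fun z => ψ (z ^ 2)) k = if Even k then taylorCoeff ψ (k / 2) else 0 := by
  refine taylorCoeff_eq_of_hasSum (c := fun k => if Even k then taylorCoeff ψ (k / 2) else 0)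
    (fun z hz => ?_) k
  have hz2 : z ^ 2 ∈ ball (0 : ℂ) 1 := by
    rw [mem_ball_zero_iff] at hz ⊢
    rw [norm_pow]
    exact pow_lt_one₀ (norm_nonneg _) hz two_ne_zero
  have hi : Function.Injective (fun j : ℕ => 2 * j) := fun i j h => by
    simpa using h
  rw [← hi.hasSum_iff]
  · convert! hasSum_taylorCoeff hψ hz2 using 2 with j
    simp [pow_mul]
  · intro k hk
    rw [if_neg, zero_mul]
    rintro ⟨j, rfl⟩
    exact hk ⟨j, by simp; ring⟩

/-- The area theorem for the odd square root transform `ψ (z ^ 2) / z = f (z ^ 2) ^ (-1/2)`. -/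
lemma IsSchlicht.sum_area_sqrt_le (hf : IsSchlicht f) (hψ : DifferentiableOn ℂ ψ (ball 0 1))
    (hψ0 : ψ 0 = 1) (hψD : ∀ z ∈ ball (0 : ℂ) 1, ψ z * D z = 1)
    (hfD : ∀ z ∈ ball (0 : ℂ) 1, f z = z * D z ^ 2) (N : ℕ) :
    ∑ j ∈ Finset.range N, (2 * j + 1) * ‖taylorCoeff ψ (j + 1)‖ ^ 2 ≤ 1 := by
  have hsq : ∀ z ∈ ball (0 : ℂ) 1, z ^ 2 ∈ ball (0 : ℂ) 1 := by
    intro z hz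
    rw [mem_ball_zero_iff] at hz ⊢
    rw [norm_pow]
    exact pow_lt_one₀ (norm_nonneg _) hz two_ne_zero
  have hφ : DifferentiableOn ℂ (fun z => ψ (z ^ 2)) (ball 0 1) :=
    hψ.comp (by fun_prop) hsq
  have hinj : InjOn (fun z => ψ (z ^ 2) / z) (ball 0 1 \ {0}) := by
    rintro z ⟨hz, hz0⟩ w ⟨hw, hw0⟩ hzw
    simp only [mem_singleton_iff] at hz0 hw0 hzw
    have hinv : ∀ z ∈ ball (0 : ℂ) 1, z ≠ 0 → (ψ (z ^ 2) / z) ^ 2 = (f (z ^ 2))⁻¹ := by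
      intro z hz _
      have hD : D (z ^ 2) ≠ 0 := right_ne_zero_of_mul_eq_one (hψD _ (hsq z hz))
      rw [hfD _ (hsq z hz), eq_inv_of_mul_eq_one_left (hψD _ (hsq z hz))]
      field_simp
    have h2 : z ^ 2 = w ^ 2 := by
      refine hf.injOn (hsq z hz) (hsq w hw) (inv_injective ?_)
      rw [← hinv z hz hz0, ← hinv w hw hw0, hzw]
    rcases sq_eq_sq_iff_eq_or_eq_neg.mp h2 with h | h
    · exact h
    · have hψne : ψ (w ^ 2) ≠ 0 := left_ne_zero_of_mul_eq_one (hψD _ (hsq w hw))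
      rw [h2, h, div_neg, neg_eq_iff_add_eq_zero, ← two_mul] at hzw
      simp [hψne, hw0] at hzw
  refine le_trans (le_of_eq ?_)
    (sum_mul_norm_taylorCoeff_sq_le_one hφ (by simp [hψ0]) hinj (2 * N))
  induction N with
  | zero => simp
  | succ N ih =>
    rw [Finset.sum_range_succ, ih, show 2 * (N + 1) = 2 * N + 1 + 1 by ring,
      Finset.sum_range_succ _ (2 * N + 1), Finset.sum_range_succ _ (2 * N)]
    simp only [taylorCoeff_comp_sq hψ]
    have h1 : ¬ Even (2 * N + 1) := by simp
    have h2 : Even (2 * N + 1 + 1) := ⟨N + 1, by ring⟩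
    rw [if_neg h1, if_pos h2, show (2 * N + 1 + 1) / 2 = N + 1 by omega]
    simp

/-- The coefficients of `f = z * D ^ 2`. -/
lemma taylorCoeff_succ_of_eq_mul_sq (hD : DifferentiableOn ℂ D (ball 0 1))
    (hfD : ∀ z ∈ ball (0 : ℂ) 1, f z = z * D z ^ 2) (k : ℕ) :
    taylorCoeff f (k + 1) =
      ∑ i ∈ Finset.range (k + 1), taylorCoeff D i * taylorCoeff D (k - i) := by
  rw [← taylorCoeff_mul hD hD]
  refine (taylorCoeff_eq_of_hasSum (f := f)
    (c := fun k => k.casesOn 0 (taylorCoeff fun z => D z * D z)) (fun z hz => ?_) (k + 1))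
  rw [← hasSum_nat_add_iff' 1]
  have h := (hasSum_taylorCoeff (f := fun z => D z * D z) (hD.mul hD) hz).mul_left z
  simp only [Finset.sum_range_one, hfD z hz]
  convert! h using 1
  · ext k
    ring
  · change z * D z ^ 2 - 0 * z ^ 0 = _
    ring

/-- The recursion for the coefficients of the inverse power series. -/
lemma taylorCoeff_succ_of_mul_eq_one (hψ : DifferentiableOn ℂ ψ (ball 0 1))
    (hD : DifferentiableOn ℂ D (ball 0 1)) (hψ0 : ψ 0 = 1)
    (hψD : ∀ z ∈ ball (0 : ℂ) 1, ψ z * D z = 1) (k : ℕ) :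
    taylorCoeff D (k + 1) =
      -∑ j ∈ Finset.range (k + 1), taylorCoeff ψ (j + 1) * taylorCoeff D (k - j) := by
  have h1 := taylorCoeff_mul hψ hD (k + 1)
  have h2 : taylorCoeff (fun z => ψ z * D z) (k + 1) = 0 := by
    rw [taylorCoeff_congr (g := fun _ => 1) hψD]
    simp [taylorCoeff, iteratedDeriv_const]
  rw [h2, Finset.sum_range_succ', taylorCoeff_zero, hψ0] at h1
  simp only [Nat.add_sub_add_right, one_mul, Nat.sub_zero] at h1
  linear_combination -h1

end

lemma sum_pow_div_odd_le_one (K : ℕ) :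
    ∑ j ∈ Finset.range K, (25 / 36 : ℝ) ^ (j + 1) / (2 * j + 1) ≤ 1 := by
  have h : ∀ m : ℕ, ∑ j ∈ Finset.range (m + 12), (25 / 36 : ℝ) ^ (j + 1) / (2 * j + 1) ≤
      1 - (25 / 36 : ℝ) ^ (m + 13) * (36 / 11) / (2 * m + 25) := by
    intro m
    induction m with
    | zero => norm_num [Finset.sum_range_succ]
    | succ m ih =>
      rw [show m + 1 + 12 = m + 12 + 1 by ring, Finset.sum_range_succ]
      have h1 : (25 / 36 : ℝ) ^ (m + 1 + 13) * (36 / 11) / (2 * ((m + 1 : ℕ) : ℝ) + 25) ≤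
          (25 / 36 : ℝ) ^ (m + 13) * (25 / 11) / (2 * m + 25) := by
        push_cast
        gcongr ?_ / ?_
        · rw [show m + 1 + 13 = m + 13 + 1 by ring, pow_succ]
          linarith
        · linarith
      have h2 : (25 / 36 : ℝ) ^ (m + 12 + 1) / (2 * ((m + 12 : ℕ) : ℝ) + 1) =
          (25 / 36 : ℝ) ^ (m + 13) * (36 / 11) / (2 * m + 25) -
          (25 / 36 : ℝ) ^ (m + 13) * (25 / 11) / (2 * m + 25) := by
        push_cast
        rw [← sub_div, ← mul_sub]
        norm_num
        ring_nf
      linarith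
  have hmono : ∑ j ∈ Finset.range K, (25 / 36 : ℝ) ^ (j + 1) / (2 * j + 1) ≤
      ∑ j ∈ Finset.range (K + 12), (25 / 36 : ℝ) ^ (j + 1) / (2 * j + 1) :=
    Finset.sum_le_sum_of_subset_of_nonneg (Finset.range_mono (Nat.le_add_right _ _))
      fun _ _ _ => by positivity
  have hpos : 0 ≤ (25 / 36 : ℝ) ^ (K + 13) * (36 / 11) / (2 * K + 25) := by positivity
  linarith [h K]

section

variable {f D ψ : ℂ → ℂ}

/-- Exponential growth bound for the coefficients of `D`. -/
lemma IsSchlicht.norm_taylorCoeff_sqrt_le (hf : IsSchlicht f)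
    (hD : DifferentiableOn ℂ D (ball 0 1)) (hψ : DifferentiableOn ℂ ψ (ball 0 1))
    (hD0 : D 0 = 1) (hψ0 : ψ 0 = 1) (hψD : ∀ z ∈ ball (0 : ℂ) 1, ψ z * D z = 1)
    (hfD : ∀ z ∈ ball (0 : ℂ) 1, f z = z * D z ^ 2) (k : ℕ) :
    ‖taylorCoeff D k‖ ≤ (6 / 5) ^ k := by
  induction k using Nat.strong_induction_on with
  | _ k ih =>
  rcases k with _ | k
  · simp [taylorCoeff_zero, hD0]
  refine (sq_le_sq₀ (norm_nonneg _) (by positivity)).mp ?_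
  have h1 : ‖taylorCoeff D (k + 1)‖ ≤
      ∑ j ∈ Finset.range (k + 1), ‖taylorCoeff ψ (j + 1)‖ * ‖taylorCoeff D (k - j)‖ := by
    rw [taylorCoeff_succ_of_mul_eq_one hψ hD hψ0 hψD, norm_neg]
    exact (norm_sum_le _ _).trans (Finset.sum_le_sum fun j _ => (norm_mul _ _).le)
  have h2 : ∑ j ∈ Finset.range (k + 1), ‖taylorCoeff D (k - j)‖ ^ 2 / (2 * j + 1) ≤
      ((6 / 5) ^ (k + 1)) ^ 2 := by
    calc _ ≤ ∑ j ∈ Finset.range (k + 1),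
          ((6 / 5) ^ (k + 1)) ^ 2 * ((25 / 36 : ℝ) ^ (j + 1) / (2 * j + 1)) := by
          refine Finset.sum_le_sum fun j hj => ?_
          have hjk : j ≤ k := Nat.lt_succ_iff.mp (Finset.mem_range.mp hj)
          have h3 : ((6 / 5 : ℝ) ^ (k + 1)) ^ 2 * (25 / 36 : ℝ) ^ (j + 1) =
              ((6 / 5) ^ (k - j)) ^ 2 := by
            rw [show k + 1 = (k - j) + (j + 1) by omega, pow_add, mul_pow, mul_assoc,
              ← pow_mul (6 / 5 : ℝ) (j + 1), mul_comm (j + 1), pow_mul, ← mul_pow]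
            norm_num
          rw [← mul_div_assoc, h3]
          gcongr
          exact ih (k - j) (by omega)
      _ ≤ ((6 / 5) ^ (k + 1)) ^ 2 * 1 := by
          rw [← Finset.mul_sum]
          gcongr
          exact sum_pow_div_odd_le_one _
      _ = _ := mul_one _
  calc ‖taylorCoeff D (k + 1)‖ ^ 2
      ≤ (∑ j ∈ Finset.range (k + 1), ‖taylorCoeff ψ (j + 1)‖ * ‖taylorCoeff D (k - j)‖) ^ 2 := by
        gcongr
    _ ≤ (∑ j ∈ Finset.range (k + 1), (2 * j + 1) * ‖taylorCoeff ψ (j + 1)‖ ^ 2) *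
        ∑ j ∈ Finset.range (k + 1), ‖taylorCoeff D (k - j)‖ ^ 2 / (2 * j + 1) := by
        refine Finset.sum_sq_le_sum_mul_sum_of_sq_le_mul _ (fun j _ => by positivity)
          (fun j _ => by positivity) fun j _ => le_of_eq ?_
        have : (2 * j + 1 : ℝ) ≠ 0 := by positivity
        field_simp
    _ ≤ 1 * ((6 / 5) ^ (k + 1)) ^ 2 := by
        gcongr
        exact hf.sum_area_sqrt_le hψ hψ0 hψD hfD _
    _ = _ := one_mul _

lemma IsSchlicht.norm_taylorCoeff_succ_le (hf : IsSchlicht f) (k : ℕ) :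
    ‖taylorCoeff f (k + 1)‖ ≤ (k + 1) * (6 / 5) ^ k := by
  obtain ⟨D, ψ, hD, hψ, hD0, hψ0, hψD, hfD⟩ := hf.exists_sqrt
  have hDk := hf.norm_taylorCoeff_sqrt_le hD hψ hD0 hψ0 hψD hfD
  rw [taylorCoeff_succ_of_eq_mul_sq hD hfD]
  calc _ ≤ ∑ i ∈ Finset.range (k + 1), (6 / 5 : ℝ) ^ k := by
        refine norm_sum_le_of_le _ fun i hi => ?_
        have hik : i ≤ k := Nat.lt_succ_iff.mp (Finset.mem_range.mp hi)
        rw [norm_mul, ← Nat.add_sub_of_le hik, pow_add, Nat.add_sub_cancel_left]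
        gcongr <;> apply hDk
    _ = _ := by simp

/-- **Bieberbach's inequality** for the second coefficient. -/
lemma IsSchlicht.norm_taylorCoeff_two_le (hf : IsSchlicht f) : ‖taylorCoeff f 2‖ ≤ 2 := by
  obtain ⟨D, ψ, hD, hψ, hD0, hψ0, hψD, hfD⟩ := hf.exists_sqrt
  have h1 := hf.sum_area_sqrt_le hψ hψ0 hψD hfD 1
  have h2 := taylorCoeff_succ_of_mul_eq_one hψ hD hψ0 hψD 0
  have h3 := taylorCoeff_succ_of_eq_mul_sq hD hfD 1
  simp [Finset.sum_range_succ, taylorCoeff_zero, hD0] at h1 h2 h3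
  rw [h3, h2, ← neg_add, norm_neg, ← two_mul, norm_mul]
  simpa using h1

/-- The Fekete–Szegő type bound coming from the area theorem. -/
lemma IsSchlicht.norm_taylorCoeff_two_sq_sub_le (hf : IsSchlicht f) :
    ‖taylorCoeff f 2 ^ 2 - taylorCoeff f 3‖ ≤ 1 := by
  obtain ⟨D, ψ, hD, hψ, hD0, hψ0, hψD, hfD⟩ := hf.exists_sqrt
  have h1 := hf.sum_area_inv_le hψ hψ0 hψD hfD 2
  have hφ := taylorCoeff_mul hψ hψ 2
  have hD1 := taylorCoeff_succ_of_mul_eq_one hψ hD hψ0 hψD 0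
  have hD2 := taylorCoeff_succ_of_mul_eq_one hψ hD hψ0 hψD 1
  have ha2 := taylorCoeff_succ_of_eq_mul_sq hD hfD 1
  have ha3 := taylorCoeff_succ_of_eq_mul_sq hD hfD 2
  simp [Finset.sum_range_succ, taylorCoeff_zero, hD0, hψ0] at h1 hφ hD1 hD2 ha2 ha3
  refine le_of_eq_of_le (congrArg norm ?_) h1
  rw [hφ, ha2, ha3, hD2, hD1]
  ring

end

lemma norm_pow_sub_pow_le {z w : ℂ} {r : ℝ} (hz : ‖z‖ ≤ r) (hw : ‖w‖ ≤ r) (k : ℕ) :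
    ‖z ^ (k + 1) - w ^ (k + 1)‖ ≤ (k + 1) * r ^ k * ‖z - w‖ := by
  have hr : 0 ≤ r := (norm_nonneg z).trans hz
  induction k with
  | zero => simp
  | succ k ih =>
    calc ‖z ^ (k + 1 + 1) - w ^ (k + 1 + 1)‖
        = ‖z * (z ^ (k + 1) - w ^ (k + 1)) + w ^ (k + 1) * (z - w)‖ := by
          congr 1
          ring
      _ ≤ r * ((k + 1) * r ^ k * ‖z - w‖) + r ^ (k + 1) * ‖z - w‖ := by
          refine (norm_add_le _ _).trans ?_
          rw [norm_mul, norm_mul, norm_pow]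
          gcongr
      _ = _ := by
          push_cast
          ring

lemma sum_pow_div_odd_le (N : ℕ) :
    ∑ j ∈ Finset.range N, (1 / 16 : ℝ) ^ (j + 1) / (2 * j + 1) ≤ 0.065 := by
  rcases N with _ | N
  · norm_num
  have h : ∑ j ∈ Finset.range (N + 1), (1 / 16 : ℝ) ^ (j + 1) / (2 * j + 1) ≤
      0.065 - (1 / 16) ^ (N + 1) * (1 / 32) := by
    induction N with
    | zero => norm_num
    | succ N ih =>
      rw [Finset.sum_range_succ]
      have : (1 / 16 : ℝ) ^ (N + 1 + 1) / (2 * ((N + 1 : ℕ) : ℝ) + 1) ≤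
          (1 / 16 : ℝ) ^ (N + 1 + 1) / 3 := by
        push_cast
        gcongr
        linarith [Nat.cast_nonneg (α := ℝ) N]
      have hp : 0 ≤ (1 / 16 : ℝ) ^ (N + 1) := by positivity
      rw [pow_succ _ (N + 1)] at this ⊢
      linarith
  have hp : 0 ≤ (1 / 16 : ℝ) ^ (N + 1) := by positivity
  linarith

lemma sum_mul_pow_le (N : ℕ) :
    ∑ m ∈ Finset.range N, m * (1 / 16 : ℝ) ^ (m + 1) ≤ 1 / 225 := by
  have h : ∑ m ∈ Finset.range N, m * (1 / 16 : ℝ) ^ (m + 1) =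
      1 / 225 - (1 / 16) ^ N * (N / 15 + 1 / 225) := by
    induction N with
    | zero => norm_num
    | succ N ih =>
      rw [Finset.sum_range_succ, ih]
      push_cast
      ring
  rw [h, sub_le_self_iff]
  positivity

lemma sum_sq_mul_pow_le (m N : ℕ) :
    ∑ i ∈ Finset.range N, ((i + m + 5 : ℝ) ^ 2 * (3 / 10) ^ (i + m + 4)) ≤ 0.35 := by
  have h : ∀ N : ℕ, ∑ i ∈ Finset.range N, ((i + 5 : ℝ) ^ 2 * (3 / 10) ^ (i + 4)) =
      59697 / 171500 - (3 / 10) ^ N *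
        (81 / 7000 * (N : ℝ) ^ 2 + 1539 / 12250 * (N : ℝ) + 59697 / 171500) := by
    intro N
    induction N with
    | zero => norm_num
    | succ N ih =>
      rw [Finset.sum_range_succ, ih]
      push_cast
      ring
  have h2 := h (m + N)
  rw [Finset.sum_range_add] at h2
  have h3 : 0 ≤ ∑ i ∈ Finset.range m, ((i + 5 : ℝ) ^ 2 * (3 / 10) ^ (i + 4)) := by positivity
  have h4 : 0 ≤ (3 / 10 : ℝ) ^ (m + N) *
    (81 / 7000 * ((m + N : ℕ) : ℝ) ^ 2 + 1539 / 12250 * ((m + N : ℕ) : ℝ) +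
      59697 / 171500) := by positivity
  have h5 : ∑ i ∈ Finset.range N, ((i + m + 5 : ℝ) ^ 2 * (3 / 10) ^ (i + m + 4)) =
      ∑ i ∈ Finset.range N, ((((m + i : ℕ) : ℝ) + 5) ^ 2 * (3 / 10) ^ (m + i + 4)) := by
    refine Finset.sum_congr rfl fun i _ => ?_
    push_cast
    ring
  rw [h5]
  linarith

section

variable {f D ψ : ℂ → ℂ}

lemma IsSchlicht.norm_inv_sqrt_le (hf : IsSchlicht f) (hψ : DifferentiableOn ℂ ψ (ball 0 1))
    (hψ0 : ψ 0 = 1) (hψD : ∀ z ∈ ball (0 : ℂ) 1, ψ z * D z = 1)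
    (hfD : ∀ z ∈ ball (0 : ℂ) 1, f z = z * D z ^ 2) {z : ℂ} (hz : ‖z‖ ≤ 1 / 4) :
    ‖ψ z‖ ≤ 1.255 := by
  have hs := (hasSum_taylorCoeff hψ (z := z) (by simp; linarith)).tendsto_sum_nat
  refine le_of_tendsto ((tendsto_add_atTop_iff_nat 1).mpr hs).norm (.of_forall fun N => ?_)
  rw [Finset.sum_range_succ', taylorCoeff_zero, hψ0]
  have h1 : ∑ j ∈ Finset.range N, ‖taylorCoeff ψ (j + 1)‖ * (1 / 4) ^ (j + 1) ≤ 0.255 := by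
    refine le_of_sq_le_sq ?_ (by norm_num)
    calc _ ≤ (∑ j ∈ Finset.range N, (2 * j + 1) * ‖taylorCoeff ψ (j + 1)‖ ^ 2) *
        ∑ j ∈ Finset.range N, (1 / 16 : ℝ) ^ (j + 1) / (2 * j + 1) := by
          refine Finset.sum_sq_le_sum_mul_sum_of_sq_le_mul _ (fun j _ => by positivity)
            (fun j _ => by positivity) fun j _ => le_of_eq ?_
          have : (2 * j + 1 : ℝ) ≠ 0 := by positivity
          rw [mul_pow, pow_right_comm, show (1 / 4 : ℝ) ^ 2 = 1 / 16 by norm_num]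
          field_simp
      _ ≤ 1 * 0.065 := by
          gcongr
          · exact hf.sum_area_sqrt_le hψ hψ0 hψD hfD N
          · exact sum_pow_div_odd_le N
      _ ≤ _ := by norm_num
  have h2 : ‖∑ j ∈ Finset.range N, taylorCoeff ψ (j + 1) * z ^ (j + 1)‖ ≤
      ∑ j ∈ Finset.range N, ‖taylorCoeff ψ (j + 1)‖ * (1 / 4) ^ (j + 1) :=
    norm_sum_le_of_le _ fun j _ => by
      rw [norm_mul, norm_pow]
      gcongr
  refine (norm_add_le _ _).trans ?_
  rw [pow_zero, one_mul, norm_one]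
  linarith

lemma IsSchlicht.norm_cross_sub_le (hf : IsSchlicht f) (hψ : DifferentiableOn ℂ ψ (ball 0 1))
    (hψ0 : ψ 0 = 1) (hψD : ∀ z ∈ ball (0 : ℂ) 1, ψ z * D z = 1)
    (hfD : ∀ z ∈ ball (0 : ℂ) 1, f z = z * D z ^ 2) {z w : ℂ} (hz : ‖z‖ ≤ 1 / 4)
    (hw : ‖w‖ ≤ 1 / 4) :
    ‖z * (ψ w * ψ w) - w * (ψ z * ψ z) - (z - w)‖ ≤ 1 / 15 * ‖z - w‖ := by
  set c := taylorCoeff fun z => ψ z * ψ z with hc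
  have hs : ∀ z : ℂ, ‖z‖ ≤ 1 / 4 → HasSum (fun k => c k * z ^ k) (ψ z * ψ z) := fun z hz =>
    hasSum_taylorCoeff (f := fun z => ψ z * ψ z) (hψ.mul hψ) (by simp; linarith)
  have h := ((hs w hw).mul_left z).sub ((hs z hz).mul_left w)
  rw [← hasSum_nat_add_iff' 1] at h
  have hc0 : c 0 = 1 := by simp [hc, taylorCoeff_zero, hψ0]
  simp only [Finset.sum_range_one, hc0, pow_zero, mul_one] at h
  refine le_of_tendsto h.tendsto_sum_nat.norm (.of_forall fun N => ?_)
  have h1 : ∑ m ∈ Finset.range N, m * ‖c (m + 1)‖ * (1 / 4) ^ (m + 1) ≤ 1 / 15 := by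
    refine le_of_sq_le_sq ?_ (by norm_num)
    calc _ ≤ (∑ m ∈ Finset.range N, m * ‖c (m + 1)‖ ^ 2) *
        ∑ m ∈ Finset.range N, m * (1 / 16 : ℝ) ^ (m + 1) := by
          refine Finset.sum_sq_le_sum_mul_sum_of_sq_le_mul _ (fun j _ => by positivity)
            (fun j _ => by positivity) fun j _ => le_of_eq ?_
          rw [mul_pow, pow_right_comm, show (1 / 4 : ℝ) ^ 2 = 1 / 16 by norm_num]
          ring
      _ ≤ 1 * (1 / 225) := by
          gcongr
          · exact hf.sum_area_inv_le hψ hψ0 hψD hfD N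
          · exact sum_mul_pow_le N
      _ ≤ _ := by norm_num
  calc _ ≤ ∑ m ∈ Finset.range N, m * ‖c (m + 1)‖ * (1 / 4) ^ (m + 1) * ‖z - w‖ := by
        refine norm_sum_le_of_le _ fun m _ => ?_
        rw [show z * (c (m + 1) * w ^ (m + 1)) - w * (c (m + 1) * z ^ (m + 1)) =
          c (m + 1) * (z * w * (w ^ m - z ^ m)) by ring]
        rcases m with _ | m
        · simp
        rw [norm_mul, norm_mul, norm_mul, norm_sub_rev]
        calc _ ≤ ‖c (m + 1 + 1)‖ * (1 / 4 * (1 / 4) * ((m + 1) * (1 / 4) ^ m * ‖z - w‖)) := by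
              gcongr
              exact norm_pow_sub_pow_le hz hw m
          _ = _ := by
              push_cast
              ring
    _ ≤ _ := by
        rw [← Finset.sum_mul]
        gcongr

/-- Quantitative injectivity of schlicht functions on the disc of radius `1 / 4`. -/
lemma IsSchlicht.le_norm_sub (hf : IsSchlicht f) {z w : ℂ} (hz : ‖z‖ ≤ 1 / 4)
    (hw : ‖w‖ ≤ 1 / 4) : 0.375 * ‖z - w‖ ≤ ‖f z - f w‖ := by
  obtain ⟨D, ψ, hD, hψ, hD0, hψ0, hψD, hfD⟩ := hf.exists_sqrt
  have hb : ∀ z : ℂ, ‖z‖ ≤ 1 / 4 → z ∈ ball (0 : ℂ) 1 := fun z hz => by simp; linarith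
  have h1 := hf.norm_cross_sub_le hψ hψ0 hψD hfD hz hw
  have h2 : z * (ψ w * ψ w) - w * (ψ z * ψ z) = (f z - f w) * (ψ z ^ 2 * ψ w ^ 2) := by
    rw [hfD z (hb z hz), hfD w (hb w hw)]
    linear_combination -(z * ψ w ^ 2 * (ψ z * D z + 1)) * hψD z (hb z hz) +
      w * ψ z ^ 2 * (ψ w * D w + 1) * hψD w (hb w hw)
  have h3 : ‖ψ z ^ 2 * ψ w ^ 2‖ ≤ 1.255 ^ 2 * 1.255 ^ 2 := by
    rw [norm_mul, norm_pow, norm_pow]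
    gcongr
    · exact hf.norm_inv_sqrt_le hψ hψ0 hψD hfD hz
    · exact hf.norm_inv_sqrt_le hψ hψ0 hψD hfD hw
  have h4 : ‖z - w‖ - 1 / 15 * ‖z - w‖ ≤ ‖f z - f w‖ * (1.255 ^ 2 * 1.255 ^ 2) := by
    calc _ ≤ ‖z * (ψ w * ψ w) - w * (ψ z * ψ z)‖ := by
          have := norm_sub_norm_le (z - w) (z * (ψ w * ψ w) - w * (ψ z * ψ z))
          rw [norm_sub_rev] at h1
          linarith
      _ ≤ _ := by
          rw [h2, norm_mul]
          gcongr
  norm_num at h4 ⊢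
  linarith [norm_nonneg (f z - f w), norm_nonneg (z - w)]

lemma IsSchlicht.norm_sub_le_of_section_eq (hf : IsSchlicht f) {z w : ℂ} (hz : ‖z‖ ≤ 1 / 4)
    (hw : ‖w‖ ≤ 1 / 4) {n : ℕ} (hn : 4 ≤ n)
    (h : ∑ k ∈ Finset.range (n + 1), taylorCoeff f k * z ^ k =
      ∑ k ∈ Finset.range (n + 1), taylorCoeff f k * w ^ k) :
    ‖f z - f w‖ ≤ 0.35 * ‖z - w‖ := by
  obtain ⟨m, rfl⟩ := Nat.exists_eq_add_of_le' hn
  have hs := (hasSum_taylorCoeff hf.differentiableOn (z := z) (by simp; linarith)).sub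
    (hasSum_taylorCoeff hf.differentiableOn (z := w) (by simp; linarith))
  rw [← hasSum_nat_add_iff' (m + 4 + 1), Finset.sum_sub_distrib, h, sub_self, sub_zero] at hs
  refine le_of_tendsto hs.tendsto_sum_nat.norm (.of_forall fun N => ?_)
  calc _ ≤ ∑ i ∈ Finset.range N, (i + m + 5 : ℝ) ^ 2 * (3 / 10) ^ (i + m + 4) * ‖z - w‖ := by
        refine norm_sum_le_of_le _ fun i _ => ?_
        rw [← mul_sub, norm_mul, show i + (m + 4 + 1) = i + m + 4 + 1 by ring]
        calc _ ≤ (((i + m + 4 : ℕ) : ℝ) + 1) * (6 / 5) ^ (i + m + 4) *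
            ((((i + m + 4 : ℕ) : ℝ) + 1) * (1 / 4) ^ (i + m + 4) * ‖z - w‖) := by
              gcongr
              · exact hf.norm_taylorCoeff_succ_le _
              · exact norm_pow_sub_pow_le hz hw _
          _ = _ := by
              rw [show (3 / 10 : ℝ) = 6 / 5 * (1 / 4) by norm_num, mul_pow]
              push_cast
              ring
    _ ≤ _ := by
        rw [← Finset.sum_mul]
        gcongr
        exact sum_sq_mul_pow_le m N

end

lemma le_norm_quadratic_sq (s : ℂ) :
    6 * (‖s‖ ^ 2) ^ 2 - 16 * ‖s‖ ^ 2 + 32 / 3 ≤ ‖4 + 4 * s + 3 * s ^ 2‖ ^ 2 := by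
  have h : ‖4 + 4 * s + 3 * s ^ 2‖ ^ 2 - (6 * (‖s‖ ^ 2) ^ 2 - 16 * ‖s‖ ^ 2 + 32 / 3) =
      48 * (s.re + (3 * ‖s‖ ^ 2 + 4) / 12) ^ 2 := by
    rw [← Complex.normSq_eq_norm_sq, ← Complex.normSq_eq_norm_sq, Complex.normSq_apply,
      Complex.normSq_apply]
    simp [sq]
    ring
  linarith [sq_nonneg (s.re + (3 * ‖s‖ ^ 2 + 4) / 12)]

/-- The divided difference of the third section does not vanish. -/
lemma cubic_divided_difference_ne_zero {a b z w : ℂ} (ha : ‖a‖ ≤ 2) (hab : ‖a ^ 2 - b‖ ≤ 1)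
    (hz : ‖z‖ ≤ 1 / 4) (hw : ‖w‖ ≤ 1 / 4) :
    1 + a * (z + w) + b * (z ^ 2 + z * w + w ^ 2) ≠ 0 := by
  intro h
  have hpar := parallelogram_law_with_norm ℝ z w
  have hS : ‖2 * (z + w)‖ = 2 * ‖z + w‖ := by simp
  have hd : ‖2 * (z - w)‖ = 2 * ‖z - w‖ := by simp
  set S := 2 * (z + w) with hSdef
  set d := 2 * (z - w) with hddef
  have hSd : ‖S‖ ^ 2 + ‖d‖ ^ 2 ≤ 1 := by
    rw [hS, hd]
    nlinarith [norm_nonneg z, norm_nonneg w]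
  have ha2 : ‖a / 2‖ ≤ 1 := by
    rw [norm_div]
    norm_num
    linarith
  have heq : 4 + 4 * (a / 2 * S) + 3 * (a / 2 * S) ^ 2 =
      (a ^ 2 - b) * (3 * S ^ 2 + d ^ 2) / 4 - (a / 2) ^ 2 * d ^ 2 := by
    rw [hSdef, hddef]
    linear_combination 4 * h
  have hle : ‖4 + 4 * (a / 2 * S) + 3 * (a / 2 * S) ^ 2‖ ≤ 5 / 4 - ‖S‖ ^ 2 / 2 := by
    rw [heq]
    calc _ ≤ ‖a ^ 2 - b‖ * (3 * ‖S‖ ^ 2 + ‖d‖ ^ 2) / 4 + ‖a / 2‖ ^ 2 * ‖d‖ ^ 2 := by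
          refine (norm_sub_le _ _).trans ?_
          rw [norm_div, norm_mul, norm_mul, norm_pow, norm_pow, Complex.norm_ofNat]
          gcongr
          refine (norm_add_le _ _).trans ?_
          simp
      _ ≤ 1 * (3 * ‖S‖ ^ 2 + ‖d‖ ^ 2) / 4 + 1 ^ 2 * ‖d‖ ^ 2 := by gcongr
      _ ≤ _ := by linarith
  have hσ : ‖a / 2 * S‖ ^ 2 ≤ ‖S‖ ^ 2 := by
    rw [norm_mul]
    gcongr
    exact mul_le_of_le_one_left (norm_nonneg _) ha2
  have hq := le_norm_quadratic_sq (a / 2 * S)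
  have hsq := pow_le_pow_left₀ (norm_nonneg _) hle 2
  have hτ : ‖S‖ ^ 2 ≤ 1 := by linarith [sq_nonneg ‖d‖]
  generalize ‖a / 2 * S‖ ^ 2 = σ at *
  have hτ0 := sq_nonneg ‖S‖
  generalize ‖S‖ ^ 2 = τ at *
  have hmono : 6 * τ ^ 2 - 16 * τ ≤ 6 * σ ^ 2 - 16 * σ := by nlinarith
  nlinarith

theorem IsSchlicht.injOn_section {f : ℂ → ℂ} (hf : IsSchlicht f) {n : ℕ} (hn : 1 ≤ n) :
    InjOn (fun z : ℂ => ∑ k ∈ Finset.Icc 1 n, taylorCoeff f k * z ^ k) (ball 0 (1 / 4)) := by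
  intro z hz w hw hzw
  simp only at hzw
  rw [mem_ball_zero_iff] at hz hw
  have ha1 : taylorCoeff f 1 = 1 := by rw [taylorCoeff_one, hf.deriv_zero]
  have ha2 := hf.norm_taylorCoeff_two_le
  by_contra hne
  have hsub : z - w ≠ 0 := sub_ne_zero.mpr hne
  rcases lt_or_ge n 4 with h4 | h4
  · interval_cases n
    · simp [ha1] at hzw
      exact hne hzw
    · simp [Finset.sum_Icc_succ_top, ha1] at hzw
      have h : 1 + taylorCoeff f 2 * (z + w) = 0 := by
        refine (mul_eq_zero.mp ?_).resolve_left hsub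
        linear_combination hzw
      have h1 : ‖taylorCoeff f 2 * (z + w)‖ = 1 := by
        rw [eq_neg_of_add_eq_zero_right h, norm_neg, norm_one]
      rw [norm_mul] at h1
      nlinarith [norm_add_le z w, norm_nonneg (z + w)]
    · simp [Finset.sum_Icc_succ_top, ha1] at hzw
      refine cubic_divided_difference_ne_zero ha2 hf.norm_taylorCoeff_two_sq_sub_le hz.le hw.le
        ((mul_eq_zero.mp ?_).resolve_left hsub)
      linear_combination hzw
  · have hrange : ∀ u : ℂ, ∑ k ∈ Finset.range (n + 1), taylorCoeff f k * u ^ k =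
        ∑ k ∈ Finset.Icc 1 n, taylorCoeff f k * u ^ k := by
      intro u
      rw [Finset.range_eq_Ico, Finset.sum_eq_sum_Ico_succ_bot (Nat.succ_pos n), taylorCoeff_zero,
        hf.map_zero, zero_mul, zero_add]
      rfl
    have h1 := hf.le_norm_sub hz.le hw.le
    have h2 := hf.norm_sub_le_of_section_eq hz.le hw.le h4 (by rw [hrange, hrange, hzw])
    have h3 := norm_pos_iff.mpr hsub
    norm_num at h1 h2
    linarith

end

/-- Szegő's theorem on sections of schlicht functions: if `f` is holomorphic
and injective on the open unit disc with `f 0 = 0` and `f' 0 = 1`, then for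
every `n ≥ 1` the partial sum `fₙ(z) = Σ_{k=1}^{n} bₖ zᵏ` of its Taylor
series (with `bₖ = f⁽ᵏ⁾(0)/k!`) is injective on the open disc of radius 1/4. -/
theorem szego_sections (f : ℂ → ℂ)
    (hdiff : DifferentiableOn ℂ f (Metric.ball 0 1))
    (hinj : Set.InjOn f (Metric.ball 0 1))
    (h0 : f 0 = 0) (h1 : deriv f 0 = 1) :
    ∀ n : ℕ, 1 ≤ n →
      Set.InjOn
        (fun z : ℂ => ∑ k ∈ Finset.Icc 1 n,
          (iteratedDeriv k f 0 / (k.factorial : ℂ)) * z ^ k)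
        (Metric.ball 0 (1 / 4)) := by
  intro n hn
  exact IsSchlicht.injOn_section ⟨hdiff, hinj, h0, h1⟩ hn
end

section
/- For every real number r > 1/4, the polynomial map z ↦ z + 2z² (the second partial sum of the Koebe function k(z) = z/(1−z)² = Σ_{p≥1} p zᵖ) is NOT injective on the open disc {z ∈ ℂ : |z| < r}. -/
/-- Sharpness of the radius 1/4 in Szegő's theorem: for every `r > 1/4` the
second section `z + 2z²` of the Koebe function fails to be injective on the
open disc of radius `r`. -/
theorem szego_sharp (r : ℝ) (hr : 1 / 4 < r) :
    ¬ Set.InjOn (fun z : ℂ => z + 2 * z ^ 2) (Metric.ball 0 r) := by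
  intro h
  -- `z + 2z²` takes equal values at points symmetric about its critical point `-1/4`.
  obtain ⟨e, he, her⟩ : ∃ e : ℝ, 0 < e ∧ 1 / 4 + e < r :=
    ⟨(r - 1 / 4) / 2, by linarith, by linarith⟩
  have hmem : ∀ t : ℝ, |t| < r → (t : ℂ) ∈ Metric.ball (0 : ℂ) r := by
    intro t ht
    rwa [mem_ball_zero_iff, Complex.norm_real, Real.norm_eq_abs]
  have heq : ((-1 / 4 + e : ℝ) : ℂ) = ((-1 / 4 - e : ℝ) : ℂ) := by
    refine h (hmem _ ?_) (hmem _ ?_) ?_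
    · rw [abs_lt]; constructor <;> linarith
    · rw [abs_lt]; constructor <;> linarith
    · push_cast
      ring
  have := Complex.ofReal_injective heq
  linarith
end
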